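/- Let (n,m) be either (2,4) or (3,3), let k ≥ 1, and set q = 2k + m. Then there exist a closed subgroup G of SO(n,q) that is isogenous to SO(n,m), and a non-cocompact lattice Λ in SO(n,q), such that Λ ∩ G is a cocompact lattice in G (i.e. Λ ∩ G is discrete in G and G/(Λ ∩ G) is compact). -/

import Mathlib

open Matrix MeasureTheory

/-- A lattice in a topological group `G` with respect to a (left Haar) measure `μ`:
a discrete subgroup admitting a Borel fundamental domain of finite measure. -/
def IsLattice {G : Type*} [Group G] [TopologicalSpace G] [MeasurableSpace G]
    (μ : Measure G) (Λ : Subgroup G) : Prop :=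
  DiscreteTopology Λ ∧
    ∃ D : Set G, MeasurableSet D ∧ μ D < ⊤ ∧
      (∀ g : G, ∃ γ : Λ, ∃ d ∈ D, g = (γ : G) * d) ∧
      ∀ d₁ ∈ D, ∀ d₂ ∈ D, ∀ γ : Λ, d₁ = (γ : G) * d₂ → d₁ = d₂

/-- Two topological groups are isogenous if a common topological group surjects onto both
by continuous open homomorphisms with finite kernels. -/
def Isogenous (G₁ : Type*) (G₂ : Type*) [Group G₁] [TopologicalSpace G₁]
    [Group G₂] [TopologicalSpace G₂] : Prop :=
  ∃ (L : Type) (_ : Group L) (_ : TopologicalSpace L) (p₁ : L →* G₁) (p₂ : L →* G₂),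
    Continuous p₁ ∧ IsOpenMap p₁ ∧ Function.Surjective p₁ ∧ (p₁.ker : Set L).Finite ∧
    Continuous p₂ ∧ IsOpenMap p₂ ∧ Function.Surjective p₂ ∧ (p₂.ker : Set L).Finite

/-- The special orthogonal group of the symmetric bilinear form with matrix `J`,
as a subgroup of the general linear group. -/
def SOQ {ι : Type*} [Fintype ι] [DecidableEq ι] (J : Matrix ι ι ℝ) :
    Subgroup (GL ι ℝ) where
  carrier := {A | A.val.det = 1 ∧ A.valᵀ * J * A.val = J}
  one_mem' := by simp
  mul_mem' := by
    rintro A B ⟨hAd, hAf⟩ ⟨hBd, hBf⟩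
    refine ⟨by simp [Units.val_mul, hAd, hBd], ?_⟩
    show (A.val * B.val)ᵀ * J * (A.val * B.val) = J
    rw [Matrix.transpose_mul]
    calc B.valᵀ * A.valᵀ * J * (A.val * B.val)
        = B.valᵀ * (A.valᵀ * J * A.val) * B.val := by simp only [Matrix.mul_assoc]
      _ = J := by rw [hAf, hBf]
  inv_mem' := by
    rintro A ⟨hAd, hAf⟩
    have h1 : A.val * (A⁻¹).val = 1 := by
      rw [← Units.val_mul, mul_inv_cancel, Units.val_one]
    refine ⟨?_, ?_⟩
    · have h2 : A.val.det * (A⁻¹).val.det = 1 := by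
        rw [← Matrix.det_mul, h1, Matrix.det_one]
      rwa [hAd, one_mul] at h2
    · have e1 : (A⁻¹).valᵀ * (A.valᵀ * J * A.val) * (A⁻¹).val
          = (A⁻¹).valᵀ * J * (A⁻¹).val := by rw [hAf]
      have ht : (A⁻¹).valᵀ * A.valᵀ = 1 := by
        rw [← Matrix.transpose_mul, h1, Matrix.transpose_one]
      have e2 : (A⁻¹).valᵀ * (A.valᵀ * J * A.val) * (A⁻¹).val = J := by
        calc (A⁻¹).valᵀ * (A.valᵀ * J * A.val) * (A⁻¹).val
            = ((A⁻¹).valᵀ * A.valᵀ) * (J * (A.val * (A⁻¹).val)) := by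
              simp only [Matrix.mul_assoc]
          _ = J := by rw [ht, h1, Matrix.one_mul, Matrix.mul_one]
      rw [← e1]; exact e2

/-- `SO(n,m)`: real matrices of determinant 1 with `Aᵀ Jₙₘ A = Jₙₘ`. -/
def SOnm (n m : ℕ) : Subgroup (GL (Fin (n + m)) ℝ) :=
  SOQ (Matrix.diagonal fun i : Fin (n + m) => if (i : ℕ) < n then (1 : ℝ) else -1)

/-- The entrywise `ℓ¹` size of a real matrix. -/
def entryNorm {α β : Type*} [Fintype α] [Fintype β] (A : Matrix α β ℝ) : ℝ :=
  ∑ i, ∑ j, |A i j|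

section entryNorm
variable {α β γ : Type*} [Fintype α] [Fintype β] [Fintype γ]

lemma entryNorm_nonneg (A : Matrix α β ℝ) : 0 ≤ entryNorm A :=
  Finset.sum_nonneg fun _ _ => Finset.sum_nonneg fun _ _ => abs_nonneg _

lemma abs_le_entryNorm (A : Matrix α β ℝ) (i : α) (j : β) : |A i j| ≤ entryNorm A :=
  (Finset.single_le_sum (f := fun j => |A i j|) (fun _ _ => abs_nonneg _)
    (Finset.mem_univ j)).trans
  (Finset.single_le_sum (f := fun i => ∑ j, |A i j|)
    (fun _ _ => Finset.sum_nonneg fun _ _ => abs_nonneg _) (Finset.mem_univ i))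

lemma entryNorm_zero : entryNorm (0 : Matrix α β ℝ) = 0 := by simp [entryNorm]

lemma entryNorm_eq_zero {A : Matrix α β ℝ} : entryNorm A = 0 ↔ A = 0 := by
  refine ⟨fun h => ?_, fun h => by rw [h, entryNorm_zero]⟩
  ext i j
  have := abs_le_entryNorm A i j
  rw [h] at this
  simpa using this

lemma entryNorm_pos {A : Matrix α β ℝ} (h : A ≠ 0) : 0 < entryNorm A :=
  lt_of_le_of_ne (entryNorm_nonneg A) fun h' => h (entryNorm_eq_zero.1 h'.symm)

lemma entryNorm_add_le (A B : Matrix α β ℝ) : entryNorm (A + B) ≤ entryNorm A + entryNorm B := by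
  simp only [entryNorm, ← Finset.sum_add_distrib]
  exact Finset.sum_le_sum fun _ _ => Finset.sum_le_sum fun _ _ => abs_add_le _ _

lemma entryNorm_neg (A : Matrix α β ℝ) : entryNorm (-A) = entryNorm A := by
  simp [entryNorm]

lemma entryNorm_sub_le (A B : Matrix α β ℝ) : entryNorm (A - B) ≤ entryNorm A + entryNorm B := by
  rw [sub_eq_add_neg, ← entryNorm_neg B]
  exact entryNorm_add_le _ _

lemma entryNorm_smul (c : ℝ) (A : Matrix α β ℝ) : entryNorm (c • A) = |c| * entryNorm A := by
  simp [entryNorm, abs_mul, Finset.mul_sum]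

lemma entryNorm_transpose (A : Matrix α β ℝ) : entryNorm Aᵀ = entryNorm A := by
  simp only [entryNorm, Matrix.transpose_apply]
  exact Finset.sum_comm

lemma entryNorm_mul_le (A : Matrix α β ℝ) (B : Matrix β γ ℝ) :
    entryNorm (A * B) ≤ entryNorm A * entryNorm B := by
  have h1 : entryNorm (A * B) ≤ ∑ i, ∑ k, ∑ j, |A i j| * |B j k| := by
    refine Finset.sum_le_sum fun i _ => Finset.sum_le_sum fun k _ => ?_
    rw [Matrix.mul_apply]
    exact (Finset.abs_sum_le_sum_abs _ _).trans_eq (by simp [abs_mul])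
  have h2 : ∑ i, ∑ k, ∑ j, |A i j| * |B j k| = ∑ i, ∑ j, |A i j| * ∑ k, |B j k| := by
    refine Finset.sum_congr rfl fun i _ => ?_
    rw [Finset.sum_comm]
    simp [Finset.mul_sum]
  have h3 : ∑ i, ∑ j, |A i j| * ∑ k, |B j k| ≤ ∑ i, ∑ j, |A i j| * entryNorm B := by
    refine Finset.sum_le_sum fun i _ => Finset.sum_le_sum fun j _ => ?_
    refine mul_le_mul_of_nonneg_left ?_ (abs_nonneg _)
    exact Finset.single_le_sum (f := fun j => ∑ k, |B j k|)
      (fun _ _ => Finset.sum_nonneg fun _ _ => abs_nonneg _) (Finset.mem_univ j)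
  rw [h2] at h1
  refine (h1.trans h3).trans_eq ?_
  simp [entryNorm, Finset.sum_mul]

lemma continuous_entryNorm : Continuous (entryNorm : Matrix α β ℝ → ℝ) := by
  unfold entryNorm
  fun_prop

lemma isCompact_entryNorm_le (R : ℝ) : IsCompact {A : Matrix α β ℝ | entryNorm A ≤ R} := by
  have h1 : IsCompact (Set.pi Set.univ fun _ : α => Set.pi Set.univ fun _ : β => Set.Icc (-R) R) :=
    isCompact_univ_pi fun _ => isCompact_univ_pi fun _ => isCompact_Icc
  refine h1.of_isClosed_subset (isClosed_le continuous_entryNorm continuous_const) ?_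
  intro A hA i _ j _
  exact abs_le.1 ((abs_le_entryNorm A i j).trans hA)

lemma abs_det_two_le (A : Matrix (Fin 2) (Fin 2) ℝ) : |A.det| ≤ entryNorm A ^ 2 := by
  have h : ∀ i j, |A i j| ≤ entryNorm A := abs_le_entryNorm A
  rw [Matrix.det_fin_two]
  have e : entryNorm A = |A 0 0| + |A 0 1| + (|A 1 0| + |A 1 1|) := by
    simp [entryNorm, Fin.sum_univ_two]
  calc |A 0 0 * A 1 1 - A 0 1 * A 1 0| ≤ |A 0 0 * A 1 1| + |A 0 1 * A 1 0| := abs_sub _ _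
    _ = |A 0 0| * |A 1 1| + |A 0 1| * |A 1 0| := by rw [abs_mul, abs_mul]
    _ ≤ entryNorm A ^ 2 := by
      rw [e]
      have := abs_nonneg (A 0 0); have := abs_nonneg (A 0 1)
      have := abs_nonneg (A 1 0); have := abs_nonneg (A 1 1)
      nlinarith [mul_nonneg (abs_nonneg (A 0 0)) (abs_nonneg (A 1 1)),
        mul_nonneg (abs_nonneg (A 0 1)) (abs_nonneg (A 1 0)),
        mul_nonneg (abs_nonneg (A 0 0)) (abs_nonneg (A 0 1)),
        mul_nonneg (abs_nonneg (A 0 0)) (abs_nonneg (A 1 0)),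
        mul_nonneg (abs_nonneg (A 0 1)) (abs_nonneg (A 1 1)),
        mul_nonneg (abs_nonneg (A 1 0)) (abs_nonneg (A 1 1))]

end entryNorm

section reflection
variable {ι : Type*} [Fintype ι] [DecidableEq ι]

lemma dotProduct_mulVec_antisymm {w : Matrix ι ι ℝ} (hw : wᵀ = -w) (a b : ι → ℝ) :
    a ⬝ᵥ w *ᵥ b = -(b ⬝ᵥ w *ᵥ a) := by
  rw [Matrix.dotProduct_mulVec, ← Matrix.mulVec_transpose, hw, Matrix.neg_mulVec,
    neg_dotProduct, dotProduct_comm]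

lemma dotProduct_mulVec_self_antisymm {w : Matrix ι ι ℝ} (hw : wᵀ = -w) (a : ι → ℝ) :
    a ⬝ᵥ w *ᵥ a = 0 := by
  have := dotProduct_mulVec_antisymm hw a a
  linarith

/-- The reflection `v ↦ v - s B(x,v) x`, where `B` has matrix `J`. -/
def formRefl (J : Matrix ι ι ℝ) (s : ℝ) (x : ι → ℝ) : Matrix ι ι ℝ :=
  1 - s • vecMulVec x (J *ᵥ x)

lemma det_formRefl (J : Matrix ι ι ℝ) (s : ℝ) (x : ι → ℝ) :
    (formRefl J s x).det = 1 - s * (x ⬝ᵥ J *ᵥ x) := by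
  have : formRefl J s x =
      1 + Matrix.replicateCol Unit ((-s) • x) * Matrix.replicateRow Unit (J *ᵥ x) := by
    ext i j
    simp [formRefl, vecMulVec_apply, Matrix.mul_apply, sub_eq_add_neg, mul_assoc]
  rw [this, Matrix.det_one_add_replicateCol_mul_replicateRow, dotProduct_smul,
    dotProduct_comm, smul_eq_mul]
  ring

lemma formRefl_form {J : Matrix ι ι ℝ} (hJ : Jᵀ = J) {s : ℝ} {x : ι → ℝ}
    (hx : s * (x ⬝ᵥ J *ᵥ x) = 2) :
    (formRefl J s x)ᵀ * J * formRefl J s x = J := by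
  have h1 : x ᵥ* J = J *ᵥ x := by rw [← Matrix.mulVec_transpose, hJ]
  have h2 : (J *ᵥ x) ⬝ᵥ x = x ⬝ᵥ J *ᵥ x := dotProduct_comm _ _
  have h3 : J * formRefl J s x = J - s • vecMulVec (J *ᵥ x) (J *ᵥ x) := by
    simp only [formRefl, Matrix.mul_sub, Matrix.mul_one, mul_smul_comm, mul_vecMulVec]
  have h4 : (formRefl J s x)ᵀ = 1 - s • vecMulVec (J *ᵥ x) x := by
    simp only [formRefl, transpose_sub, transpose_one, transpose_smul, transpose_vecMulVec]
  rw [Matrix.mul_assoc, h3, h4, Matrix.sub_mul, Matrix.one_mul, Matrix.mul_sub, smul_mul_assoc,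
    smul_mul_assoc, mul_smul_comm, vecMulVec_mul_vecMulVec, vecMulVec_mul, h1, vecMulVec_smul]
  have : s * (s * (x ⬝ᵥ J *ᵥ x)) = 2 * s := by rw [hx]; ring
  rw [smul_smul, smul_smul, mul_assoc s s, this]
  module

lemma formRefl_mul_self {J : Matrix ι ι ℝ} {s : ℝ} {x : ι → ℝ}
    (hx : s * (x ⬝ᵥ J *ᵥ x) = 2) :
    formRefl J s x * formRefl J s x = 1 := by
  have h2 : (J *ᵥ x) ⬝ᵥ x = x ⬝ᵥ J *ᵥ x := dotProduct_comm _ _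
  simp only [formRefl]
  rw [Matrix.sub_mul, Matrix.one_mul, Matrix.mul_sub, mul_smul_comm,
    smul_mul_assoc, smul_mul_assoc, vecMulVec_mul_vecMulVec, Matrix.mul_one, vecMulVec_smul, h2]
  have : s * (s * (x ⬝ᵥ J *ᵥ x)) = 2 * s := by rw [hx]; ring
  rw [smul_smul, smul_smul, mul_assoc s s, this]
  module

/-- The antisymmetric matrix of the bivector `a ∧ b`. -/
def wedge (a b : ι → ℝ) : Matrix ι ι ℝ := vecMulVec a b - vecMulVec b a

lemma wedge_add_left (a a' b : ι → ℝ) : wedge (a + a') b = wedge a b + wedge a' b := by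
  simp only [wedge, add_vecMulVec, vecMulVec_add]; abel

lemma wedge_add_right (a b b' : ι → ℝ) : wedge a (b + b') = wedge a b + wedge a b' := by
  simp only [wedge, add_vecMulVec, vecMulVec_add]; abel

lemma wedge_smul_left (c : ℝ) (a b : ι → ℝ) : wedge (c • a) b = c • wedge a b := by
  simp only [wedge, smul_vecMulVec, vecMulVec_smul, smul_sub]

lemma wedge_smul_right (c : ℝ) (a b : ι → ℝ) : wedge a (c • b) = c • wedge a b := by
  simp only [wedge, smul_vecMulVec, vecMulVec_smul, smul_sub]

lemma entryNorm_wedge_le (a b : ι → ℝ) (w : Matrix ι ι ℝ) :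
    entryNorm (wedge a (w *ᵥ b)) ≤ 2 * entryNorm (vecMulVec a b) * entryNorm w := by
  have h : wedge a (w *ᵥ b) = vecMulVec a b * wᵀ - w * vecMulVec b a := by
    rw [wedge, vecMulVec_mul, mul_vecMulVec, Matrix.vecMul_transpose]
  have h2 : entryNorm (vecMulVec b a) = entryNorm (vecMulVec a b) := by
    rw [← entryNorm_transpose, transpose_vecMulVec]
  rw [h]
  refine (entryNorm_sub_le _ _).trans ?_
  have h3 := entryNorm_mul_le (vecMulVec a b) wᵀ
  have h4 := entryNorm_mul_le w (vecMulVec b a)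
  rw [entryNorm_transpose] at h3
  rw [h2] at h4
  linarith

lemma formRefl_conj (J : Matrix ι ι ℝ) (s : ℝ) (x : ι → ℝ) {w : Matrix ι ι ℝ} (hw : wᵀ = -w) :
    formRefl J s x * w * (formRefl J s x)ᵀ = w + s • wedge x (w *ᵥ (J *ᵥ x)) := by
  have h4 : (formRefl J s x)ᵀ = 1 - s • vecMulVec (J *ᵥ x) x := by
    simp only [formRefl, transpose_sub, transpose_one, transpose_smul, transpose_vecMulVec]
  have h5 : (J *ᵥ x) ᵥ* w = -(w *ᵥ (J *ᵥ x)) := by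
    rw [← Matrix.mulVec_transpose, hw, Matrix.neg_mulVec]
  have h6 : w *ᵥ (J *ᵥ x) ⬝ᵥ (J *ᵥ x) = 0 := by
    rw [dotProduct_comm, dotProduct_mulVec_self_antisymm hw]
  rw [h4]
  simp only [formRefl]
  rw [Matrix.sub_mul, Matrix.one_mul, smul_mul_assoc, vecMulVec_mul, h5, Matrix.mul_sub,
    Matrix.mul_one, Matrix.sub_mul, mul_smul_comm, smul_mul_assoc, mul_smul_comm, mul_vecMulVec,
    vecMulVec_mul_vecMulVec, neg_dotProduct, h6, neg_zero, zero_smul, vecMulVec_zero,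
    vecMulVec_neg, wedge]
  module

lemma entryNorm_formRefl_conj (J : Matrix ι ι ℝ) (e n : ι → ℝ) :
    ∃ C : ℝ, ∀ s : ℝ, 1 ≤ s → ∀ w : Matrix ι ι ℝ, wᵀ = -w →
      s * entryNorm (wedge e (w *ᵥ (J *ᵥ e))) - C * entryNorm w ≤
        entryNorm (formRefl J s (e + s⁻¹ • n) * w * (formRefl J s (e + s⁻¹ • n))ᵀ) := by
  refine ⟨1 + 2 * entryNorm (vecMulVec e (J *ᵥ n)) + 2 * entryNorm (vecMulVec n (J *ᵥ e)) +
    2 * entryNorm (vecMulVec n (J *ᵥ n)), fun s hs w hw => ?_⟩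
  have hs0 : s ≠ 0 := by positivity
  set A := formRefl J s (e + s⁻¹ • n) * w * (formRefl J s (e + s⁻¹ • n))ᵀ with hA
  have h1 : s • wedge e (w *ᵥ (J *ᵥ e)) = A - (w + (wedge e (w *ᵥ (J *ᵥ n)) +
      (wedge n (w *ᵥ (J *ᵥ e)) + s⁻¹ • wedge n (w *ᵥ (J *ᵥ n))))) := by
    rw [hA, formRefl_conj J _ _ hw]
    simp only [mulVec_add, mulVec_smul, wedge_add_left, wedge_add_right, wedge_smul_left,
      wedge_smul_right, smul_add, smul_smul, mul_inv_cancel₀ hs0, one_smul]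
    have : s * (s⁻¹ * s⁻¹) = s⁻¹ := by field_simp
    rw [this]
    abel
  have h2 : s * entryNorm (wedge e (w *ᵥ (J *ᵥ e))) = entryNorm (s • wedge e (w *ᵥ (J *ᵥ e))) := by
    rw [entryNorm_smul, abs_of_nonneg (by linarith)]
  have h3 := entryNorm_wedge_le e (J *ᵥ n) w
  have h4 := entryNorm_wedge_le n (J *ᵥ e) w
  have h5 := entryNorm_wedge_le n (J *ᵥ n) w
  have h6 : entryNorm (s⁻¹ • wedge n (w *ᵥ (J *ᵥ n))) ≤ entryNorm (wedge n (w *ᵥ (J *ᵥ n))) := by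
    rw [entryNorm_smul, abs_of_nonneg (by positivity)]
    exact mul_le_of_le_one_left (entryNorm_nonneg _) (inv_le_one_of_one_le₀ hs)
  rw [h2, h1]
  have h7 := entryNorm_sub_le A (w + (wedge e (w *ᵥ (J *ᵥ n)) +
      (wedge n (w *ᵥ (J *ᵥ e)) + s⁻¹ • wedge n (w *ᵥ (J *ᵥ n)))))
  have h8 := entryNorm_add_le w (wedge e (w *ᵥ (J *ᵥ n)) +
      (wedge n (w *ᵥ (J *ᵥ e)) + s⁻¹ • wedge n (w *ᵥ (J *ᵥ n))))
  have h9 := entryNorm_add_le (wedge e (w *ᵥ (J *ᵥ n)))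
      (wedge n (w *ᵥ (J *ᵥ e)) + s⁻¹ • wedge n (w *ᵥ (J *ᵥ n)))
  have h10 := entryNorm_add_le (wedge n (w *ᵥ (J *ᵥ e))) (s⁻¹ • wedge n (w *ᵥ (J *ᵥ n)))
  linarith

lemma wedge_eq_zero {J w : Matrix ι ι ℝ} (hJw : w * J * w = 0)
    {e : ι → ℝ} (he : e ≠ 0) (h : wedge e (w *ᵥ (J *ᵥ e)) = 0) : w *ᵥ (J *ᵥ e) = 0 := by
  obtain ⟨i, hi⟩ := Function.ne_iff.1 he
  rw [Pi.zero_apply] at hi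
  set u := w *ᵥ (J *ᵥ e) with hu
  have h1 : u = (u i / e i) • e := by
    ext j
    have := congrFun (congrFun h i) j
    simp only [wedge, Matrix.sub_apply, vecMulVec_apply, Matrix.zero_apply] at this
    simp only [Pi.smul_apply, smul_eq_mul]
    field_simp
    linarith
  have h2 : w *ᵥ (J *ᵥ u) = 0 := by
    rw [hu, mulVec_mulVec, mulVec_mulVec, mulVec_mulVec,
      hJw, Matrix.zero_mul, Matrix.zero_mulVec]
  rw [h1, mulVec_smul, mulVec_smul, ← hu] at h2
  rcases smul_eq_zero.1 h2 with h3 | h3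
  · rw [h1, h3, zero_smul]
  · exact h3

end reflection

section isotropicCurve
variable {N : ℕ}

/-- The indices different from `p`, `m`, `z`. -/
def otherIdx (p m z : Fin N) : Finset (Fin N) := ((Finset.univ.erase p).erase m).erase z

lemma mem_otherIdx {p m z j : Fin N} : j ∈ otherIdx p m z ↔ j ≠ z ∧ j ≠ m ∧ j ≠ p := by
  simp [otherIdx]

lemma sum_eq_add_otherIdx {p m z : Fin N} (hpm : p ≠ m) (hpz : p ≠ z) (hmz : m ≠ z)
    (f : Fin N → ℝ) : ∑ j, f j = f p + (f m + (f z + ∑ j ∈ otherIdx p m z, f j)) := by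
  rw [otherIdx, Finset.add_sum_erase _ _ (by simp [hpz.symm, hmz.symm]),
    Finset.add_sum_erase _ _ (by simp [hpm.symm]), Finset.add_sum_erase _ _ (by simp)]

/-- The norm of the middle part of the isotropic curve. -/
noncomputable def curveNorm (ε : Fin N → ℝ) (p m z : Fin N) (t : ℝ) : ℝ :=
  ∑ j ∈ otherIdx p m z, ε j * t ^ (2 * (2 * (j : ℕ) + 1))

/-- A polynomial curve of isotropic vectors for the form `diag ε`. -/
noncomputable def isoCurve (ε : Fin N → ℝ) (p m z : Fin N) (t : ℝ) : Fin N → ℝ := fun j =>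
  if j = z then 0 else if j = p then (1 - curveNorm ε p m z t) / 2
  else if j = m then -(1 + curveNorm ε p m z t) / 2 else t ^ (2 * (j : ℕ) + 1)

variable {ε : Fin N → ℝ} {p m z : Fin N}

lemma sum_mul_isoCurve (hpm : p ≠ m) (hpz : p ≠ z) (hmz : m ≠ z) (φ : Fin N → ℝ) (t : ℝ) :
    ∑ j, φ j * isoCurve ε p m z t j = (φ p - φ m) / 2 - (φ p + φ m) / 2 * curveNorm ε p m z t +
      ∑ j ∈ otherIdx p m z, φ j * t ^ (2 * (j : ℕ) + 1) := by
  rw [sum_eq_add_otherIdx hpm hpz hmz]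
  have : ∑ j ∈ otherIdx p m z, φ j * isoCurve ε p m z t j =
      ∑ j ∈ otherIdx p m z, φ j * t ^ (2 * (j : ℕ) + 1) := by
    refine Finset.sum_congr rfl fun j hj => ?_
    obtain ⟨h1, h2, h3⟩ := mem_otherIdx.1 hj
    simp [isoCurve, h1, h2, h3]
  rw [this]
  simp only [isoCurve, hpz, hmz, hpm.symm, if_true, if_false]
  ring

lemma isoCurve_isotropic (hpm : p ≠ m) (hpz : p ≠ z) (hmz : m ≠ z) (hp : ε p = 1) (hm : ε m = -1)
    (t : ℝ) : isoCurve ε p m z t ⬝ᵥ diagonal ε *ᵥ isoCurve ε p m z t = 0 := by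
  have h : ∑ j ∈ otherIdx p m z, isoCurve ε p m z t j * (ε j * isoCurve ε p m z t j) =
      curveNorm ε p m z t := by
    refine Finset.sum_congr rfl fun j hj => ?_
    obtain ⟨h1, h2, h3⟩ := mem_otherIdx.1 hj
    simp only [isoCurve, h1, h2, h3, if_false]
    ring
  simp only [dotProduct, mulVec_diagonal]
  rw [sum_eq_add_otherIdx hpm hpz hmz, h]
  simp only [isoCurve, hpz, hmz, hpm.symm, if_true, if_false, hp, hm]
  ring

lemma exists_card_zeros_isoCurve_le (hε : ∀ i, ε i = 1 ∨ ε i = -1) (hpm : p ≠ m) (hpz : p ≠ z)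
    (hmz : m ≠ z) {j₀ : Fin N} (hj : j₀ ∈ otherIdx p m z) :
    ∃ D : ℕ, ∀ φ : Fin N → ℝ, (∃ j, j ≠ z ∧ φ j ≠ 0) → ∀ T : Finset ℕ,
      (∀ i ∈ T, ∑ j, φ j * isoCurve ε p m z (i : ℝ) j = 0) → T.card ≤ D := by
  refine ⟨4 * N + 2, fun φ hφ T hT => ?_⟩
  obtain ⟨i, hiz, hi⟩ := hφ
  let Q : Polynomial ℝ := ∑ j ∈ otherIdx p m z,
    Polynomial.C (ε j) * Polynomial.X ^ (2 * (2 * (j : ℕ) + 1))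
  let S : Polynomial ℝ := ∑ j ∈ otherIdx p m z,
    Polynomial.C (φ j) * Polynomial.X ^ (2 * (j : ℕ) + 1)
  let F : Polynomial ℝ := Polynomial.C ((φ p - φ m) / 2) - Polynomial.C ((φ p + φ m) / 2) * Q + S
  have hF : F ≠ 0 := by
    intro h0
    have hc : ∀ n, (if n = 0 then (φ p - φ m) / 2 else 0) - (φ p + φ m) / 2 *
        (∑ j ∈ otherIdx p m z, if n = 2 * (2 * (j : ℕ) + 1) then ε j else 0) +
        (∑ j ∈ otherIdx p m z, if n = 2 * (j : ℕ) + 1 then φ j else 0) = 0 := by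
      intro n
      have := congrArg (fun P => Polynomial.coeff P n) h0
      simpa [F, Q, S, Polynomial.coeff_C, Polynomial.finsetSum_coeff, Polynomial.coeff_X_pow]
        using this
    have c0 : φ p - φ m = 0 := by
      have := hc 0
      rw [Finset.sum_eq_zero (by intros; simp; try omega),
        Finset.sum_eq_zero (by intros; simp; try omega)] at this
      simp at this
      exact this
    have c1 : φ p + φ m = 0 := by
      have := hc (2 * (2 * (j₀ : ℕ) + 1))
      rw [Finset.sum_eq_single_of_mem j₀ hj (by
          intro b _ hb
          rw [if_neg]
          intro h
          exact hb (Fin.ext (by omega))),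
        Finset.sum_eq_zero (by intros; rw [if_neg]; omega)] at this
      rcases hε j₀ with h | h <;> simp [h] at this <;> linarith
    by_cases hip : i = p
    · exact hi (by rw [hip]; linarith)
    by_cases him : i = m
    · exact hi (by rw [him]; linarith)
    have := hc (2 * (i : ℕ) + 1)
    simp only [c1, zero_div, zero_mul, sub_zero] at this
    rw [Finset.sum_eq_single_of_mem i (mem_otherIdx.2 ⟨hiz, him, hip⟩) (by
      intro b _ hb
      rw [if_neg]
      intro h
      exact hb (Fin.ext (by omega)))] at this
    simp at this
    exact hi this
  have hdeg : F.natDegree ≤ 4 * N + 2 := by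
    have hQ : Q.natDegree ≤ 4 * N + 2 := by
      refine Polynomial.natDegree_sum_le_of_forall_le _ _ fun j _ => ?_
      refine (Polynomial.natDegree_C_mul_X_pow_le _ _).trans ?_
      have := j.2
      omega
    have hS : S.natDegree ≤ 4 * N + 2 := by
      refine Polynomial.natDegree_sum_le_of_forall_le _ _ fun j _ => ?_
      refine (Polynomial.natDegree_C_mul_X_pow_le _ _).trans ?_
      have := j.2
      omega
    refine Polynomial.natDegree_add_le_of_degree_le
      ((Polynomial.natDegree_sub_le _ _).trans
        (max_le (by simp) ((Polynomial.natDegree_C_mul_le _ _).trans hQ))) hS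
  have hsub : T.image (fun i : ℕ => (i : ℝ)) ⊆ F.roots.toFinset := by
    intro x hx
    obtain ⟨i, hiT, rfl⟩ := Finset.mem_image.1 hx
    rw [Multiset.mem_toFinset, Polynomial.mem_roots hF, Polynomial.IsRoot]
    rw [← hT i hiT, sum_mul_isoCurve hpm hpz hmz]
    simp [F, Q, S, curveNorm, Polynomial.eval_finsetSum]
  calc T.card = (T.image (fun i : ℕ => (i : ℝ))).card :=
        (Finset.card_image_of_injective _ Nat.cast_injective).symm
    _ ≤ F.roots.toFinset.card := Finset.card_le_card hsub
    _ ≤ F.roots.card := Multiset.toFinset_card_le _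
    _ ≤ F.natDegree := Polynomial.card_roots' _
    _ ≤ _ := hdeg

end isotropicCurve

section contraction
variable {ι : Type*} [Fintype ι] [DecidableEq ι]

lemma entryNorm_diagonal_conj {ρ : ι → ℝ} (hρ : ∀ i, |ρ i| = 1) (A : Matrix ι ι ℝ) :
    entryNorm (diagonal ρ * A * diagonal ρ) = entryNorm A := by
  simp [entryNorm, abs_mul, hρ]

lemma entryNorm_formRefl_le (J : Matrix ι ι ℝ) (e n : ι → ℝ) :
    ∃ C : ℝ, ∀ s : ℝ, 1 ≤ s → entryNorm (formRefl J s (e + s⁻¹ • n)) ≤ C * s := by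
  refine ⟨entryNorm (1 : Matrix ι ι ℝ) + (entryNorm (vecMulVec e (J *ᵥ e)) +
    (entryNorm (vecMulVec e (J *ᵥ n)) + (entryNorm (vecMulVec n (J *ᵥ e)) +
    entryNorm (vecMulVec n (J *ᵥ n))))), fun s hs => ?_⟩
  have hs0 : s ≠ 0 := by positivity
  have h1 : formRefl J s (e + s⁻¹ • n) = 1 - s • (vecMulVec e (J *ᵥ e) +
      (s⁻¹ • vecMulVec e (J *ᵥ n) + (s⁻¹ • vecMulVec n (J *ᵥ e) +
      s⁻¹ • s⁻¹ • vecMulVec n (J *ᵥ n)))) := by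
    simp only [formRefl, mulVec_add, mulVec_smul, vecMulVec_add, add_vecMulVec, smul_vecMulVec,
      vecMulVec_smul, smul_add]
    abel
  have key : ∀ A : Matrix ι ι ℝ, entryNorm (s⁻¹ • A) ≤ entryNorm A := by
    intro A
    rw [entryNorm_smul, abs_of_nonneg (by positivity)]
    exact mul_le_of_le_one_left (entryNorm_nonneg _) (inv_le_one_of_one_le₀ hs)
  rw [h1, add_mul, mul_comm _ s, mul_comm _ s]
  refine (entryNorm_sub_le _ _).trans (add_le_add ?_ ?_)
  · exact le_mul_of_one_le_left (entryNorm_nonneg _) hs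
  · rw [entryNorm_smul, abs_of_nonneg (by linarith)]
    refine mul_le_mul_of_nonneg_left ?_ (by linarith)
    refine (entryNorm_add_le _ _).trans (add_le_add le_rfl ?_)
    refine (entryNorm_add_le _ _).trans (add_le_add (key _) ?_)
    refine (entryNorm_add_le _ _).trans (add_le_add (key _) ?_)
    exact (key _).trans (key _)

lemma entryNorm_le_formRefl_conj {J : Matrix ι ι ℝ} {s : ℝ} {x : ι → ℝ}
    (hx : s * (x ⬝ᵥ J *ᵥ x) = 2) (w : Matrix ι ι ℝ) :
    entryNorm w ≤ entryNorm (formRefl J s x) ^ 2 *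
      entryNorm (formRefl J s x * w * (formRefl J s x)ᵀ) := by
  set r := formRefl J s x with hr
  have h1 : r * r = 1 := formRefl_mul_self hx
  have h2 : rᵀ * rᵀ = 1 := by rw [← transpose_mul, h1, transpose_one]
  have h3 : w = r * (r * w * rᵀ) * rᵀ := by
    calc w = (r * r) * w * (rᵀ * rᵀ) := by rw [h1, h2, Matrix.one_mul, Matrix.mul_one]
      _ = _ := by simp only [Matrix.mul_assoc]
  have h4 := entryNorm_mul_le (r * (r * w * rᵀ)) rᵀ
  have h5 := entryNorm_mul_le r (r * w * rᵀ)
  rw [← h3, entryNorm_transpose] at h4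
  have := mul_le_mul_of_nonneg_right h5 (entryNorm_nonneg r)
  calc entryNorm w ≤ _ := h4
    _ ≤ _ := this
    _ = _ := by ring

/-- The involution `ρ_z r_x` for a vector `x` with `x_z = 0`. -/
lemma exists_involution {ε : ι → ℝ} (hε : ∀ i, ε i = 1 ∨ ε i = -1) {z : ι} {s : ℝ} {x : ι → ℝ}
    (hz : x z = 0) (hx : s * (x ⬝ᵥ diagonal ε *ᵥ x) = 2) :
    ∃ h : SOQ (diagonal ε), h * h = 1 ∧ ∀ w : Matrix ι ι ℝ,
      entryNorm (h.1.val * w * h.1.valᵀ) =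
        entryNorm (formRefl (diagonal ε) s x * w * (formRefl (diagonal ε) s x)ᵀ) := by
  set J := diagonal ε with hJ
  set ρ : ι → ℝ := fun j => if j = z then -1 else 1 with hρ
  have hρ1 : ∀ j, ρ j * ρ j = 1 := by intro j; simp only [hρ]; split_ifs <;> norm_num
  have hρ2 : ∀ j, |ρ j| = 1 := by intro j; simp only [hρ]; split_ifs <;> norm_num
  set r := formRefl J s x with hr
  have hrr : r * r = 1 := formRefl_mul_self hx
  have hc : diagonal ρ * r = r * diagonal ρ := by
    have e1 : diagonal ρ *ᵥ x = x := by
      ext j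
      simp only [mulVec_diagonal, hρ]
      split_ifs with h
      · rw [h, hz]; simp
      · simp
    have e2 : (J *ᵥ x) ᵥ* diagonal ρ = J *ᵥ x := by
      ext j
      simp only [vecMul_diagonal, hJ, mulVec_diagonal, hρ]
      split_ifs with h
      · rw [h, hz]; simp
      · simp
    simp only [hr, formRefl, Matrix.mul_sub, Matrix.sub_mul, mul_smul_comm, smul_mul_assoc,
      mul_vecMulVec, vecMulVec_mul, e1, e2, Matrix.mul_one, Matrix.one_mul]
  have hρρ : diagonal ρ * diagonal ρ = 1 := by
    rw [diagonal_mul_diagonal]; simp [hρ1]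
  have hsq : diagonal ρ * r * (diagonal ρ * r) = 1 := by
    calc diagonal ρ * r * (diagonal ρ * r) = diagonal ρ * r * (r * diagonal ρ) := by rw [hc]
      _ = diagonal ρ * (r * r) * diagonal ρ := by simp only [Matrix.mul_assoc]
      _ = 1 := by rw [hrr, Matrix.mul_one, hρρ]
  have hdet : (diagonal ρ * r).det = 1 := by
    rw [Matrix.det_mul, det_diagonal, hr, det_formRefl, hx]
    have : ∏ i, ρ i = -1 := by
      rw [Finset.prod_eq_single z (fun b _ hb => by simp [hρ, hb]) (by simp)]
      simp [hρ]
    rw [this]; norm_num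
  have hform : (diagonal ρ * r)ᵀ * J * (diagonal ρ * r) = J := by
    have e3 : diagonal ρ * J * diagonal ρ = J := by
      rw [hJ, diagonal_mul_diagonal, diagonal_mul_diagonal]
      congr 1
      ext j
      have := hρ1 j
      linear_combination ε j * this
    calc (diagonal ρ * r)ᵀ * J * (diagonal ρ * r)
        = rᵀ * (diagonal ρ * J * diagonal ρ) * r := by
          rw [transpose_mul, diagonal_transpose]; simp only [Matrix.mul_assoc]
      _ = J := by rw [e3, hr, formRefl_form (by rw [hJ, diagonal_transpose]) hx]
  refine ⟨⟨⟨diagonal ρ * r, diagonal ρ * r, hsq, hsq⟩, hdet, hform⟩, ?_, ?_⟩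
  · apply Subtype.ext
    apply Units.ext
    exact hsq
  · intro w
    show entryNorm (diagonal ρ * r * w * (diagonal ρ * r)ᵀ) = _
    rw [← entryNorm_diagonal_conj hρ2 (r * w * rᵀ), transpose_mul, diagonal_transpose]
    simp only [Matrix.mul_assoc]

/-- The cone of antisymmetric matrices whose image is isotropic. -/
def isoCone (J : Matrix ι ι ℝ) : Set (Matrix ι ι ℝ) := {w | wᵀ = -w ∧ w * J * w = 0}

lemma isClosed_isoCone (J : Matrix ι ι ℝ) : IsClosed (isoCone J) := by
  refine IsClosed.and (isClosed_eq ?_ ?_) (isClosed_eq ?_ ?_) <;> fun_prop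

lemma isoCone_smul {J w : Matrix ι ι ℝ} (hw : w ∈ isoCone J) (c : ℝ) : c • w ∈ isoCone J := by
  refine ⟨by rw [transpose_smul, hw.1, smul_neg], ?_⟩
  rw [smul_mul_assoc, smul_mul_assoc, mul_smul_comm, hw.2, smul_zero, smul_zero]

lemma exists_uniform_nonvanishing {r D : ℕ} {K : Set (Matrix ι ι ℝ)} (hK : IsCompact K)
    (f : Fin r → Matrix ι ι ℝ → ℝ) (hf : ∀ i, Continuous (f i)) (hf0 : ∀ i w, 0 ≤ f i w)
    (h : ∀ w ∈ K, ∀ T : Finset (Fin r), (∀ i ∈ T, f i w = 0) → T.card ≤ D) :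
    ∃ η > 0, ∀ w ∈ K, (Finset.univ.filter fun i => f i w < η).card ≤ D := by
  have h1 : ∀ T : Finset (Fin r), T.card = D + 1 → ∃ η > 0, ∀ w ∈ K, η ≤ ∑ i ∈ T, f i w := by
    intro T hT
    rcases K.eq_empty_or_nonempty with rfl | hne
    · exact ⟨1, one_pos, by simp⟩
    obtain ⟨w0, hw0, hmin⟩ := hK.exists_isMinOn hne
      (f := fun w => ∑ i ∈ T, f i w) (continuous_finsetSum _ fun i _ => hf i).continuousOn
    refine ⟨∑ i ∈ T, f i w0, ?_, fun w hw => hmin hw⟩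
    refine lt_of_le_of_ne (Finset.sum_nonneg fun i _ => hf0 i w0) fun h0 => ?_
    have := h w0 hw0 T ((Finset.sum_eq_zero_iff_of_nonneg fun i _ => hf0 i w0).1 h0.symm)
    omega
  choose! η hη hη2 using h1
  have h2 : ∀ᶠ x in nhdsWithin (0 : ℝ) (Set.Ioi 0), ∀ T : Finset (Fin r), T.card = D + 1 →
      (D + 1 : ℝ) * x < η T := by
    rw [Filter.eventually_all]
    intro T
    by_cases hT : T.card = D + 1
    · have : Set.Ioo (0 : ℝ) (η T / (D + 1)) ∈ nhdsWithin (0 : ℝ) (Set.Ioi 0) :=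
        Ioo_mem_nhdsGT (div_pos (hη T hT) (by positivity))
      filter_upwards [this] with x hx _
      have := hx.2
      rw [lt_div_iff₀ (by positivity)] at this
      linarith
    · exact Filter.Eventually.of_forall fun x h => absurd h hT
  obtain ⟨x, hx, hx0⟩ := (h2.and self_mem_nhdsWithin).exists
  refine ⟨x, hx0, fun w hw => ?_⟩
  by_contra! hlt
  obtain ⟨T, hTs, hT⟩ := Finset.exists_subset_card_eq (Nat.succ_le_of_lt hlt)
  have h3 : ∑ i ∈ T, f i w ≤ ∑ i ∈ T, x :=
    Finset.sum_le_sum fun i hi => (Finset.mem_filter.1 (hTs hi)).2.le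
  have h4 := hη2 T hT w hw
  have h5 := hx T hT
  rw [Finset.sum_const, hT, nsmul_eq_mul] at h3
  push_cast at h3
  linarith

end contraction

section contractionLemma

/-- On the isotropic cone, suitable finitely many involutions contract `w ↦ ‖w‖ ^ (-δ)`
on average. -/
theorem exists_contracting_involutions {N : ℕ} {ε : Fin N → ℝ} (hε : ∀ i, ε i = 1 ∨ ε i = -1)
    {p m z j₀ : Fin N} (hpm : p ≠ m) (hpz : p ≠ z) (hmz : m ≠ z) (hj : j₀ ∈ otherIdx p m z)
    (hp : ε p = 1) (hm : ε m = -1) :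
    ∃ (r : ℕ) (h : Fin r → SOQ (diagonal ε)) (δ : ℝ), 0 < r ∧ 0 < δ ∧ (∀ i, h i * h i = 1) ∧
      ∀ w ∈ isoCone (diagonal ε), w ≠ 0 →
        ∑ i, entryNorm ((h i).1.val * w * (h i).1.valᵀ) ^ (-δ) ≤
          3 / 4 * r * entryNorm w ^ (-δ) := by
  obtain ⟨D₀, hD₀⟩ := exists_card_zeros_isoCurve_le hε hpm hpz hmz hj
  set D := D₀ + 1 with hD
  obtain ⟨r, hr⟩ : ∃ r, r = 256 * D := ⟨_, rfl⟩
  set J := diagonal ε with hJ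
  let e : Fin r → Fin N → ℝ := fun i => isoCurve ε p m z ((i : ℕ) : ℝ)
  let n₀ : Fin N → ℝ := Pi.single p 1 + Pi.single m 1
  have hee : ∀ i, e i ⬝ᵥ J *ᵥ e i = 0 := fun i => isoCurve_isotropic hpm hpz hmz hp hm _
  have hJn : J *ᵥ n₀ = Pi.single p 1 - Pi.single m 1 := by
    ext j
    simp only [hJ, mulVec_diagonal, n₀, Pi.add_apply, Pi.sub_apply, Pi.single_apply]
    by_cases h1 : j = p
    · simp [h1, hpm, hp]
    · by_cases h2 : j = m <;> simp [h1, h2, hm, hpm.symm]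
  have hen : ∀ i, e i ⬝ᵥ J *ᵥ n₀ = 1 := by
    intro i
    rw [hJn, dotProduct_sub, dotProduct_single, dotProduct_single]
    simp only [e, isoCurve, hpz, hmz, hpm.symm, if_true, if_false]
    ring
  have hnn : n₀ ⬝ᵥ J *ᵥ n₀ = 0 := by
    rw [hJn, dotProduct_sub, dotProduct_single, dotProduct_single]
    simp [n₀, hpm, hpm.symm]
  have hne : ∀ i, n₀ ⬝ᵥ J *ᵥ e i = 1 := by
    intro i
    rw [Matrix.dotProduct_mulVec, ← Matrix.mulVec_transpose, hJ, diagonal_transpose, ← hJ,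
      dotProduct_comm, hen]
  have he0 : ∀ i, e i ≠ 0 := by
    intro i h0
    have := hen i
    rw [h0, zero_dotProduct] at this
    exact zero_ne_one this
  have hx : ∀ i (s : ℝ), 1 ≤ s → s * ((e i + s⁻¹ • n₀) ⬝ᵥ J *ᵥ (e i + s⁻¹ • n₀)) = 2 := by
    intro i s hs
    have : s ≠ 0 := by positivity
    simp only [mulVec_add, mulVec_smul, add_dotProduct, dotProduct_add, smul_dotProduct,
      dotProduct_smul, hee, hen, hne, hnn, smul_eq_mul]
    field_simp
    ring
  have hez : ∀ i (s : ℝ), (e i + s⁻¹ • n₀) z = 0 := by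
    intro i s
    simp [e, isoCurve, n₀, hpz.symm, hmz.symm]
  -- uniform nonvanishing on the unit sphere of the cone
  let K : Set (Matrix (Fin N) (Fin N) ℝ) := isoCone J ∩ {w | entryNorm w = 1}
  have hK : IsCompact K := by
    refine (isCompact_entryNorm_le 1).of_isClosed_subset
      ((isClosed_isoCone J).inter (isClosed_eq continuous_entryNorm continuous_const)) ?_
    intro w hw
    exact hw.2.le
  obtain ⟨η, hη, hηK⟩ := exists_uniform_nonvanishing (D := D) hK
    (fun i w => entryNorm (wedge (e i) (w *ᵥ (J *ᵥ e i))))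
    (fun i => continuous_entryNorm.comp (by unfold wedge; fun_prop))
    (fun i w => entryNorm_nonneg _) (by
      intro w hw T hT
      have hw0 : w ≠ 0 := by
        rintro rfl
        have := hw.2
        rw [Set.mem_ofPred_eq, entryNorm_zero] at this
        exact zero_ne_one this
      have hu : ∀ i ∈ T, w *ᵥ (J *ᵥ e i) = 0 := fun i hi =>
        wedge_eq_zero hw.1.2 (he0 i) (entryNorm_eq_zero.1 (hT i hi))
      obtain ⟨a, b, hb, hab⟩ : ∃ a b, b ≠ z ∧ w a b ≠ 0 := by
        by_contra! hcon
        apply hw0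
        ext a b
        by_cases hb : b = z
        · by_cases ha : a = z
          · have := congrFun (congrFun hw.1.1 a) b
            rw [hb, ha] at this ⊢
            simp only [transpose_apply, Matrix.neg_apply] at this
            simp only [Matrix.zero_apply]
            linarith
          · have := congrFun (congrFun hw.1.1 a) b
            simp only [transpose_apply, Matrix.neg_apply] at this
            rw [hcon b a ha] at this
            simp only [Matrix.zero_apply]
            linarith
        · exact hcon a b hb
      have h2 := hD₀ (fun j => w a j * ε j) ⟨b, hb, mul_ne_zero hab (by
        rcases hε b with h | h <;> rw [h] <;> norm_num)⟩ (T.image fun i : Fin r => (i : ℕ)) (by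
          intro i hi
          obtain ⟨i, hiT, rfl⟩ := Finset.mem_image.1 hi
          have := congrFun (hu i hiT) a
          rw [Pi.zero_apply] at this
          rw [← this]
          refine Finset.sum_congr rfl fun j _ => ?_
          rw [hJ, mulVec_diagonal, mul_assoc])
      rw [Finset.card_image_of_injective _ Fin.val_injective] at h2
      omega)
  choose C hC using fun i => entryNorm_formRefl_conj J (e i) n₀
  choose C' hC' using fun i => entryNorm_formRefl_le J (e i) n₀
  obtain ⟨u, hu2, hu⟩ : ∃ u : ℝ, 2 ≤ u ∧ ∀ i, (1 + |C i|) / η ≤ u ∧ |C' i| ≤ u := by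
    have : ∀ᶠ u : ℝ in Filter.atTop, ∀ i, (1 + |C i|) / η ≤ u ∧ |C' i| ≤ u :=
      Filter.eventually_all.2 fun i =>
        (Filter.eventually_ge_atTop _).and (Filter.eventually_ge_atTop _)
    exact ((Filter.eventually_ge_atTop 2).and this).exists
  have hu0 : 0 < u := by linarith
  have hM1 : 1 ≤ u ^ 2 := by nlinarith
  choose h hh hhw using fun i => exists_involution (x := e i + (u ^ 2)⁻¹ • n₀) hε (hez i _)
    (hx i (u ^ 2) hM1)
  have hlog : 0 < Real.log u := Real.log_pos (by linarith)
  set δ := Real.log 2 / Real.log u with hδ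
  have hδ0 : 0 < δ := div_pos (Real.log_pos (by norm_num)) hlog
  have huδ : u ^ (-δ) = 1 / 2 := by
    rw [Real.rpow_def_of_pos hu0]
    have : Real.log u * -δ = -Real.log 2 := by rw [hδ]; field_simp
    rw [this, Real.exp_neg, Real.exp_log (by norm_num)]; norm_num
  -- the estimate on the unit sphere
  have key : ∀ w ∈ K, ∑ i, entryNorm ((h i).1.val * w * (h i).1.valᵀ) ^ (-δ) ≤ 3 / 4 * r := by
    intro w hw
    have hw1 : entryNorm w = 1 := hw.2
    have hgood : ∀ i, η ≤ entryNorm (wedge (e i) (w *ᵥ (J *ᵥ e i))) →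
        entryNorm ((h i).1.val * w * (h i).1.valᵀ) ^ (-δ) ≤ 1 / 2 := by
      intro i hi
      rw [← huδ]
      refine Real.rpow_le_rpow_of_nonpos hu0 ?_ (by linarith)
      rw [hhw]
      refine le_trans ?_ (hC i _ hM1 w hw.1.1)
      rw [hw1, mul_one]
      have h1 := (hu i).1
      rw [div_le_iff₀ hη] at h1
      have h2 := le_abs_self (C i)
      have h3 : u ^ 2 * η ≤ u ^ 2 * entryNorm (wedge (e i) (w *ᵥ (J *ᵥ e i))) :=
        mul_le_mul_of_nonneg_left hi (by positivity)
      have h4 := abs_nonneg (C i)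
      nlinarith
    have hbad : ∀ i, entryNorm ((h i).1.val * w * (h i).1.valᵀ) ^ (-δ) ≤ 64 := by
      intro i
      have h64 : ((u ^ 6)⁻¹) ^ (-δ) = 64 := by
        rw [Real.inv_rpow (by positivity), ← Real.rpow_natCast, ← Real.rpow_mul hu0.le,
          mul_comm, Real.rpow_mul hu0.le, huδ]
        norm_num
      rw [← h64]
      refine Real.rpow_le_rpow_of_nonpos (by positivity) ?_ (by linarith)
      rw [hhw, inv_le_iff_one_le_mul₀ (by positivity), ← hw1]
      refine (entryNorm_le_formRefl_conj (hx i (u ^ 2) hM1) w).trans ?_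
      rw [mul_comm]
      refine mul_le_mul_of_nonneg_left ?_ (entryNorm_nonneg _)
      have h1 := hC' i _ hM1
      have h2 := (hu i).2
      have h3 := le_abs_self (C' i)
      have h4 : entryNorm (formRefl J (u ^ 2) (e i + (u ^ 2)⁻¹ • n₀)) ≤ u * u ^ 2 :=
        h1.trans (mul_le_mul_of_nonneg_right (h3.trans h2) (by positivity))
      calc _ ≤ (u * u ^ 2) ^ 2 := pow_le_pow_left₀ (entryNorm_nonneg _) h4 2
        _ = u ^ 6 := by ring
    have hcard := hηK w hw
    calc ∑ i, entryNorm ((h i).1.val * w * (h i).1.valᵀ) ^ (-δ)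
        ≤ ∑ i, (1 / 2 + if entryNorm (wedge (e i) (w *ᵥ (J *ᵥ e i))) < η then (64 : ℝ) else 0) := by
          refine Finset.sum_le_sum fun i _ => ?_
          split_ifs with hi
          · have := hbad i
            linarith
          · have := hgood i (not_lt.1 hi)
            linarith
      _ = r / 2 + (Finset.univ.filter fun i =>
            entryNorm (wedge (e i) (w *ᵥ (J *ᵥ e i))) < η).card * 64 := by
          rw [Finset.sum_add_distrib, ← Finset.sum_filter]
          simp only [Finset.sum_const, nsmul_eq_mul, Finset.card_univ, Fintype.card_fin]
          ring
      _ ≤ r / 2 + D * 64 := by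
          have : ((Finset.univ.filter fun i =>
            entryNorm (wedge (e i) (w *ᵥ (J *ᵥ e i))) < η).card : ℝ) ≤ D := by
              exact_mod_cast hcard
          linarith
      _ = 3 / 4 * r := by rw [hr]; push_cast; ring
  refine ⟨r, h, δ, by omega, hδ0, hh, fun w hw hw0 => ?_⟩
  have hpos := entryNorm_pos hw0
  set c := entryNorm w with hc
  have hwK : c⁻¹ • w ∈ K := by
    refine ⟨isoCone_smul hw _, ?_⟩
    rw [Set.mem_ofPred_eq, entryNorm_smul, abs_of_pos (by positivity), ← hc]
    field_simp
  have h1 := key _ hwK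
  have h2 : ∀ i, entryNorm ((h i).1.val * (c⁻¹ • w) * (h i).1.valᵀ) ^ (-δ) =
      (c ^ (-δ))⁻¹ * entryNorm ((h i).1.val * w * (h i).1.valᵀ) ^ (-δ) := by
    intro i
    rw [mul_smul_comm, smul_mul_assoc, entryNorm_smul, abs_of_pos (by positivity),
      Real.mul_rpow (by positivity) (entryNorm_nonneg _), Real.inv_rpow hpos.le]
  simp only [h2] at h1
  rw [← Finset.mul_sum, inv_mul_le_iff₀ (Real.rpow_pos_of_pos hpos _)] at h1
  linarith

end contractionLemma

section covolume
variable {G : Type*} [Group G] [TopologicalSpace G] [IsTopologicalGroup G]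

lemma countable_of_discrete_subgroup [SecondCountableTopology G] (Λ : Subgroup G)
    [DiscreteTopology Λ] : Countable Λ :=
  TopologicalSpace.separableSpace_iff_countable.1 inferInstance

/-- A discrete subgroup of a second countable group has a Borel strict fundamental domain. -/
lemma exists_strict_fundamentalDomain [SecondCountableTopology G] [MeasurableSpace G]
    [BorelSpace G] (Λ : Subgroup G) [DiscreteTopology Λ] :
    ∃ D : Set G, MeasurableSet D ∧ (∀ g : G, ∃ γ : Λ, ∃ d ∈ D, g = (γ : G) * d) ∧
      ∀ d₁ ∈ D, ∀ d₂ ∈ D, ∀ γ : Λ, d₁ = (γ : G) * d₂ → γ = 1 := by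
  obtain ⟨U, hU, hUΛ⟩ : ∃ U ∈ nhds (1 : G), ∀ x ∈ U, x ∈ Λ → x = 1 := by
    have h1 : ({1} : Set Λ) ∈ nhds (1 : Λ) := (isOpen_discrete _).mem_nhds rfl
    rw [nhds_subtype, Filter.mem_comap] at h1
    obtain ⟨U, hU, hUs⟩ := h1
    refine ⟨U, by simpa using hU, fun x hx hxΛ => ?_⟩
    have : (⟨x, hxΛ⟩ : Λ) ∈ ({1} : Set Λ) := hUs hx
    exact congrArg Subtype.val (Set.mem_singleton_iff.1 this)
  obtain ⟨V, hVo, hV1, hVV⟩ : ∃ V : Set G, IsOpen V ∧ (1 : G) ∈ V ∧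
      ∀ a ∈ V, ∀ b ∈ V, a * b⁻¹ ∈ U := by
    have hc : ContinuousAt (fun q : G × G => q.1 * q.2⁻¹) (1, 1) := by fun_prop
    have h2 := hc.preimage_mem_nhds (t := U) (by simpa using hU)
    rw [mem_nhds_prod_iff'] at h2
    obtain ⟨V₁, V₂, h1o, h1, h2o, h2, hs⟩ := h2
    exact ⟨V₁ ∩ V₂, h1o.inter h2o, ⟨h1, h2⟩, fun a ha b hb => hs (Set.mk_mem_prod ha.1 hb.2)⟩
  let W : G → Set G := fun g => {x | x * g⁻¹ ∈ V}
  have hWo : ∀ g, IsOpen (W g) := fun g => hVo.preimage (continuous_mul_const g⁻¹)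
  have hWn : ∀ g, W g ∈ nhds g := fun g => (hWo g).mem_nhds (by simp [W, hV1])
  obtain ⟨T, hTc, hT⟩ := TopologicalSpace.countable_cover_nhds hWn
  have hTne : T.Nonempty := by
    by_contra hne
    rw [Set.not_nonempty_iff_eq_empty.1 hne] at hT
    have : (1 : G) ∈ (Set.univ : Set G) := Set.mem_univ _
    rw [← hT] at this
    simp at this
  obtain ⟨f, hf⟩ := hTc.exists_eq_range hTne
  have hcov : ∀ g : G, ∃ i, g ∈ W (f i) := by
    intro g
    have : g ∈ ⋃ x ∈ T, W x := by rw [hT]; trivial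
    simp only [Set.mem_iUnion, hf, Set.mem_range] at this
    obtain ⟨_, ⟨i, rfl⟩, hi⟩ := this
    exact ⟨i, hi⟩
  let O : ℕ → Set G := fun i => ⋃ γ : Λ, (fun x => (γ : G) * x) ⁻¹' W (f i)
  have hOo : ∀ i, IsOpen (O i) := fun i =>
    isOpen_iUnion fun γ => (hWo _).preimage (continuous_const_mul _)
  have hO : ∀ i x, x ∈ O i ↔ ∃ γ : Λ, (γ : G) * x ∈ W (f i) := fun i x => by simp [O]
  refine ⟨⋃ i, (W (f i) \ ⋃ j, ⋃ _ : j < i, O j), ?_, ?_, ?_⟩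
  · exact MeasurableSet.iUnion fun i => (hWo _).measurableSet.diff
      (MeasurableSet.iUnion fun j => MeasurableSet.iUnion fun _ => (hOo j).measurableSet)
  · intro g
    classical
    have hex : ∃ i, g ∈ O i := by
      obtain ⟨i, hi⟩ := hcov g
      exact ⟨i, (hO i g).2 ⟨1, by simpa using hi⟩⟩
    obtain ⟨γ, hγ⟩ := (hO _ _).1 (Nat.find_spec hex)
    refine ⟨γ⁻¹, γ * g, ?_, by simp⟩
    refine Set.mem_iUnion.2 ⟨Nat.find hex, hγ, ?_⟩
    simp only [Set.mem_iUnion, not_exists]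
    intro j hj hjO
    obtain ⟨γ', hγ'⟩ := (hO _ _).1 hjO
    exact Nat.find_min hex hj ((hO _ _).2 ⟨γ' * γ, by simpa [mul_assoc] using hγ'⟩)
  · intro d₁ h₁ d₂ h₂ γ hγ
    obtain ⟨i, hi, hi'⟩ := Set.mem_iUnion.1 h₁
    obtain ⟨j, hj, hj'⟩ := Set.mem_iUnion.1 h₂
    simp only [Set.mem_iUnion, not_exists] at hi' hj'
    have hij : i = j := by
      rcases lt_trichotomy i j with h | h | h
      · exact absurd ((hO i d₂).2 ⟨γ, hγ ▸ hi⟩) (hj' i h)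
      · exact h
      · refine absurd ((hO j d₁).2 ⟨γ⁻¹, ?_⟩) (hi' j h)
        rw [hγ]
        simpa using hj
    subst hij
    have h3 := hVV _ hi _ hj
    have h4 : d₁ * (f i)⁻¹ * (d₂ * (f i)⁻¹)⁻¹ = γ := by rw [hγ]; group
    rw [h4] at h3
    exact Subtype.ext (hUΛ _ h3 γ.2)

lemma map_mul_right_involution [LocallyCompactSpace G] [SecondCountableTopology G]
    [MeasurableSpace G] [BorelSpace G] (μ : Measure G) [μ.IsHaarMeasure] {h : G}
    (hh : h * h = 1) : μ.map (· * h) = μ := by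
  have h1 := Measure.isMulLeftInvariant_eq_smul (μ.map (· * h)) μ
  rw [← Measure.modularCharacterFun_eq_haarScalarFactor] at h1
  have h2 : Measure.modularCharacterFun h * Measure.modularCharacterFun h = 1 := by
    rw [← Measure.modularCharacterFun_map_mul, hh, Measure.modularCharacterFun_map_one]
  have h3 : Measure.modularCharacterFun h = 1 := by
    exact (pow_eq_one_iff_of_nonneg zero_le two_ne_zero).1 (by rw [sq]; exact h2)
  rw [h1, h3, one_smul]

lemma isFundamentalDomain_of_strict {H : Type*} [Group H] [MeasurableSpace H] {μ : Measure H}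
    {Λ : Subgroup H} {D : Set H} (hD : MeasurableSet D)
    (hcov : ∀ g : H, ∃ γ : Λ, ∃ d ∈ D, g = (γ : H) * d)
    (hstr : ∀ d₁ ∈ D, ∀ d₂ ∈ D, ∀ γ : Λ, d₁ = (γ : H) * d₂ → γ = 1) :
    IsFundamentalDomain Λ D μ := by
  refine IsFundamentalDomain.mk' hD.nullMeasurableSet fun x => ?_
  obtain ⟨γ, d, hd, rfl⟩ := hcov x
  refine ⟨γ⁻¹, by simpa [Subgroup.smul_def] using hd, fun γ' h' => ?_⟩
  have h2 := hstr _ h' _ hd (γ' * γ) (by simp [Subgroup.smul_def, mul_assoc])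
  exact eq_inv_of_mul_eq_one_left h2

lemma lintegral_mul_right_involution [LocallyCompactSpace G] [SecondCountableTopology G]
    [MeasurableSpace G] [BorelSpace G] (μ : Measure G) [μ.IsHaarMeasure] {Λ : Subgroup G}
    [DiscreteTopology Λ] {D : Set G} (hD : MeasurableSet D)
    (hcov : ∀ g : G, ∃ γ : Λ, ∃ d ∈ D, g = (γ : G) * d)
    (hstr : ∀ d₁ ∈ D, ∀ d₂ ∈ D, ∀ γ : Λ, d₁ = (γ : G) * d₂ → γ = 1) {h : G} (hh : h * h = 1)
    {φ : G → ENNReal} (hφ : ∀ (γ : Λ) (g : G), φ ((γ : G) * g) = φ g) :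
    ∫⁻ g in D, φ (g * h) ∂μ = ∫⁻ g in D, φ g ∂μ := by
  have := countable_of_discrete_subgroup Λ
  set D' : Set G := (· * h) ⁻¹' D with hD'
  have hhh : ∀ g : G, g * h * h = g := fun g => by rw [mul_assoc, hh, mul_one]
  have hpre : (· * h) ⁻¹' D' = D := by
    ext g
    simp [hD', hhh]
  have hD'm : MeasurableSet D' := hD.preimage (continuous_mul_const h).measurable
  have h1 : ∫⁻ g in D, φ (g * h) ∂μ = ∫⁻ g in D', φ g ∂μ := by
    have hmp : MeasurePreserving (· * h) μ μ :=
      ⟨(continuous_mul_const h).measurable, map_mul_right_involution μ hh⟩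
    rw [← hmp.setLIntegral_comp_preimage_emb
      (Homeomorph.mulRight h).measurableEmbedding φ D', hpre]
  rw [h1]
  refine IsFundamentalDomain.setLIntegral_eq (G := Λ)
    (isFundamentalDomain_of_strict hD'm ?_ ?_)
    (isFundamentalDomain_of_strict hD hcov hstr) φ fun γ g => hφ γ g
  · intro g
    obtain ⟨γ, d, hd, hg⟩ := hcov (g * h)
    refine ⟨γ, d * h, by simpa [hD', hhh] using hd, ?_⟩
    rw [← mul_assoc, ← hg, hhh]
  · intro d₁ h₁ d₂ h₂ γ hγ
    exact hstr _ h₁ _ h₂ γ (by simp only [hγ, mul_assoc])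

/-- The averaging operator attached to finitely many group elements. -/
noncomputable def avgOp {G : Type*} [Mul G] {r : ℕ} (h : Fin r → G) (φ : G → ENNReal) :
    G → ENNReal :=
  fun g => (r : ENNReal)⁻¹ * ∑ i, φ (g * h i)

section avgOp
variable {H : Type*} [Group H] {r : ℕ} {h : Fin r → H}

lemma avgOp_mono {φ ψ : H → ENNReal} (hφ : ∀ g, φ g ≤ ψ g) (g : H) : avgOp h φ g ≤ avgOp h ψ g :=
  mul_le_mul_right (Finset.sum_le_sum fun _ _ => hφ _) _

lemma avgOp_add (φ ψ : H → ENNReal) (g : H) :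
    avgOp h (fun x => φ x + ψ x) g = avgOp h φ g + avgOp h ψ g := by
  simp only [avgOp, Finset.sum_add_distrib, mul_add]

lemma avgOp_mul_left (c : ENNReal) (φ : H → ENNReal) (g : H) :
    avgOp h (fun x => c * φ x) g = c * avgOp h φ g := by
  simp only [avgOp, ← Finset.mul_sum]
  ring

lemma avgOp_const (hr : 0 < r) (c : ENNReal) (g : H) : avgOp h (fun _ => c) g = c := by
  simp only [avgOp, Finset.sum_const, Finset.card_univ, Fintype.card_fin, nsmul_eq_mul]
  rw [← mul_assoc, ENNReal.inv_mul_cancel (by exact_mod_cast hr.ne') (by simp), one_mul]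

lemma avgOp_iterate_le (hr : 0 < r) {q b : ENNReal} {f : H → ENNReal}
    (hf : ∀ g, avgOp h f g ≤ q * f g + b) (n : ℕ) (g : H) :
    (avgOp h)^[n] f g ≤ q ^ n * f g + b * ∑ i ∈ Finset.range n, q ^ i := by
  have h1 : ∀ n g, avgOp h ((avgOp h)^[n] f) g ≤ q * (avgOp h)^[n] f g + b := by
    intro n
    induction n with
    | zero => exact hf
    | succ n ih =>
      intro g
      rw [Function.iterate_succ_apply']
      refine (avgOp_mono ih g).trans ?_
      rw [avgOp_add, avgOp_mul_left, avgOp_const hr]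
  induction n generalizing g with
  | zero => simp
  | succ n ih =>
    rw [Function.iterate_succ_apply']
    refine (h1 n g).trans ?_
    refine (add_le_add_left (mul_le_mul_right (ih g) q) b).trans_eq ?_
    rw [Finset.sum_range_succ']
    simp only [pow_succ, ← Finset.sum_mul]
    ring

lemma one_le_avgOp_iterate (hr : 0 < r) {R : ENNReal} {f : H → ENNReal} {K : Set H}
    (hK : ∀ g, g ∉ K → 1 ≤ R * f g) (n : ℕ) (g : H) :
    1 ≤ (avgOp h)^[n] (K.indicator 1) g + R * (avgOp h)^[n] f g := by
  induction n generalizing g with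
  | zero =>
    by_cases hg : g ∈ K
    · simp [hg]
    · simpa [hg] using hK g hg
  | succ n ih =>
    rw [Function.iterate_succ_apply', Function.iterate_succ_apply', ← avgOp_mul_left, ← avgOp_add,
      ← avgOp_const (h := h) hr 1 g]
    exact avgOp_mono ih g

end avgOp

/-- A discrete subgroup has finite covolume as soon as there is an invariant function which is
contracted by averaging over involutions and whose sublevel sets are compact modulo the group. -/
theorem isLattice_of_contracted_function [LocallyCompactSpace G] [SecondCountableTopology G]
    [T2Space G] [MeasurableSpace G] [BorelSpace G] (μ : Measure G) [μ.IsHaarMeasure]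
    {Λ : Subgroup G} [DiscreteTopology Λ] {r : ℕ} (hr : 0 < r) (h : Fin r → G)
    (hh : ∀ i, h i * h i = 1) {f : G → ENNReal} (hfin : ∀ g, f g ≠ ⊤) {b : ENNReal} (hb : b ≠ ⊤)
    (hf : ∀ g, avgOp h f g ≤ (3 / 4 : NNReal) * f g + b)
    (hK : ∀ R : ENNReal, R ≠ ⊤ → ∃ C : Set G, IsCompact C ∧
      ∀ g, f g ≤ R → ∃ γ ∈ Λ, ∃ c ∈ C, g = γ * c) :
    IsLattice μ Λ := by
  obtain ⟨D, hD, hcov, hstr⟩ := exists_strict_fundamentalDomain Λ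
  have := countable_of_discrete_subgroup Λ
  refine ⟨inferInstance, D, hD, ?_, hcov, fun d₁ h₁ d₂ h₂ γ hγ => ?_⟩
  swap
  · have := hstr d₁ h₁ d₂ h₂ γ hγ
    rw [hγ, this]
    simp
  set q : ENNReal := ((3 / 4 : NNReal) : ENNReal) with hq
  have hq1 : q < 1 := by
    rw [hq, ENNReal.coe_lt_one_iff, div_lt_one (by norm_num)]
    norm_num
  have hqs : ∀ n : ℕ, ∑ i ∈ Finset.range n, q ^ i ≤ 4 := by
    intro n
    refine (ENNReal.sum_le_tsum _).trans_eq ?_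
    rw [ENNReal.tsum_geometric]
    have : (1 : ENNReal) - q = ((1 / 4 : NNReal) : ENNReal) := by
      rw [hq, ← ENNReal.coe_one, ← ENNReal.coe_sub]
      congr 1
      apply NNReal.coe_injective
      rw [NNReal.coe_sub] <;> norm_num
      rw [div_le_one (by norm_num)]; norm_num
    rw [this, ← ENNReal.coe_inv (by norm_num)]
    norm_num
  lift b to NNReal using hb
  set R : NNReal := 16 * (b + 1) with hR
  have hR0 : R ≠ 0 := by positivity
  obtain ⟨C, hC, hCK⟩ := hK R (by simp)
  set K : Set G := ⋃ γ : Λ, (fun x => ((γ : G))⁻¹ * x) ⁻¹' C with hKdef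
  have hKmem : ∀ g, g ∈ K ↔ ∃ γ : Λ, (γ : G)⁻¹ * g ∈ C := fun g => by simp [hKdef]
  have hKm : MeasurableSet K := MeasurableSet.iUnion fun γ =>
    hC.measurableSet.preimage (continuous_const_mul _).measurable
  have hKf : ∀ g, g ∉ K → 1 ≤ ((R⁻¹ : NNReal) : ENNReal) * f g := by
    intro g hg
    have : (R : ENNReal) < f g := by
      by_contra hlt
      obtain ⟨γ, hγ, c, hc, rfl⟩ := hCK g (not_lt.1 hlt)
      exact hg ((hKmem _).2 ⟨⟨γ, hγ⟩, by simpa using hc⟩)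
    rw [ENNReal.coe_inv hR0, mul_comm, ← div_eq_mul_inv]
    rw [ENNReal.le_div_iff_mul_le (by simp [hR0]) (by simp), one_mul]
    exact this.le
  set P : ℕ → G → ENNReal := fun n => (avgOp h)^[n] (K.indicator 1) with hP
  have hlim : ∀ g, (1 / 2 : NNReal) ≤ Filter.liminf (fun n => P n g) Filter.atTop := by
    intro g
    refine Filter.le_liminf_of_le (by isBoundedDefault) ?_
    have ht : Filter.Tendsto (fun n => q ^ n * f g) Filter.atTop (nhds 0) := by
      have := ENNReal.Tendsto.mul_const (ENNReal.tendsto_pow_atTop_nhds_zero_of_lt_one hq1)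
        (Or.inr (hfin g))
      simpa using this
    have hev : ∀ᶠ n in Filter.atTop, q ^ n * f g < (1 : NNReal) :=
      ht.eventually (gt_mem_nhds (by simp))
    filter_upwards [hev] with n hn
    have h1 := one_le_avgOp_iterate (h := h) hr hKf n g
    have h2 := avgOp_iterate_le hr hf n g
    have h3 : (avgOp h)^[n] f g ≤ ((1 + b * 4 : NNReal) : ENNReal) := by
      refine h2.trans ?_
      push_cast
      refine add_le_add hn.le (mul_le_mul_right (hqs n) _)
    have h4 : ((R⁻¹ : NNReal) : ENNReal) * (avgOp h)^[n] f g ≤ ((1 / 2 : NNReal) : ENNReal) := by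
      refine (mul_le_mul_right h3 _).trans ?_
      rw [← ENNReal.coe_mul, ENNReal.coe_le_coe, inv_mul_le_iff₀ (by positivity), hR]
      rw [← NNReal.coe_le_coe]
      push_cast
      nlinarith [b.2]
    have h5 : (1 : ENNReal) ≤ P n g + ((1 / 2 : NNReal) : ENNReal) :=
      h1.trans (add_le_add_right h4 _)
    have h6 : (1 : ENNReal) = ((1 / 2 : NNReal) : ENNReal) + ((1 / 2 : NNReal) : ENNReal) := by
      rw [← ENNReal.coe_add]; norm_num
    rw [h6] at h5
    exact (ENNReal.add_le_add_iff_right ENNReal.coe_ne_top).1 h5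
  have hPm : ∀ n, Measurable (P n) := by
    intro n
    induction n with
    | zero => exact measurable_one.indicator hKm
    | succ n ih =>
      simp only [hP, Function.iterate_succ_apply']
      refine Measurable.const_mul (Finset.measurable_fun_sum _ fun i _ => ?_) _
      exact ih.comp (continuous_mul_const _).measurable
  have hPi : ∀ n (γ : Λ) (g : G), P n ((γ : G) * g) = P n g := by
    intro n
    induction n with
    | zero =>
      intro γ g
      have : ((γ : G) * g ∈ K) ↔ g ∈ K := by
        rw [hKmem, hKmem]
        constructor
        · rintro ⟨γ', h'⟩
          exact ⟨γ⁻¹ * γ', by simpa [mul_assoc] using h'⟩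
        · rintro ⟨γ', h'⟩
          exact ⟨γ * γ', by simpa [mul_assoc] using h'⟩
      show K.indicator 1 ((γ : G) * g) = K.indicator 1 g
      by_cases hg : g ∈ K
      · rw [Set.indicator_of_mem hg, Set.indicator_of_mem (this.2 hg)]
        rfl
      · rw [Set.indicator_of_notMem hg, Set.indicator_of_notMem (fun h' => hg (this.1 h'))]
    | succ n ih =>
      intro γ g
      simp only [hP, Function.iterate_succ_apply', avgOp, mul_assoc] at ih ⊢
      simp only [ih]
  have hPint : ∀ n, ∫⁻ g in D, P n g ∂μ = μ (K ∩ D) := by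
    intro n
    induction n with
    | zero =>
      simp only [hP, Function.iterate_zero, id]
      rw [lintegral_indicator_one hKm, Measure.restrict_apply hKm]
    | succ n ih =>
      have h1 : ∀ g, P (n + 1) g = (r : ENNReal)⁻¹ * ∑ i, P n (g * h i) := fun g => by
        simp only [hP, Function.iterate_succ_apply', avgOp]
      simp only [h1]
      have hm : ∀ i, Measurable fun g => P n (g * h i) := fun i =>
        (hPm n).comp (continuous_mul_const _).measurable
      rw [lintegral_const_mul _ (Finset.measurable_fun_sum _ fun i _ => hm i),
        lintegral_finsetSum _ fun i _ => hm i]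
      simp only [lintegral_mul_right_involution μ hD hcov hstr (hh _) (hPi n), ih]
      rw [Finset.sum_const, Finset.card_univ, Fintype.card_fin, nsmul_eq_mul, ← mul_assoc,
        ENNReal.inv_mul_cancel (by exact_mod_cast hr.ne') (by simp), one_mul]
  have hKC : μ (K ∩ D) ≤ μ C := by
    rw [(isFundamentalDomain_of_strict hD hcov hstr : IsFundamentalDomain Λ D μ).measure_eq_tsum C]
    refine le_trans (measure_mono ?_) (measure_iUnion_le _)
    rintro g ⟨hg, hgD⟩
    obtain ⟨γ, hγ⟩ := (hKmem g).1 hg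
    exact Set.mem_iUnion.2 ⟨γ, ⟨_, hγ, by simp [Subgroup.smul_def]⟩, hgD⟩
  have hfat : ((1 / 2 : NNReal) : ENNReal) * μ D ≤ μ C := by
    calc ((1 / 2 : NNReal) : ENNReal) * μ D = ∫⁻ _ in D, ((1 / 2 : NNReal) : ENNReal) ∂μ := by
          rw [setLIntegral_const]
      _ ≤ ∫⁻ g in D, Filter.liminf (fun n => P n g) Filter.atTop ∂μ :=
          lintegral_mono fun g => hlim g
      _ ≤ Filter.liminf (fun n => ∫⁻ g in D, P n g ∂μ) Filter.atTop :=
          lintegral_liminf_le hPm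
      _ = μ (K ∩ D) := by simp only [hPint, Filter.liminf_const]
      _ ≤ μ C := hKC
  by_contra htop
  rw [not_lt, top_le_iff] at htop
  rw [htop, ENNReal.mul_top (by simp)] at hfat
  exact hC.measure_lt_top.ne (top_le_iff.1 hfat)

end covolume

section grouptopology

variable {ι : Type*} [Fintype ι] [DecidableEq ι] {J : Matrix ι ι ℝ}

lemma SOQ.inv_val (hJ : J * J = 1) (g : SOQ J) : (g⁻¹).1.val = J * g.1.valᵀ * J := by
  have h1 : (J * g.1.valᵀ * J) * g.1.val = 1 := by
    rw [Matrix.mul_assoc, Matrix.mul_assoc, ← Matrix.mul_assoc g.1.valᵀ, g.2.2, hJ]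
  have h2 : g.1.val * (g⁻¹).1.val = 1 := by
    rw [← Units.val_mul, ← Subgroup.coe_mul, mul_inv_cancel]; rfl
  calc (g⁻¹).1.val = ((J * g.1.valᵀ * J) * g.1.val) * (g⁻¹).1.val := by rw [h1, Matrix.one_mul]
    _ = J * g.1.valᵀ * J := by rw [Matrix.mul_assoc, h2, Matrix.mul_one]

lemma SOQ.inv_mul_val (g : SOQ J) : (g⁻¹).1.val * g.1.val = 1 := by
  rw [← Units.val_mul, ← Subgroup.coe_mul, inv_mul_cancel]; rfl

lemma SOQ.mul_inv_val (g : SOQ J) : g.1.val * (g⁻¹).1.val = 1 := by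
  rw [← Units.val_mul, ← Subgroup.coe_mul, mul_inv_cancel]; rfl

/-- The element of `SOQ J` with a given matrix. -/
noncomputable def SOQ.mk (A : Matrix ι ι ℝ) (hd : A.det = 1) (hA : Aᵀ * J * A = J) : SOQ J :=
  ⟨Matrix.GeneralLinearGroup.mkOfDetNeZero A (by rw [hd]; exact one_ne_zero), hd, hA⟩

lemma SOQ.mk_val (A : Matrix ι ι ℝ) (hd : A.det = 1) (hA : Aᵀ * J * A = J) :
    (SOQ.mk A hd hA).1.val = A := rfl

lemma SOQ.ext_val {g h : SOQ J} (H : g.1.val = h.1.val) : g = h :=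
  Subtype.ext (Units.ext H)

lemma SOQ.continuous_val : Continuous fun g : SOQ J => g.1.val :=
  Units.continuous_val.comp continuous_subtype_val

lemma SOQ.isClosedEmbedding_val (hJ : J * J = 1) :
    Topology.IsClosedEmbedding fun g : SOQ J => g.1.val := by
  have hind : Topology.IsInducing fun g : SOQ J => g.1.val := by
    rw [Topology.isInducing_iff_nhds]
    intro g
    refine le_antisymm (SOQ.continuous_val.tendsto g).le_comap ?_
    have hsub : Topology.IsInducing (Subtype.val : SOQ J → GL ι ℝ) := Topology.IsInducing.subtypeVal
    have hu := Units.isInducing_embedProduct (M := Matrix ι ι ℝ)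
    have h := (hu.comp hsub).nhds_eq_comap g
    rw [h, ← Filter.tendsto_iff_comap]
    have h1 : Filter.Tendsto (fun g : SOQ J => g.1.val)
        (Filter.comap (fun g : SOQ J => g.1.val) (nhds g.1.val)) (nhds g.1.val) :=
      Filter.tendsto_comap
    have hc : Continuous fun A : Matrix ι ι ℝ => J * Aᵀ * J := by fun_prop
    have h2 := (hc.tendsto g.1.val).comp h1
    have h3 := (MulOpposite.continuous_op.tendsto _).comp h2
    have h4 := h1.prodMk_nhds h3
    refine (h4.congr fun x => ?_).trans_eq ?_
    · show (x.1.val, MulOpposite.op (J * x.1.valᵀ * J)) = _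
      rw [← SOQ.inv_val hJ]
      rfl
    · rw [← SOQ.inv_val hJ]
      rfl
  refine ⟨⟨hind, fun a b h => SOQ.ext_val h⟩, ?_⟩
  have : Set.range (fun g : SOQ J => g.1.val) = {A | A.det = 1} ∩ {A | Aᵀ * J * A = J} := by
    ext A
    constructor
    · rintro ⟨g, rfl⟩
      exact g.2
    · rintro ⟨h1, h2⟩
      exact ⟨SOQ.mk A h1 h2, rfl⟩
  rw [this]
  refine IsClosed.inter (isClosed_eq (by fun_prop) continuous_const)
    (isClosed_eq (by fun_prop) continuous_const)

lemma SOQ.isCompact_le (hJ : J * J = 1) (R : ℝ) : IsCompact {g : SOQ J | entryNorm g.1.val ≤ R} :=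
  (SOQ.isClosedEmbedding_val hJ).isCompact_preimage (isCompact_entryNorm_le R)

lemma SOQ.locallyCompactSpace (hJ : J * J = 1) : LocallyCompactSpace (SOQ J) :=
  have : LocallyCompactSpace (Matrix ι ι ℝ) := inferInstanceAs (LocallyCompactSpace (ι → ι → ℝ))
  (SOQ.isClosedEmbedding_val hJ).locallyCompactSpace

lemma SOQ.secondCountableTopology (hJ : J * J = 1) : SecondCountableTopology (SOQ J) :=
  have : SecondCountableTopology (Matrix ι ι ℝ) :=
    inferInstanceAs (SecondCountableTopology (ι → ι → ℝ))
  (SOQ.isClosedEmbedding_val hJ).isInducing.secondCountableTopology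

lemma SOQ.t2Space (hJ : J * J = 1) : T2Space (SOQ J) :=
  (SOQ.isClosedEmbedding_val hJ).isEmbedding.t2Space

lemma SOQ.det_val (g : SOQ J) : g.1.val.det = 1 := g.2.1

lemma SOQ.form_val (g : SOQ J) : g.1.valᵀ * J * g.1.val = J := g.2.2

lemma SOQ.mul_val (g h : SOQ J) : (g * h).1.val = g.1.val * h.1.val := rfl

end grouptopology

section minkowski

variable {α β κ : Type*} [Fintype α] [Fintype β] [Fintype κ]

lemma exists_dominated_dual_vector [DecidableEq α] [DecidableEq β]
    {φ : Matrix α β ℝ →ₗ[ℝ] ℝ} (hφ : φ ≠ 0) :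
    ∃ e, φ e = 1 ∧ ∀ z, |φ z| * entryNorm e ≤ entryNorm z := by
  have hsum : ∀ z : Matrix α β ℝ, φ z = ∑ i, ∑ j, z i j * φ (Matrix.single i j 1) := by
    intro z
    conv_lhs => rw [Matrix.matrix_eq_sum_single z]
    simp only [map_sum]
    refine Finset.sum_congr rfl fun i _ => Finset.sum_congr rfl fun j _ => ?_
    rw [← smul_eq_mul, ← map_smul, Matrix.smul_single, smul_eq_mul, mul_one]
  have hne : Nonempty (α × β) := by
    by_contra hempty
    apply hφ
    ext z
    rw [hsum z, LinearMap.zero_apply]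
    exact Finset.sum_eq_zero fun i _ => Finset.sum_eq_zero fun j _ => (hempty ⟨(i, j)⟩).elim
  obtain ⟨⟨i, j⟩, hmax⟩ := Finite.exists_max fun q : α × β => |φ (Matrix.single q.1 q.2 1)|
  set M := φ (Matrix.single i j 1) with hM
  have hle : ∀ z, |φ z| ≤ entryNorm z * |M| := by
    intro z
    rw [hsum z, entryNorm, Finset.sum_mul]
    refine (Finset.abs_sum_le_sum_abs _ _).trans (Finset.sum_le_sum fun a _ => ?_)
    rw [Finset.sum_mul]
    refine (Finset.abs_sum_le_sum_abs _ _).trans (Finset.sum_le_sum fun c _ => ?_)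
    rw [abs_mul]
    exact mul_le_mul_of_nonneg_left (hmax (a, c)) (abs_nonneg _)
  have hM0 : M ≠ 0 := by
    intro h0
    apply hφ
    ext z
    have := hle z
    rw [h0, abs_zero, mul_zero] at this
    simpa using this
  have hs : entryNorm (Matrix.single i j (1 : ℝ)) = 1 := by
    rw [entryNorm, Finset.sum_eq_single i, Finset.sum_eq_single j]
    · simp
    · intro c _ hc
      simp [Matrix.single_apply, hc.symm]
    · simp
    · intro a _ ha
      simp [Matrix.single_apply, ha.symm]
    · simp
  refine ⟨M⁻¹ • Matrix.single i j 1, by rw [map_smul, ← hM, smul_eq_mul, inv_mul_cancel₀ hM0],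
    fun z => ?_⟩
  rw [entryNorm_smul, hs, mul_one, abs_inv, ← div_eq_mul_inv, div_le_iff₀ (abs_pos.2 hM0)]
  exact hle z

/-- The lattice vectors of bounded size span, uniformly over all unimodular images of a lattice
without short vectors: version in a normed space with an auxiliary norm. -/
theorem exists_uniform_spanning_bound_aux {E : Type*} [NormedAddCommGroup E] [NormedSpace ℝ E]
    (b : Module.Basis κ ℝ E) (p : E → ℝ) (hpc : Continuous p)
    (hadd : ∀ x y, p (x + y) ≤ p x + p y) (hsmul : ∀ (t : ℝ) x, p (t • x) = |t| * p x)
    (hnn : ∀ x, 0 ≤ p x)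
    (hdual : ∀ φ : E →ₗ[ℝ] ℝ, φ ≠ 0 → ∃ e, φ e = 1 ∧ ∀ z, |φ z| * p e ≤ p z)
    {ε : ℝ} (hε : 0 < ε) :
    ∃ R : ℝ, ∀ A : E ≃ₗ[ℝ] E, LinearMap.det (A : E →ₗ[ℝ] E) = 1 →
      (∀ x ∈ Submodule.span ℤ (Set.range b), x ≠ 0 → ε ≤ p (A x)) →
      Submodule.span ℝ {x | x ∈ Submodule.span ℤ (Set.range b) ∧ p (A x) ≤ R} = ⊤ := by
  letI : MeasurableSpace E := borel _
  have : BorelSpace E := ⟨rfl⟩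
  have : FiniteDimensional ℝ E := b.finiteDimensional_of_finite
  have hzero : p 0 = 0 := by simpa using hsmul 0 0
  have hneg : ∀ x, p (-x) = p x := fun x => by simpa using hsmul (-1) x
  set μ : Measure (E) := b.addHaar with hμ
  set U : Set (E) := {x | p x < 1} with hU
  have hUo : IsOpen U := isOpen_lt hpc continuous_const
  have hU0 : μ U ≠ 0 := (hUo.measure_pos μ ⟨0, by simp [hU, hzero]⟩).ne'
  have hF : μ (ZSpan.fundamentalDomain b) ≠ ⊤ :=
    (ZSpan.fundamentalDomain_isBounded b).measure_lt_top.ne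
  set d := Module.finrank ℝ (E) with hd
  set c : ENNReal := ENNReal.ofReal (ε ^ d) * μ U with hc
  have hc0 : c ≠ 0 := mul_ne_zero (by simp [hε]) hU0
  obtain ⟨N, hN⟩ : ∃ N : ℕ, μ (ZSpan.fundamentalDomain b) * 2 ^ d < N * c := by
    obtain ⟨N, hN⟩ := ENNReal.exists_nat_mul_gt hc0
      (ENNReal.mul_ne_top hF (ENNReal.pow_ne_top (by simp : (2 : ENNReal) ≠ ⊤)))
    exact ⟨N, hN⟩
  have hN0 : 0 < (N : ℝ) := by
    rcases Nat.eq_zero_or_pos N with h | h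
    · simp [h] at hN
    · exact_mod_cast h
  refine ⟨ε * N, fun A hA hshort => ?_⟩
  by_contra hne
  obtain ⟨f, hf0, hf⟩ := Submodule.exists_le_ker_of_lt_top _ (lt_top_iff_ne_top.2 hne)
  set φ : E →ₗ[ℝ] ℝ := f ∘ₗ (A.symm : E →ₗ[ℝ] _) with hφ
  have hφ0 : φ ≠ 0 := by
    intro h
    apply hf0
    ext x
    have := LinearMap.congr_fun h (A x)
    simpa [hφ] using this
  obtain ⟨e, he1, he⟩ := hdual φ hφ0
  set s : ℝ := 1 - (N : ℝ)⁻¹ with hs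
  set T : E →ₗ[ℝ] E :=
    ε⁻¹ • LinearMap.transvection φ (-s • e) with hT
  have hTa : ∀ y, T y = ε⁻¹ • (y - (s * φ y) • e) := by
    intro y
    simp only [hT, LinearMap.smul_apply, LinearMap.transvection.apply]
    rw [smul_smul, mul_neg, neg_smul, mul_comm s, sub_eq_add_neg]
  have hTd : LinearMap.det T = (ε ^ d)⁻¹ * (N : ℝ)⁻¹ := by
    rw [hT, LinearMap.det_smul, LinearMap.transvection.det, map_smul, he1, inv_pow, hs]
    simp [hd]
  have hdet : LinearMap.det (T ∘ₗ (A : E →ₗ[ℝ] _)) = (ε ^ d)⁻¹ * (N : ℝ)⁻¹ := by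
    rw [LinearMap.det_comp, hA, hTd, mul_one]
  have hvol : μ ((T ∘ₗ (A : E →ₗ[ℝ] _)) ⁻¹' U) = N * c := by
    rw [Measure.addHaar_preimage_linearMap _ (by rw [hdet]; positivity), hdet, mul_inv, inv_inv,
      inv_inv, abs_of_nonneg (by positivity), mul_comm, ENNReal.ofReal_mul (by positivity), hc,
      ENNReal.ofReal_natCast]
    ring
  have hcount : Countable (Submodule.span ℤ (Set.range b)).toAddSubgroup := by
    have : Countable (Submodule.span ℤ (Set.range b)) := inferInstance
    exact this
  obtain ⟨⟨x, hxL⟩, hx0, hxU⟩ := exists_ne_zero_mem_lattice_of_measure_mul_two_pow_lt_measure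
    (ZSpan.isAddFundamentalDomain' b μ)
    (s := (T ∘ₗ (A : E →ₗ[ℝ] _)) ⁻¹' U)
    (fun x hx => by
      simp only [Set.mem_preimage, hU, Set.mem_ofPred_eq, map_neg, hneg] at hx ⊢
      exact hx)
    (by
      refine Convex.linear_preimage ?_ _
      intro x hx y hy a c ha hc hac
      refine (hadd _ _).trans_lt ?_
      rw [hsmul, hsmul, abs_of_nonneg ha, abs_of_nonneg hc]
      have h1 : p x < 1 := hx
      have h2 : p y < 1 := hy
      rcases ha.eq_or_lt with rfl | ha
      · rw [zero_add] at hac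
        subst hac
        simpa using h2
      · nlinarith)
    (by rw [hvol]; exact hN)
  have hx0 : x ≠ 0 := fun h => hx0 (Subtype.ext h)
  have hxL : x ∈ Submodule.span ℤ (Set.range b) := hxL
  set y := A x with hy
  have hz : p (T y) < 1 := hxU
  set z := T y with hz'
  have hφz : φ z = ε⁻¹ * (N : ℝ)⁻¹ * φ y := by
    rw [hz', hTa, map_smul, map_sub, map_smul, he1, hs]
    simp only [smul_eq_mul]
    ring
  have hyz : y = ε • (z + ((N - 1) * φ z) • e) := by
    rw [hφz, hz', hTa, smul_add, smul_smul, smul_smul, mul_inv_cancel₀ hε.ne', one_smul]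
    have : ε * ((N - 1) * (ε⁻¹ * (N : ℝ)⁻¹ * φ y)) = s * φ y := by
      rw [hs]; field_simp
    rw [this, sub_add_cancel]
  have hN1 : (1 : ℝ) ≤ N := by exact_mod_cast (by exact_mod_cast hN0 : 0 < N)
  have hyle : p y ≤ ε * N := by
    rw [hyz, hsmul, abs_of_pos hε]
    refine mul_le_mul_of_nonneg_left ((hadd _ _).trans ?_) hε.le
    rw [hsmul, abs_mul, abs_of_nonneg (by linarith), mul_assoc]
    have := mul_le_mul_of_nonneg_left (he z) (by linarith : (0 : ℝ) ≤ N - 1)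
    nlinarith [hnn z]
  have hfx : f x = 0 := hf (Submodule.subset_span ⟨hxL, hyle⟩)
  have hφy : φ y = 0 := by simpa [hφ, hy] using hfx
  rw [hφz, hφy, mul_zero, mul_zero, zero_smul, add_zero] at hyz
  have := hshort x hxL hx0
  rw [← hy, hyz, hsmul, abs_of_pos hε] at this
  nlinarith

/-- The lattice vectors of bounded size span, uniformly over all unimodular images of a lattice
without short vectors. -/
theorem exists_uniform_spanning_bound [DecidableEq α] [DecidableEq β]
    (b : Module.Basis κ ℝ (Matrix α β ℝ)) {ε : ℝ} (hε : 0 < ε) :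
    ∃ R : ℝ, ∀ A : Matrix α β ℝ ≃ₗ[ℝ] Matrix α β ℝ, LinearMap.det (A : Matrix α β ℝ →ₗ[ℝ] _) = 1 →
      (∀ x ∈ Submodule.span ℤ (Set.range b), x ≠ 0 → ε ≤ entryNorm (A x)) →
      Submodule.span ℝ {x | x ∈ Submodule.span ℤ (Set.range b) ∧ entryNorm (A x) ≤ R} = ⊤ :=
  exists_uniform_spanning_bound_aux (E := α → β → ℝ) b entryNorm continuous_entryNorm
    entryNorm_add_le entryNorm_smul entryNorm_nonneg
    (fun _ hφ => exists_dominated_dual_vector hφ) hε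

end minkowski

section reduction

variable {ι κ : Type*} [Fintype ι] [DecidableEq ι] [Fintype κ] {J : Matrix ι ι ℝ}

lemma det_eq_one_of_left_mul {A : Matrix ι ι ℝ} (hA : A.det = 1)
    {T : Matrix ι (Fin 2) ℝ →ₗ[ℝ] Matrix ι (Fin 2) ℝ} (hT : ∀ x, T x = A * x) :
    LinearMap.det T = 1 := by
  let e : Matrix ι (Fin 2) ℝ ≃ₗ[ℝ] (Fin 2 → ι → ℝ) := Matrix.transposeLinearEquiv ι (Fin 2) ℝ ℝ
  rw [← LinearMap.det_conj T e]
  have : (e : Matrix ι (Fin 2) ℝ →ₗ[ℝ] Fin 2 → ι → ℝ) ∘ₗ T ∘ₗ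
      (e.symm : (Fin 2 → ι → ℝ) →ₗ[ℝ] Matrix ι (Fin 2) ℝ) =
      LinearMap.pi fun i : Fin 2 => (Matrix.toLin' A).comp (LinearMap.proj i) := by
    refine LinearMap.ext fun x => ?_
    funext i j
    simp only [LinearMap.comp_apply, LinearEquiv.coe_coe, hT, LinearMap.pi_apply,
      LinearMap.proj_apply, Matrix.toLin'_apply]
    rfl
  rw [this, LinearMap.det_pi]
  simp [hA]

/-- Left multiplication by an element of `SOQ J`, as a linear equivalence. -/
noncomputable def SOQ.mulEquiv (g : SOQ J) : Matrix ι (Fin 2) ℝ ≃ₗ[ℝ] Matrix ι (Fin 2) ℝ where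
  toFun x := g.1.val * x
  invFun x := (g⁻¹).1.val * x
  map_add' x y := Matrix.mul_add _ _ _
  map_smul' t x := by simp
  left_inv x := by
    show (g⁻¹).1.val * (g.1.val * x) = x
    rw [← Matrix.mul_assoc, SOQ.inv_mul_val, Matrix.one_mul]
  right_inv x := by
    show g.1.val * ((g⁻¹).1.val * x) = x
    rw [← Matrix.mul_assoc, SOQ.mul_inv_val, Matrix.one_mul]

lemma SOQ.form_mul (g : SOQ J) (x y : Matrix ι (Fin 2) ℝ) :
    (g.1.val * x)ᵀ * J * (g.1.val * y) = xᵀ * J * y := by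
  rw [Matrix.transpose_mul]
  calc xᵀ * g.1.valᵀ * J * (g.1.val * y) = xᵀ * (g.1.valᵀ * J * g.1.val) * y := by
        simp only [Matrix.mul_assoc]
    _ = _ := by rw [SOQ.form_val g]

lemma eq_zero_of_basis_form (hJ : J * J = 1) (c : Module.Basis κ ℝ (Matrix ι (Fin 2) ℝ))
    {z : Matrix ι (Fin 2) ℝ} (h : ∀ i, (c i)ᵀ * J * z = 0) : z = 0 := by
  have hall : ∀ y : Matrix ι (Fin 2) ℝ, yᵀ * J * z = 0 := by
    intro y
    rw [← c.sum_repr y, Matrix.transpose_sum, Matrix.sum_mul, Matrix.sum_mul]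
    refine Finset.sum_eq_zero fun i _ => ?_
    rw [Matrix.transpose_smul, Matrix.smul_mul, Matrix.smul_mul, h, smul_zero]
  have h1 := hall (J * z)
  have hJz : J * z = 0 := by
    have h2 : ∀ i : ι, ∀ a : Fin 2, (J * z) i a = 0 := by
      intro i a
      have h3 := congrFun (congrFun (hall (Matrix.single i 0 1)) 0) a
      rw [Matrix.mul_assoc, Matrix.transpose_single, Matrix.single_mul_apply_same] at h3
      simpa using h3
    ext i a
    exact h2 i a
  rw [← Matrix.one_mul z, ← hJ, Matrix.mul_assoc, hJz, Matrix.mul_zero]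

/-- An isometry between bases for the matrix valued form is a left multiplication. -/
lemma exists_left_mul_of_form_eq (hJ : J * J = 1) (c c' : Module.Basis κ ℝ (Matrix ι (Fin 2) ℝ))
    (h : ∀ i j, (c i)ᵀ * J * c j = (c' i)ᵀ * J * c' j) :
    ∃ A : Matrix ι ι ℝ, Aᵀ * J * A = J ∧ ∀ i, A * c i = c' i := by
  let τ := c.equiv c' (Equiv.refl κ)
  have hτ : ∀ x, τ x = ∑ i, c.repr x i • c' i := by
    intro x
    conv_lhs => rw [← c.sum_repr x]
    simp only [map_sum, map_smul, τ, Module.Basis.equiv_apply, Equiv.refl_apply]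
  have hform : ∀ x y, (τ x)ᵀ * J * τ y = xᵀ * J * y := by
    intro x y
    conv_rhs => rw [← c.sum_repr x, ← c.sum_repr y]
    rw [hτ, hτ]
    simp only [Matrix.transpose_sum, Matrix.sum_mul, Matrix.mul_sum, Matrix.transpose_smul,
      Matrix.smul_mul, Matrix.mul_smul, h]
  have hmul : ∀ x (a : Matrix (Fin 2) (Fin 2) ℝ), τ (x * a) = τ x * a := by
    intro x a
    rw [← sub_eq_zero]
    refine eq_zero_of_basis_form hJ c' fun i => ?_
    have hc : c' i = τ (c i) := by simp [τ]
    rw [hc, Matrix.mul_sub, hform, ← Matrix.mul_assoc, ← Matrix.mul_assoc _ (τ x), hform, sub_self]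
  let E : ι → Fin 2 → Matrix ι (Fin 2) ℝ := fun j a => Matrix.single j a 1
  let A : Matrix ι ι ℝ := Matrix.of fun i j => τ (E j 0) i 0
  have hA : ∀ x, A * x = τ x := by
    intro x
    have hs : ∀ (j : ι) (a : Fin 2), τ (E j a) =
        τ (E j 0) * Matrix.single (0 : Fin 2) a (1 : ℝ) := by
      intro j a
      rw [← hmul]
      simp only [E, Matrix.single_mul_single_same, one_mul]
    have hx : τ x = ∑ j, ∑ a, x j a • τ (E j a) := by
      conv_lhs => rw [Matrix.matrix_eq_sum_single x]
      simp only [map_sum]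
      refine Finset.sum_congr rfl fun j _ => Finset.sum_congr rfl fun a _ => ?_
      rw [← map_smul]
      simp only [E, Matrix.smul_single, smul_eq_mul, mul_one]
    rw [hx]
    ext i a
    rw [Matrix.mul_apply, Matrix.sum_apply]
    refine Finset.sum_congr rfl fun j _ => ?_
    rw [Matrix.sum_apply, Finset.sum_eq_single a]
    · rw [Matrix.smul_apply, hs, Matrix.mul_single_apply_same, mul_one, smul_eq_mul, mul_comm]
      rfl
    · intro a' _ ha
      rw [Matrix.smul_apply, hs, Matrix.mul_single_apply_of_ne _ _ _ _ _ ha.symm, smul_zero]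
    · simp
  refine ⟨A, ?_, fun i => by rw [hA]; simp [τ]⟩
  ext i j
  have h1 := congrFun (congrFun (hform (E i 0) (E j 0)) 0) 0
  rw [← hA, ← hA, Matrix.transpose_mul] at h1
  have h2 : (E i 0)ᵀ * Aᵀ * J * (A * E j 0) =
      (E i 0)ᵀ * (Aᵀ * J * A) * E j 0 := by
    simp only [Matrix.mul_assoc]
  rw [h2] at h1
  simpa [E, Matrix.transpose_single] using h1

end reduction

section reduction_theory

variable {ι κ : Type*} [Fintype ι] [DecidableEq ι] [Fintype κ] {J : Matrix ι ι ℝ}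

lemma entryNorm_sum_le {α β σ : Type*} [Fintype α] [Fintype β] (s : Finset σ)
    (f : σ → Matrix α β ℝ) : entryNorm (∑ i ∈ s, f i) ≤ ∑ i ∈ s, entryNorm (f i) :=
  Finset.le_sum_of_subadditive _ entryNorm_zero.le entryNorm_add_le s f

/-- The lattice spanned by a basis of the space of two-column matrices. -/
def colLattice (b : Module.Basis κ ℝ (Matrix ι (Fin 2) ℝ)) : Submodule ℤ (Matrix ι (Fin 2) ℝ) :=
  Submodule.span ℤ (Set.range b)

/-- The stabilizer in `SOQ J` of a lattice of two-column matrices. -/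
def latticeStab (J : Matrix ι ι ℝ) (b : Module.Basis κ ℝ (Matrix ι (Fin 2) ℝ)) :
    Subgroup (SOQ J) where
  carrier := {g | ∀ x, g.1.val * x ∈ colLattice b ↔ x ∈ colLattice b}
  one_mem' := fun x => by
    show (1 : Matrix ι ι ℝ) * x ∈ _ ↔ _
    rw [Matrix.one_mul]
  mul_mem' := by
    intro g h hg hh x
    rw [SOQ.mul_val, Matrix.mul_assoc, hg, hh]
  inv_mem' := by
    intro g hg x
    rw [← hg, ← Matrix.mul_assoc, SOQ.mul_inv_val, Matrix.one_mul]

lemma mem_latticeStab {b : Module.Basis κ ℝ (Matrix ι (Fin 2) ℝ)} {g : SOQ J} :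
    g ∈ latticeStab J b ↔ ∀ x, g.1.val * x ∈ colLattice b ↔ x ∈ colLattice b := Iff.rfl

/-- The set of values of the matrix valued form on a lattice. -/
def formValues (J : Matrix ι ι ℝ) (b : Module.Basis κ ℝ (Matrix ι (Fin 2) ℝ)) :
    Set (Matrix (Fin 2) (Fin 2) ℝ) :=
  {M | ∃ x ∈ colLattice b, ∃ y ∈ colLattice b, M = xᵀ * J * y}

/-- A basis consisting of lattice vectors with short image. -/
lemma exists_short_basis (b : Module.Basis κ ℝ (Matrix ι (Fin 2) ℝ)) {ε : ℝ} (hε : 0 < ε) :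
    ∃ R : ℝ, 0 ≤ R ∧ ∀ g : SOQ J, (∀ x ∈ colLattice b, x ≠ 0 → ε ≤ entryNorm (g.1.val * x)) →
      ∃ c : Module.Basis κ ℝ (Matrix ι (Fin 2) ℝ),
        ∀ i, c i ∈ colLattice b ∧ entryNorm (g.1.val * c i) ≤ R := by
  obtain ⟨R, hR⟩ := exists_uniform_spanning_bound b hε
  refine ⟨max R 0, le_max_right _ _, fun g hg => ?_⟩
  have h1 := hR (SOQ.mulEquiv g) (det_eq_one_of_left_mul (SOQ.det_val g) fun x => rfl) hg
  let c := Module.Basis.ofSpan h1.ge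
  have hc := Module.Basis.ofSpan_subset h1.ge
  refine ⟨c.reindex (c.indexEquiv b), fun i => ?_⟩
  rw [Module.Basis.reindex_apply]
  have := hc (Set.mem_range_self ((c.indexEquiv b).symm i))
  exact ⟨this.1, this.2.trans (le_max_left _ _)⟩

/-- The lattice is generated by its vectors whose image is not much longer than a given basis. -/
lemma mem_span_short {b c : Module.Basis κ ℝ (Matrix ι (Fin 2) ℝ)} {g : SOQ J} {R : ℝ}
    (hR : 0 ≤ R) (hc : ∀ i, c i ∈ colLattice b ∧ entryNorm (g.1.val * c i) ≤ R)
    {x : Matrix ι (Fin 2) ℝ} (hx : x ∈ colLattice b) :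
    x ∈ Submodule.span ℤ
      {x | x ∈ colLattice b ∧ entryNorm (g.1.val * x) ≤ (Fintype.card κ + 1) * R} := by
  set S : Set (Matrix ι (Fin 2) ℝ) :=
    {x | x ∈ colLattice b ∧ entryNorm (g.1.val * x) ≤ (Fintype.card κ + 1) * R} with hS
  have hcS : ∀ i, c i ∈ S := fun i =>
    ⟨(hc i).1, (hc i).2.trans (le_mul_of_one_le_left hR (by simp))⟩
  have h1 : ∑ i, ⌊c.repr x i⌋ • c i ∈ Submodule.span ℤ S :=
    Submodule.sum_mem _ fun i _ => Submodule.smul_mem _ _ (Submodule.subset_span (hcS i))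
  have h2 : x - ∑ i, ⌊c.repr x i⌋ • c i ∈ S := by
    refine ⟨Submodule.sub_mem _ hx (Submodule.sum_mem _ fun i _ =>
      Submodule.smul_mem _ _ (hc i).1), ?_⟩
    have h3 : x - ∑ i, ⌊c.repr x i⌋ • c i = ∑ i, Int.fract (c.repr x i) • c i := by
      rw [sub_eq_iff_eq_add, ← Finset.sum_add_distrib]
      refine (c.sum_repr x).symm.trans (Finset.sum_congr rfl fun i _ => ?_)
      rw [← Int.cast_smul_eq_zsmul ℝ, ← add_smul, Int.fract_add_floor]
    rw [h3, Matrix.mul_sum]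
    refine (entryNorm_sum_le _ _).trans ?_
    have h4 : ∀ i ∈ Finset.univ, entryNorm (g.1.val * Int.fract (c.repr x i) • c i) ≤ R := by
      intro i _
      rw [Matrix.mul_smul, entryNorm_smul, abs_of_nonneg (Int.fract_nonneg _)]
      have h5 := (Int.fract_lt_one (c.repr x i)).le
      have h6 := Int.fract_nonneg (c.repr x i)
      nlinarith [(hc i).2, entryNorm_nonneg (g.1.val * c i)]
    refine (Finset.sum_le_card_nsmul _ _ _ h4).trans ?_
    rw [Finset.card_univ, nsmul_eq_mul]
    nlinarith
  have := Submodule.add_mem _ (Submodule.subset_span h2) h1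
  simpa using this

/-- The finite data attached to a point of `SOQ J` together with a short basis. -/
noncomputable def latticeDatum (J : Matrix ι ι ℝ) (b c : Module.Basis κ ℝ (Matrix ι (Fin 2) ℝ))
    (g : SOQ J) (R : ℝ) :
    (κ → κ → Matrix (Fin 2) (Fin 2) ℝ) × Set (κ → Matrix (Fin 2) (Fin 2) ℝ) :=
  (fun i j => (c i)ᵀ * J * c j,
    {v | ∃ x ∈ colLattice b, entryNorm (g.1.val * x) ≤ R ∧ v = fun i => (c i)ᵀ * J * x})

lemma entryNorm_form_le (g : SOQ J) {x y : Matrix ι (Fin 2) ℝ} {R : ℝ}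
    (hx : entryNorm (g.1.val * x) ≤ R) (hy : entryNorm (g.1.val * y) ≤ R) :
    entryNorm (xᵀ * J * y) ≤ R * entryNorm J * R := by
  have hR : 0 ≤ R := (entryNorm_nonneg _).trans hx
  rw [← SOQ.form_mul g]
  refine (entryNorm_mul_le _ _).trans (mul_le_mul ((entryNorm_mul_le _ _).trans ?_) hy
    (entryNorm_nonneg _) (mul_nonneg hR (entryNorm_nonneg _)))
  rw [entryNorm_transpose]
  exact mul_le_mul_of_nonneg_right hx (entryNorm_nonneg _)

lemma finite_latticeDatum {b : Module.Basis κ ℝ (Matrix ι (Fin 2) ℝ)}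
    (hfin : ∀ R : ℝ, (formValues J b ∩ {M | entryNorm M ≤ R}).Finite) (R : ℝ) :
    {D | ∃ (g : SOQ J) (c : Module.Basis κ ℝ (Matrix ι (Fin 2) ℝ)),
      (∀ i, c i ∈ colLattice b ∧ entryNorm (g.1.val * c i) ≤ R) ∧
      D = latticeDatum J b c g R}.Finite := by
  set T := formValues J b ∩ {M | entryNorm M ≤ R * entryNorm J * R} with hT
  have hTf : T.Finite := hfin _
  have h1 : {f : κ → κ → Matrix (Fin 2) (Fin 2) ℝ | ∀ i, f i ∈ {u : κ → _ | ∀ j, u j ∈ T}}.Finite :=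
    Set.Finite.pi' fun _ => Set.Finite.pi' fun _ => hTf
  have h2 : {s : Set (κ → Matrix (Fin 2) (Fin 2) ℝ) | s ⊆ {u | ∀ j, u j ∈ T}}.Finite :=
    (Set.Finite.pi' fun _ => hTf).finite_subsets
  refine (h1.prod h2).subset ?_
  rintro _ ⟨g, c, hc, rfl⟩
  refine ⟨fun i j => ⟨⟨_, (hc i).1, _, (hc j).1, rfl⟩, entryNorm_form_le g (hc i).2 (hc j).2⟩, ?_⟩
  rintro _ ⟨x, hx, hxR, rfl⟩ i
  exact ⟨⟨_, (hc i).1, _, hx, rfl⟩, entryNorm_form_le g (hc i).2 hxR⟩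

lemma left_mul_mem_of_datum (hJ : J * J = 1) {b c c' : Module.Basis κ ℝ (Matrix ι (Fin 2) ℝ)}
    {g g' : SOQ J} {R : ℝ} (hR : 0 ≤ R)
    (hc : ∀ i, c i ∈ colLattice b ∧ entryNorm (g.1.val * c i) ≤ R)
    (hD : (latticeDatum J b c g ((Fintype.card κ + 1) * R)).2 ⊆
      (latticeDatum J b c' g' ((Fintype.card κ + 1) * R)).2)
    {A : Matrix ι ι ℝ} (hA : Aᵀ * J * A = J) (hAc : ∀ i, A * c i = c' i)
    {x : Matrix ι (Fin 2) ℝ} (hx : x ∈ colLattice b) : A * x ∈ colLattice b := by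
  have hx' := mem_span_short hR hc hx
  clear hx
  induction hx' using Submodule.span_induction with
  | mem x hxS =>
    obtain ⟨x', hx', -, he⟩ := hD ⟨x, hxS.1, hxS.2, rfl⟩
    have : A * x = x' := by
      rw [← sub_eq_zero]
      refine eq_zero_of_basis_form hJ c' fun i => ?_
      have h1 := congrFun he i
      rw [Matrix.mul_sub, ← h1, ← hAc, Matrix.transpose_mul, sub_eq_zero]
      calc (c i)ᵀ * Aᵀ * J * (A * x) = (c i)ᵀ * (Aᵀ * J * A) * x := by simp only [Matrix.mul_assoc]
        _ = _ := by rw [hA]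
    rwa [this]
  | zero => simp
  | add x y hx hy h1 h2 =>
    rw [Matrix.mul_add]
    exact Submodule.add_mem _ h1 h2
  | smul t x hx h1 =>
    rw [Matrix.mul_smul]
    exact Submodule.smul_mem _ _ h1

/-- Points with the same datum differ by an element of the orthogonal group preserving the
lattice. -/
lemma exists_stab_of_datum_eq (hJ : J * J = 1) {b c c' : Module.Basis κ ℝ (Matrix ι (Fin 2) ℝ)}
    {g g' : SOQ J} {R : ℝ} (hR : 0 ≤ R)
    (hc : ∀ i, c i ∈ colLattice b ∧ entryNorm (g.1.val * c i) ≤ R)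
    (hc' : ∀ i, c' i ∈ colLattice b ∧ entryNorm (g'.1.val * c' i) ≤ R)
    (hD : latticeDatum J b c g ((Fintype.card κ + 1) * R) =
      latticeDatum J b c' g' ((Fintype.card κ + 1) * R)) :
    ∃ A : Matrix ι ι ℝ, Aᵀ * J * A = J ∧ (A.det = 1 ∨ A.det = -1) ∧ (∀ i, A * c i = c' i) ∧
      ∀ x, A * x ∈ colLattice b ↔ x ∈ colLattice b := by
  have hG : ∀ i j, (c i)ᵀ * J * c j = (c' i)ᵀ * J * c' j := fun i j =>
    congrFun (congrFun (congrArg Prod.fst hD) i) j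
  obtain ⟨A, hA, hAc⟩ := exists_left_mul_of_form_eq hJ c c' hG
  obtain ⟨A', hA', hAc'⟩ := exists_left_mul_of_form_eq hJ c' c fun i j => (hG i j).symm
  have hAA : ∀ x : Matrix ι (Fin 2) ℝ, A' * (A * x) = x := by
    intro x
    conv_rhs => rw [← c.sum_repr x]
    conv_lhs => rw [← c.sum_repr x]
    simp only [Matrix.mul_sum, Matrix.mul_smul, hAc, hAc']
  refine ⟨A, hA, ?_, hAc, fun x => ⟨fun h => ?_, fun h =>
    left_mul_mem_of_datum hJ hR hc (congrArg Prod.snd hD).subset hA hAc h⟩⟩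
  · have h1 := congrArg Matrix.det hA
    rw [Matrix.det_mul, Matrix.det_mul, Matrix.det_transpose] at h1
    have h2 := congrArg Matrix.det hJ
    rw [Matrix.det_mul, Matrix.det_one] at h2
    have h3 : J.det ≠ 0 := left_ne_zero_of_mul_eq_one h2
    refine mul_self_eq_one_iff.1 (mul_right_cancel₀ h3 ?_)
    linarith
  · rw [← hAA x]
    exact left_mul_mem_of_datum hJ hR hc' (congrArg Prod.snd hD).symm.subset hA' hAc' h

lemma entryNorm_le_of_basis (c : Module.Basis κ ℝ (Matrix ι (Fin 2) ℝ)) (R : ℝ) :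
    ∃ R' : ℝ, ∀ A : Matrix ι ι ℝ, (∀ i, entryNorm (A * c i) ≤ R) → entryNorm A ≤ R' := by
  let E : ι → Matrix ι (Fin 2) ℝ := fun j => Matrix.single j 0 1
  refine ⟨∑ _i : ι, ∑ j : ι, ∑ k, |c.repr (E j) k| * R, fun A hA =>
    Finset.sum_le_sum fun i _ => Finset.sum_le_sum fun j _ => ?_⟩
  have h1 : A i j = (A * E j) i 0 := by simp [E]
  rw [h1]
  refine (abs_le_entryNorm _ _ _).trans ?_
  conv_lhs => rw [← c.sum_repr (E j)]
  rw [Matrix.mul_sum]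
  refine (entryNorm_sum_le _ _).trans (Finset.sum_le_sum fun k _ => ?_)
  rw [Matrix.mul_smul, entryNorm_smul]
  exact mul_le_mul_of_nonneg_left (hA k) (abs_nonneg _)

/-- Compactness criterion: the points of `SOQ J` for which the lattice has no short vectors are
compact modulo the stabilizer. -/
theorem exists_compact_of_no_short_vectors (hJ : J * J = 1)
    {b : Module.Basis κ ℝ (Matrix ι (Fin 2) ℝ)}
    (hfin : ∀ R : ℝ, (formValues J b ∩ {M | entryNorm M ≤ R}).Finite) {ε : ℝ} (hε : 0 < ε) :
    ∃ C : Set (SOQ J), IsCompact C ∧ ∀ g : SOQ J,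
      (∀ x ∈ colLattice b, x ≠ 0 → ε ≤ entryNorm ((g⁻¹).1.val * x)) →
      ∃ γ ∈ latticeStab J b, ∃ c ∈ C, g = γ * c := by
  obtain ⟨R, hR, hshort⟩ := exists_short_basis (J := J) b hε
  let S := {g : SOQ J // ∀ x ∈ colLattice b, x ≠ 0 → ε ≤ entryNorm (g.1.val * x)}
  choose c hc using fun g : S => hshort g.1 g.2
  set R₁ := ((Fintype.card κ : ℝ) + 1) * R with hR₁
  have hRR : R ≤ R₁ := le_mul_of_one_le_left hR (by simp)
  let D : S → _ := fun g => latticeDatum J b (c g) g.1 R₁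
  have hDf : (Set.range D).Finite := by
    refine (finite_latticeDatum hfin R₁).subset ?_
    rintro _ ⟨g, rfl⟩
    exact ⟨g.1, c g, fun i => ⟨(hc g i).1, (hc g i).2.trans hRR⟩, rfl⟩
  choose ρ hρ using fun d : Set.range D => d.2
  have hA : ∀ g : S, ∃ A : Matrix ι ι ℝ, Aᵀ * J * A = J ∧ (A.det = 1 ∨ A.det = -1) ∧
      (∀ i, A * c (ρ ⟨D g, g, rfl⟩) i = c g i) ∧ ∀ x, A * x ∈ colLattice b ↔ x ∈ colLattice b :=
    fun g => exists_stab_of_datum_eq hJ hR (hc _) (hc g) (hρ ⟨D g, g, rfl⟩)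
  choose A hAJ hAd hAc hAL using hA
  let D' : S → Set.range D × Prop := fun g => (⟨D g, g, rfl⟩, (A g).det = 1)
  have : Finite (Set.range D) := hDf
  choose ρ' hρ' using fun d : Set.range D' => d.2
  have hB : ∀ g : S, ∃ γ ∈ latticeStab J b,
      ∀ i, γ.1.val * c (ρ' ⟨D' g, g, rfl⟩) i = c g i := by
    intro g
    set g₀ := ρ' ⟨D' g, g, rfl⟩ with hg₀
    have h0 : D' g₀ = D' g := hρ' ⟨D' g, g, rfl⟩
    have h1 : (⟨D g₀, g₀, rfl⟩ : Set.range D) = ⟨D g, g, rfl⟩ := congrArg Prod.fst h0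
    have h2 : ((A g₀).det = 1) = ((A g).det = 1) := congrArg Prod.snd h0
    have h3 : (A g).det = (A g₀).det := by
      rcases hAd g with h | h <;> rcases hAd g₀ with h' | h'
      · rw [h, h']
      · rw [h2.mpr h] at h'; norm_num at h'
      · rw [h2.mp h'] at h; norm_num at h
      · rw [h, h']
    have hu : IsUnit (A g₀).det := by
      rcases hAd g₀ with h | h <;> rw [h] <;> norm_num
    have hinv : A g₀ * (A g₀)⁻¹ = 1 := Matrix.mul_nonsing_inv _ hu
    have hinv' : (A g₀)⁻¹ * A g₀ = 1 := Matrix.nonsing_inv_mul _ hu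
    have hform : (A g * (A g₀)⁻¹)ᵀ * J * (A g * (A g₀)⁻¹) = J := by
      rw [Matrix.transpose_mul]
      calc (A g₀)⁻¹ᵀ * (A g)ᵀ * J * (A g * (A g₀)⁻¹)
          = (A g₀)⁻¹ᵀ * ((A g)ᵀ * J * A g) * (A g₀)⁻¹ := by simp only [Matrix.mul_assoc]
        _ = (A g₀)⁻¹ᵀ * ((A g₀)ᵀ * J * A g₀) * (A g₀)⁻¹ := by rw [hAJ, hAJ]
        _ = (A g₀ * (A g₀)⁻¹)ᵀ * J * (A g₀ * (A g₀)⁻¹) := by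
            simp only [Matrix.mul_assoc, Matrix.transpose_mul]
        _ = J := by rw [hinv]; simp
    have hdet : (A g * (A g₀)⁻¹).det = 1 := by
      rw [Matrix.det_mul, h3, ← Matrix.det_mul, hinv, Matrix.det_one]
    refine ⟨SOQ.mk _ hdet hform, fun x => ?_, fun i => ?_⟩
    · rw [SOQ.mk_val, Matrix.mul_assoc, hAL, ← hAL g₀, ← Matrix.mul_assoc, hinv, Matrix.one_mul]
    · rw [SOQ.mk_val, ← hAc g i, ← h1, ← hAc g₀ i, Matrix.mul_assoc, ← Matrix.mul_assoc _ (A g₀),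
        hinv', Matrix.one_mul]
  choose γ hγ hγc using hB
  choose R' hR' using fun d : Set.range D' => entryNorm_le_of_basis (c (ρ' d)) R
  refine ⟨⋃ d : Set.range D', (fun g : SOQ J => g⁻¹) ⁻¹' {g | entryNorm g.1.val ≤ R' d},
    isCompact_iUnion fun d => ?_, fun g hg => ?_⟩
  · exact (Homeomorph.inv (SOQ J)).isCompact_preimage.2 (SOQ.isCompact_le hJ _)
  · let s : S := ⟨g⁻¹, hg⟩
    refine ⟨γ s, hγ s, (γ s)⁻¹ * g, Set.mem_iUnion.2 ⟨⟨D' s, s, rfl⟩, ?_⟩, by group⟩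
    refine hR' _ _ fun i => ?_
    have : (((γ s)⁻¹ * g)⁻¹).1.val * c (ρ' ⟨D' s, s, rfl⟩) i = (g⁻¹).1.val * c s i := by
      rw [_root_.mul_inv_rev, inv_inv, SOQ.mul_val, Matrix.mul_assoc, hγc]
    rw [this]
    exact (hc s i).2

end reduction_theory

section bivectors

variable {ι κ : Type*} [Fintype ι] [DecidableEq ι] [Fintype κ] {J : Matrix ι ι ℝ}

/-- The standard symplectic matrix of size two. -/
def symplMat : Matrix (Fin 2) (Fin 2) ℝ := !![0, 1; -1, 0]

/-- The bivector of the two columns of a matrix, as an antisymmetric matrix. -/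
def colBivector (x : Matrix ι (Fin 2) ℝ) : Matrix ι ι ℝ := x * symplMat * xᵀ

lemma colBivector_mul (A : Matrix ι ι ℝ) (x : Matrix ι (Fin 2) ℝ) :
    colBivector (A * x) = A * colBivector x * Aᵀ := by
  simp only [colBivector, Matrix.transpose_mul, Matrix.mul_assoc]

lemma colBivector_mem_isoCone {x : Matrix ι (Fin 2) ℝ} (hx : xᵀ * J * x = 0) :
    colBivector x ∈ isoCone J := by
  have hε : symplMatᵀ = -symplMat := by
    ext i j; fin_cases i <;> fin_cases j <;> simp [symplMat]
  refine ⟨?_, ?_⟩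
  · simp only [colBivector, Matrix.transpose_mul, Matrix.transpose_transpose, hε, Matrix.mul_assoc,
      Matrix.neg_mul, Matrix.mul_neg]
  · calc colBivector x * J * colBivector x
        = x * symplMat * (xᵀ * J * x) * symplMat * xᵀ := by
          simp only [colBivector, Matrix.mul_assoc]
      _ = 0 := by rw [hx]; simp

lemma entryNorm_colBivector_le (x : Matrix ι (Fin 2) ℝ) :
    entryNorm (colBivector x) ≤ 2 * entryNorm x ^ 2 := by
  have h : entryNorm symplMat = 2 := by
    simp [symplMat, entryNorm, Fin.sum_univ_two]; norm_num
  refine (entryNorm_mul_le _ _).trans ?_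
  rw [entryNorm_transpose]
  have := entryNorm_mul_le x symplMat
  rw [h] at this
  nlinarith [entryNorm_nonneg x]

lemma abs_trace_le_entryNorm (A : Matrix ι ι ℝ) : |A.trace| ≤ entryNorm A := by
  refine (Finset.abs_sum_le_sum_abs _ _).trans (Finset.sum_le_sum fun i _ => ?_)
  exact Finset.single_le_sum (f := fun j => |A i j|) (fun _ _ => abs_nonneg _) (Finset.mem_univ i)

lemma trace_colBivector (hJt : Jᵀ = J) (x y : Matrix ι (Fin 2) ℝ) :
    (colBivector x * J * colBivector y * J).trace = -2 * (xᵀ * J * y).det := by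
  have h1 : (colBivector x * J * colBivector y * J).trace =
      (symplMat * (xᵀ * J * y) * symplMat * (xᵀ * J * y)ᵀ).trace := by
    have : (xᵀ * J * y)ᵀ = yᵀ * J * x := by
      simp only [Matrix.transpose_mul, Matrix.transpose_transpose, hJt, Matrix.mul_assoc]
    rw [this]
    have h2 : colBivector x * J * colBivector y * J =
        x * (symplMat * (xᵀ * J * y) * symplMat * (yᵀ * J)) := by
      simp only [colBivector, Matrix.mul_assoc]
    rw [h2, Matrix.trace_mul_comm]
    simp only [Matrix.mul_assoc]
  rw [h1]
  generalize xᵀ * J * y = M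
  rw [Matrix.det_fin_two, Matrix.trace_fin_two]
  simp [symplMat, Matrix.mul_apply, Matrix.vecMul, dotProduct, Fin.sum_univ_two]
  ring

lemma abs_det_form_le (hJt : Jᵀ = J) (x y : Matrix ι (Fin 2) ℝ) :
    2 * |(xᵀ * J * y).det| ≤
      entryNorm J ^ 2 * (entryNorm (colBivector x) * entryNorm (colBivector y)) := by
  have h1 := abs_trace_le_entryNorm (colBivector x * J * colBivector y * J)
  rw [trace_colBivector hJt, abs_mul, abs_neg, abs_two] at h1
  refine h1.trans ((entryNorm_mul_le _ _).trans ?_)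
  have h2 := entryNorm_mul_le (colBivector x * J) (colBivector y)
  have h3 := entryNorm_mul_le (colBivector x) J
  calc entryNorm (colBivector x * J * colBivector y) * entryNorm J
      ≤ (entryNorm (colBivector x) * entryNorm J * entryNorm (colBivector y)) * entryNorm J := by
        gcongr
        · exact entryNorm_nonneg _
        · exact h2.trans (mul_le_mul_of_nonneg_right h3 (entryNorm_nonneg _))
    _ = _ := by ring

/-- The values of the form on the lattice are discrete, in the entrywise sense and for the
determinant. -/
structure HasDiscreteForm (J : Matrix ι ι ℝ) (b : Module.Basis κ ℝ (Matrix ι (Fin 2) ℝ)) :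
    Prop where
  finite_values : ∀ R : ℝ, (formValues J b ∩ {M | entryNorm M ≤ R}).Finite
  eq_zero_of_det : ∀ x ∈ colLattice b, ∀ y ∈ colLattice b, |(xᵀ * J * y).det| < 1 →
    xᵀ * J * y = 0

variable {b : Module.Basis κ ℝ (Matrix ι (Fin 2) ℝ)}

lemma HasDiscreteForm.exists_one_le_det (hb : HasDiscreteForm J b) (hJ : J * J = 1)
    {x : Matrix ι (Fin 2) ℝ} (hx : x ∈ colLattice b) (hx0 : x ≠ 0) (hJt : Jᵀ = J) :
    ∃ j, 1 ≤ |(xᵀ * J * b j).det| := by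
  by_contra! hlt
  refine hx0 (eq_zero_of_basis_form hJ b fun i => ?_)
  have h1 := hb.eq_zero_of_det x hx (b i) (Submodule.subset_span (Set.mem_range_self i)) (hlt i)
  have h2 := congrArg Matrix.transpose h1
  simpa only [Matrix.transpose_mul, Matrix.transpose_transpose, hJt, Matrix.mul_assoc,
    Matrix.transpose_zero] using h2

lemma HasDiscreteForm.exists_pos_le (hb : HasDiscreteForm J b) (hJ : J * J = 1) (hJt : Jᵀ = J) :
    ∃ η : ℝ, 0 < η ∧ ∀ x ∈ colLattice b, x ≠ 0 → η ≤ entryNorm x := by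
  set B := ∑ j, entryNorm (b j) with hB
  have hB0 : 0 ≤ B := Finset.sum_nonneg fun _ _ => entryNorm_nonneg _
  have hJ0 := entryNorm_nonneg J
  refine ⟨(entryNorm J * B + 1)⁻¹, by positivity, fun x hx hx0 => ?_⟩
  obtain ⟨j, hj⟩ := hb.exists_one_le_det hJ hx hx0 hJt
  have hjB : entryNorm (b j) ≤ B :=
    Finset.single_le_sum (f := fun j => entryNorm (b j)) (fun _ _ => entryNorm_nonneg _)
      (Finset.mem_univ j)
  have h1 := hj.trans (abs_det_two_le _)
  have h2 : 1 ≤ entryNorm (xᵀ * J * b j) := by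
    by_contra! h
    nlinarith [entryNorm_nonneg (xᵀ * J * b j)]
  have h3 : entryNorm (xᵀ * J * b j) ≤ entryNorm x * entryNorm J * B := by
    refine (entryNorm_mul_le _ _).trans (mul_le_mul ?_ hjB (entryNorm_nonneg _)
      (mul_nonneg (entryNorm_nonneg _) hJ0))
    refine (entryNorm_mul_le _ _).trans_eq ?_
    rw [entryNorm_transpose]
  rw [inv_le_iff_one_le_mul₀ (by positivity)]
  nlinarith [entryNorm_nonneg x]

lemma HasDiscreteForm.discreteTopology (hb : HasDiscreteForm J b) (hJ : J * J = 1)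
    (hJt : Jᵀ = J) : DiscreteTopology (latticeStab J b) := by
  obtain ⟨η, hη, hηL⟩ := hb.exists_pos_le hJ hJt
  rw [discreteTopology_iff_isOpen_singleton_one]
  have hc : ∀ j, Continuous fun g : latticeStab J b => entryNorm (g.1.1.val * b j - b j) := by
    intro j
    refine continuous_entryNorm.comp ?_
    have h1 : Continuous fun g : latticeStab J b => g.1.1.val :=
      SOQ.continuous_val.comp continuous_subtype_val
    exact (h1.matrix_mul continuous_const).sub continuous_const
  have : ({1} : Set (latticeStab J b)) = ⋂ j, {g | entryNorm (g.1.1.val * b j - b j) < η} := by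
    ext g
    simp only [Set.mem_singleton_iff, Set.mem_iInter, Set.mem_ofPred_eq]
    constructor
    · rintro rfl j
      have : ((1 : latticeStab J b).1.1.val : Matrix ι ι ℝ) = 1 := rfl
      rw [this, Matrix.one_mul, sub_self, entryNorm_zero]
      exact hη
    · intro h
      have hbj : ∀ j, g.1.1.val * b j = b j := by
        intro j
        by_contra hne
        have hj : b j ∈ colLattice b := Submodule.subset_span (Set.mem_range_self j)
        exact absurd (h j) (not_lt.2 (hηL _ (Submodule.sub_mem _ ((g.2 _).2 hj) hj)
          (sub_ne_zero.2 hne)))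
      have hall : ∀ x : Matrix ι (Fin 2) ℝ, g.1.1.val * x = x := by
        intro x
        conv_rhs => rw [← b.sum_repr x]
        conv_lhs => rw [← b.sum_repr x]
        simp only [Matrix.mul_sum, Matrix.mul_smul, hbj]
      refine Subtype.ext (SOQ.ext_val ?_)
      show g.1.1.val = 1
      ext i j
      have h1 := congrFun (congrFun (hall (Matrix.single j 0 1)) i) 0
      simpa [Matrix.single_apply, Matrix.one_apply, eq_comm] using h1
  rw [this]
  exact isOpen_iInter_of_finite fun j => isOpen_lt (hc j) continuous_const

end bivectors

section cusps

variable {ι κ : Type*} [Fintype ι] [DecidableEq ι] [Fintype κ] {J : Matrix ι ι ℝ}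
  {b : Module.Basis κ ℝ (Matrix ι (Fin 2) ℝ)}

/-- The nonzero isotropic vectors of the lattice. -/
def isotropicVectors (J : Matrix ι ι ℝ) (b : Module.Basis κ ℝ (Matrix ι (Fin 2) ℝ)) :
    Set (Matrix ι (Fin 2) ℝ) :=
  {x | x ∈ colLattice b ∧ x ≠ 0 ∧ xᵀ * J * x = 0}

/-- The height function on `SOQ J` measuring the excursion into the cusps. -/
noncomputable def cuspHeight (J : Matrix ι ι ℝ) (b : Module.Basis κ ℝ (Matrix ι (Fin 2) ℝ))
    (δ : ℝ) (g : SOQ J) : ENNReal :=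
  ⨆ x ∈ isotropicVectors J b,
    ENNReal.ofReal (entryNorm (colBivector ((g⁻¹).1.val * x)) ^ (-δ))

lemma HasDiscreteForm.exists_pos_le_colBivector (hb : HasDiscreteForm J b) (hJ : J * J = 1)
    (hJt : Jᵀ = J) (g : SOQ J) :
    ∃ c : ℝ, 0 < c ∧ ∀ x ∈ colLattice b, x ≠ 0 → c ≤ entryNorm (colBivector (g.1.val * x)) := by
  set B := ∑ j, entryNorm J ^ 2 * entryNorm (colBivector (g.1.val * b j)) with hB
  have h0 : ∀ j, 0 ≤ entryNorm J ^ 2 * entryNorm (colBivector (g.1.val * b j)) := fun j =>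
    mul_nonneg (sq_nonneg _) (entryNorm_nonneg _)
  have hB0 : 0 ≤ B := Finset.sum_nonneg fun j _ => h0 j
  refine ⟨(B + 1)⁻¹, by positivity, fun x hx hx0 => ?_⟩
  obtain ⟨j, hj⟩ := hb.exists_one_le_det hJ hx hx0 hJt
  have h1 := abs_det_form_le hJt (g.1.val * x) (g.1.val * b j)
  rw [SOQ.form_mul g] at h1
  have h2 : entryNorm J ^ 2 * entryNorm (colBivector (g.1.val * b j)) ≤ B :=
    Finset.single_le_sum (f := fun j => entryNorm J ^ 2 * entryNorm (colBivector (g.1.val * b j)))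
      (fun j _ => h0 j) (Finset.mem_univ j)
  rw [inv_le_iff_one_le_mul₀ (by positivity)]
  have h3 := entryNorm_nonneg (colBivector (g.1.val * x))
  nlinarith [mul_le_mul_of_nonneg_left h2 h3]

lemma cuspHeight_ne_top (hb : HasDiscreteForm J b) (hJ : J * J = 1) (hJt : Jᵀ = J) {δ : ℝ}
    (hδ : 0 < δ) (g : SOQ J) : cuspHeight J b δ g ≠ ⊤ := by
  obtain ⟨c, hc, hcx⟩ := hb.exists_pos_le_colBivector hJ hJt g⁻¹
  refine ne_top_of_le_ne_top (ENNReal.ofReal_ne_top (r := c ^ (-δ))) (iSup₂_le fun x hx => ?_)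
  exact ENNReal.ofReal_le_ofReal
    (Real.rpow_le_rpow_of_nonpos hc (hcx x hx.1 hx.2.1) (by linarith))

lemma entryNorm_le_conj {g : SOQ J} (hg : g * g = 1) (w : Matrix ι ι ℝ) :
    entryNorm w ≤ entryNorm g.1.val ^ 2 * entryNorm (g.1.val * w * g.1.valᵀ) := by
  set r := g.1.val with hr
  have h1 : r * r = 1 := by
    rw [hr, ← SOQ.mul_val, hg]; rfl
  have h2 : rᵀ * rᵀ = 1 := by rw [← transpose_mul, h1, transpose_one]
  have h3 : w = r * (r * w * rᵀ) * rᵀ := by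
    calc w = (r * r) * w * (rᵀ * rᵀ) := by rw [h1, h2, Matrix.one_mul, Matrix.mul_one]
      _ = _ := by simp only [Matrix.mul_assoc]
  have h4 := entryNorm_mul_le (r * (r * w * rᵀ)) rᵀ
  have h5 := entryNorm_mul_le r (r * w * rᵀ)
  rw [← h3, entryNorm_transpose] at h4
  have := mul_le_mul_of_nonneg_right h5 (entryNorm_nonneg r)
  calc entryNorm w ≤ _ := h4
    _ ≤ _ := this
    _ = _ := by ring

lemma HasDiscreteForm.no_short_of_cusp (hb : HasDiscreteForm J b) {g : SOQ J} {c : ℝ}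
    (hc : 0 < c) (h : ∀ x ∈ isotropicVectors J b, c ≤ entryNorm (colBivector (g.1.val * x))) :
    ∀ x ∈ colLattice b, x ≠ 0 →
      min (min 1 (c / 4)) (entryNorm J + 1)⁻¹ ≤ entryNorm (g.1.val * x) := by
  intro x hx hx0
  by_contra! hlt
  have h1 : entryNorm (g.1.val * x) < 1 :=
    hlt.trans_le ((min_le_left _ _).trans (min_le_left _ _))
  have h2 : entryNorm (g.1.val * x) < c / 4 :=
    hlt.trans_le ((min_le_left _ _).trans (min_le_right _ _))
  have h3 : entryNorm (g.1.val * x) < (entryNorm J + 1)⁻¹ := hlt.trans_le (min_le_right _ _)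
  have h0 := entryNorm_nonneg (g.1.val * x)
  have hJ0 := entryNorm_nonneg J
  rw [lt_inv_comm₀ (lt_of_le_of_ne h0 ?_) (by positivity)] at h3
  swap
  · intro h4
    have h5 : c ≤ 0 := by
      by_cases hi : xᵀ * J * x = 0
      · refine (h x ⟨hx, hx0, hi⟩).trans ((entryNorm_colBivector_le _).trans_eq ?_)
        rw [← h4]; ring
      · have h6 : g.1.val * x = 0 := entryNorm_eq_zero.1 h4.symm
        exact absurd (by rw [← SOQ.form_mul g, h6]; simp) hi
    linarith
  have h4 := entryNorm_form_le g (x := x) (y := x) le_rfl le_rfl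
  have hpos : 0 < entryNorm (g.1.val * x) := by
    by_contra! h5
    have : entryNorm (g.1.val * x) = 0 := le_antisymm h5 h0
    rw [this, _root_.inv_zero] at h3
    linarith
  have h5 : entryNorm J * entryNorm (g.1.val * x) < 1 := by
    have := mul_lt_mul_of_pos_right h3 hpos
    rw [inv_mul_cancel₀ hpos.ne'] at this
    linarith
  have h6 : entryNorm (xᵀ * J * x) < 1 := by nlinarith
  have h7 : |(xᵀ * J * x).det| < 1 :=
    (abs_det_two_le _).trans_lt (by nlinarith [entryNorm_nonneg (xᵀ * J * x)])
  have h8 := h x ⟨hx, hx0, hb.eq_zero_of_det x hx x hx h7⟩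
  have h9 := entryNorm_colBivector_le (g.1.val * x)
  nlinarith

/-- Lattice points that are orthogonal and isotropic span the same line of bivectors. -/
def HasRankOneCusps (J : Matrix ι ι ℝ) (b : Module.Basis κ ℝ (Matrix ι (Fin 2) ℝ)) : Prop :=
  ∀ x ∈ isotropicVectors J b, ∀ y ∈ isotropicVectors J b, xᵀ * J * y = 0 →
    ∃ t : ℝ, colBivector y = t • colBivector x

lemma avgOp_cuspHeight_le (hb : HasDiscreteForm J b) (hJ : J * J = 1) (hJt : Jᵀ = J)
    (hpar : HasRankOneCusps J b) {r : ℕ} (hr : 0 < r) {h : Fin r → SOQ J}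
    (hh : ∀ i, h i * h i = 1) {δ : ℝ} (hδ : 0 < δ)
    (hcontr : ∀ w ∈ isoCone J, w ≠ 0 → ∑ i, entryNorm ((h i).1.val * w * (h i).1.valᵀ) ^ (-δ) ≤
      3 / 4 * r * entryNorm w ^ (-δ)) :
    ∃ B : ENNReal, B ≠ ⊤ ∧ ∀ g, avgOp h (cuspHeight J b δ) g ≤
      ((3 / 4 : NNReal) : ENNReal) * cuspHeight J b δ g + B := by
  set K := ∑ i, entryNorm (h i).1.val ^ 2 + 1 with hK
  have hK0 : 0 < K := by
    have : 0 ≤ ∑ i, entryNorm (h i).1.val ^ 2 := Finset.sum_nonneg fun _ _ => sq_nonneg _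
    linarith
  have hKw : ∀ i w, entryNorm w / K ≤ entryNorm ((h i).1.val * w * (h i).1.valᵀ) := by
    intro i w
    rw [div_le_iff₀ hK0, mul_comm]
    refine (entryNorm_le_conj (hh i) w).trans (mul_le_mul_of_nonneg_right ?_ (entryNorm_nonneg _))
    have := Finset.single_le_sum (f := fun i => entryNorm (h i).1.val ^ 2)
      (fun _ _ => sq_nonneg _) (Finset.mem_univ i)
    linarith
  set ρ := (entryNorm J + 1)⁻¹ with hρ
  have hJ0 := entryNorm_nonneg J
  have hρ0 : 0 < ρ := by positivity
  set B := ENNReal.ofReal ((ρ / K) ^ (-δ)) with hB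
  have hval : ∀ (g : SOQ J) i (x : Matrix ι (Fin 2) ℝ), colBivector (((g * h i)⁻¹).1.val * x) =
      (h i).1.val * colBivector ((g⁻¹).1.val * x) * (h i).1.valᵀ := by
    intro g i x
    have h1 : (h i)⁻¹ = h i := inv_eq_of_mul_eq_one_left (hh i)
    rw [_root_.mul_inv_rev, h1, SOQ.mul_val, Matrix.mul_assoc, colBivector_mul]
  have hlarge : ∀ (g : SOQ J) i (x : Matrix ι (Fin 2) ℝ), ρ ≤ entryNorm (colBivector ((g⁻¹).1.val * x)) →
      ENNReal.ofReal (entryNorm (colBivector (((g * h i)⁻¹).1.val * x)) ^ (-δ)) ≤ B := by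
    intro g i x hx
    rw [hval]
    refine ENNReal.ofReal_le_ofReal (Real.rpow_le_rpow_of_nonpos (by positivity) ?_ (by linarith))
    exact le_trans (by gcongr) (hKw i _)
  have hrB : (r : ENNReal)⁻¹ * (r * B) = B := by
    rw [← mul_assoc, ENNReal.inv_mul_cancel (by exact_mod_cast hr.ne') (by simp), one_mul]
  refine ⟨B, ENNReal.ofReal_ne_top, fun g => ?_⟩
  by_cases hall : ∀ x ∈ isotropicVectors J b, ρ ≤ entryNorm (colBivector ((g⁻¹).1.val * x))
  · refine le_trans ?_ le_add_self
    rw [← hrB, avgOp]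
    gcongr
    refine (Finset.sum_le_card_nsmul _ _ B fun i _ => iSup₂_le fun x hx =>
      hlarge g i x (hall x hx)).trans_eq ?_
    simp
  push Not at hall
  obtain ⟨x₀, hx₀, hlt⟩ := hall
  obtain ⟨c, hc, hcx⟩ := hb.exists_pos_le_colBivector hJ hJt g⁻¹
  set u := colBivector ((g⁻¹).1.val * x₀) with hu
  have hu0 : 0 < entryNorm u := hc.trans_le (hcx x₀ hx₀.1 hx₀.2.1)
  have hune : u ≠ 0 := by
    rintro h0
    rw [h0, entryNorm_zero] at hu0
    exact lt_irrefl _ hu0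
  have huc : u ∈ isoCone J := by
    refine colBivector_mem_isoCone ?_
    rw [SOQ.form_mul]
    exact hx₀.2.2
  have hs := hcontr u huc hune
  let k : Fin r → ℝ := fun i =>
    entryNorm ((h i).1.val * u * (h i).1.valᵀ) ^ (-δ) * entryNorm u ^ δ
  have hk0 : ∀ i, 0 ≤ k i := fun i => mul_nonneg
    (Real.rpow_nonneg (entryNorm_nonneg _) _) (Real.rpow_nonneg (entryNorm_nonneg _) _)
  have hks : ∑ i, k i ≤ 3 / 4 * r := by
    rw [← Finset.sum_mul]
    refine (mul_le_mul_of_nonneg_right hs (Real.rpow_nonneg hu0.le _)).trans_eq ?_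
    rw [mul_assoc, ← Real.rpow_add hu0, neg_add_cancel, Real.rpow_zero, mul_one]
  have hstep : ∀ i, cuspHeight J b δ (g * h i) ≤
      ENNReal.ofReal (k i) * cuspHeight J b δ g + B := by
    intro i
    refine iSup₂_le fun x hx => ?_
    by_cases hxρ : ρ ≤ entryNorm (colBivector ((g⁻¹).1.val * x))
    · exact (hlarge g i x hxρ).trans le_add_self
    · push Not at hxρ
      have h1 : 2 * |(x₀ᵀ * J * x).det| < 2 := by
        rw [← SOQ.form_mul g⁻¹]
        refine (abs_det_form_le hJt _ _).trans_lt ?_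
        have h2 : entryNorm u * entryNorm (colBivector ((g⁻¹).1.val * x)) ≤ ρ * ρ :=
          mul_le_mul hlt.le hxρ.le (entryNorm_nonneg _) hρ0.le
        have h3 : entryNorm J * ρ < 1 := by
          rw [hρ, ← div_eq_mul_inv, div_lt_one (by positivity)]
          linarith
        have h4 := mul_le_mul_of_nonneg_left h2 (sq_nonneg (entryNorm J))
        nlinarith [mul_nonneg hJ0 hρ0.le]
      have h2 := hb.eq_zero_of_det x₀ hx₀.1 x hx.1 (by linarith)
      obtain ⟨t, ht⟩ := hpar x₀ hx₀ x hx h2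
      have h3 : colBivector ((g⁻¹).1.val * x) = t • u := by
        rw [hu, colBivector_mul, colBivector_mul, ht, Matrix.mul_smul, Matrix.smul_mul]
      have h4 : entryNorm (colBivector (((g * h i)⁻¹).1.val * x)) ^ (-δ) =
          k i * entryNorm (colBivector ((g⁻¹).1.val * x)) ^ (-δ) := by
        rw [hval, h3, Matrix.mul_smul, Matrix.smul_mul, entryNorm_smul, entryNorm_smul,
          Real.mul_rpow (abs_nonneg _) (entryNorm_nonneg _),
          Real.mul_rpow (abs_nonneg _) (entryNorm_nonneg _)]
        have h5 : entryNorm u ^ δ * entryNorm u ^ (-δ) = 1 := by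
          rw [← Real.rpow_add hu0, add_neg_cancel, Real.rpow_zero]
        linear_combination (-(|t| ^ (-δ) *
          entryNorm ((h i).1.val * u * (h i).1.valᵀ) ^ (-δ))) * h5
      rw [h4, ENNReal.ofReal_mul (hk0 i)]
      refine le_trans ?_ le_self_add
      gcongr
      exact le_iSup₂ (f := fun x (_ : x ∈ isotropicVectors J b) =>
        ENNReal.ofReal (entryNorm (colBivector ((g⁻¹).1.val * x)) ^ (-δ))) x hx
  calc avgOp h (cuspHeight J b δ) g
      ≤ (r : ENNReal)⁻¹ * ∑ i, (ENNReal.ofReal (k i) * cuspHeight J b δ g + B) := by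
        rw [avgOp]
        gcongr with i
        exact hstep i
    _ = (r : ENNReal)⁻¹ * ENNReal.ofReal (∑ i, k i) * cuspHeight J b δ g + B := by
        rw [Finset.sum_add_distrib, ← Finset.sum_mul, ENNReal.ofReal_sum_of_nonneg fun i _ => hk0 i,
          mul_add, Finset.sum_const, Finset.card_univ, Fintype.card_fin, nsmul_eq_mul, hrB,
          mul_assoc]
    _ ≤ ((3 / 4 : NNReal) : ENNReal) * cuspHeight J b δ g + B := by
        gcongr
        calc (r : ENNReal)⁻¹ * ENNReal.ofReal (∑ i, k i)
            ≤ (r : ENNReal)⁻¹ * ENNReal.ofReal (r * (3 / 4 : NNReal)) := by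
              gcongr
              refine hks.trans_eq ?_
              push_cast
              ring
          _ = _ := by
              rw [ENNReal.ofReal_mul (by positivity), ENNReal.ofReal_natCast,
                ENNReal.ofReal_coe_nnreal, ← mul_assoc,
                ENNReal.inv_mul_cancel (by exact_mod_cast hr.ne') (by simp), one_mul]

lemma exists_compact_of_cuspHeight_le (hb : HasDiscreteForm J b) (hJ : J * J = 1) {δ : ℝ}
    (hδ : 0 < δ) {R : ENNReal} (hR : R ≠ ⊤) (hpos : ∀ g : SOQ J, ∀ x ∈ isotropicVectors J b,
      0 < entryNorm (colBivector ((g⁻¹).1.val * x))) :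
    ∃ C : Set (SOQ J), IsCompact C ∧ ∀ g, cuspHeight J b δ g ≤ R →
      ∃ γ ∈ latticeStab J b, ∃ c ∈ C, g = γ * c := by
  set c := (R.toReal + 1) ^ (-δ⁻¹) with hc
  have hR0 : 0 < R.toReal + 1 := by positivity
  have hc0 : 0 < c := Real.rpow_pos_of_pos hR0 _
  have hJ0 := entryNorm_nonneg J
  obtain ⟨C, hC, hCg⟩ := exists_compact_of_no_short_vectors hJ hb.finite_values
    (ε := min (min 1 (c / 4)) (entryNorm J + 1)⁻¹)
    (lt_min (lt_min one_pos (by positivity)) (by positivity))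
  refine ⟨C, hC, fun g hg => hCg g (hb.no_short_of_cusp hc0 fun x hx => ?_)⟩
  have h1 : ENNReal.ofReal (entryNorm (colBivector ((g⁻¹).1.val * x)) ^ (-δ)) ≤ R :=
    le_trans (le_iSup₂ (f := fun x (_ : x ∈ isotropicVectors J b) =>
      ENNReal.ofReal (entryNorm (colBivector ((g⁻¹).1.val * x)) ^ (-δ))) x hx) hg
  rw [ENNReal.ofReal_le_iff_le_toReal hR] at h1
  have h2 := hpos g x hx
  have h3 : entryNorm (colBivector ((g⁻¹).1.val * x)) ^ (-δ) ≤ R.toReal + 1 := by linarith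
  have h4 := Real.rpow_le_rpow_of_nonpos (Real.rpow_pos_of_pos h2 (-δ)) h3
    (z := -δ⁻¹) (by simp [hδ.le])
  rw [← Real.rpow_mul h2.le, neg_mul_neg, mul_inv_cancel₀ hδ.ne', Real.rpow_one] at h4
  exact h4

/-- The stabilizer of a lattice with discrete form has compact quotient if the form is
anisotropic on the lattice. -/
lemma exists_compact_of_anisotropic (hb : HasDiscreteForm J b) (hJ : J * J = 1)
    (ha : isotropicVectors J b = ∅) :
    ∃ C : Set (SOQ J), IsCompact C ∧ ∀ g, ∃ γ ∈ latticeStab J b, ∃ c ∈ C, g = γ * c := by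
  obtain ⟨C, hC, hCg⟩ := exists_compact_of_cuspHeight_le hb hJ one_pos ENNReal.zero_ne_top
    (fun g x hx => by simp [ha] at hx)
  exact ⟨C, hC, fun g => hCg g (by simp [cuspHeight, ha])⟩

/-- If an isotropic vector of the lattice can be contracted then the quotient is not compact. -/
lemma not_compactSpace_of_contracted (hb : HasDiscreteForm J b) (hJ : J * J = 1) (hJt : Jᵀ = J)
    {x : Matrix ι (Fin 2) ℝ} (hx : x ∈ isotropicVectors J b)
    (hcon : ∀ c : ℝ, 0 < c → ∃ g : SOQ J, entryNorm (colBivector (g.1.val * x)) < c) :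
    ¬ CompactSpace (SOQ J ⧸ latticeStab J b) := by
  intro hcomp
  have := SOQ.locallyCompactSpace hJ
  have hopen : ∀ R : ℝ, IsOpen {g : SOQ J | entryNorm (g⁻¹).1.val < R} := fun R =>
    isOpen_lt (continuous_entryNorm.comp (SOQ.continuous_val.comp continuous_inv)) continuous_const
  let U : ℕ → Set (SOQ J ⧸ latticeStab J b) := fun n =>
    (QuotientGroup.mk : SOQ J → _) '' {g | entryNorm (g⁻¹).1.val < n}
  have hU : ∀ n, IsOpen (U n) := fun n => QuotientGroup.isOpenMap_coe _ (hopen n)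
  have hmono : Monotone U := by
    intro m n hmn
    refine Set.image_mono fun g hg => ?_
    rw [Set.mem_ofPred_eq] at hg ⊢
    exact hg.trans_le (by exact_mod_cast hmn)
  have hcov : (Set.univ : Set (SOQ J ⧸ latticeStab J b)) ⊆ ⋃ n, U n := by
    rintro q -
    obtain ⟨g, rfl⟩ := QuotientGroup.mk_surjective q
    obtain ⟨n, hn⟩ := exists_nat_gt (entryNorm (g⁻¹).1.val)
    exact Set.mem_iUnion.2 ⟨n, g, hn, rfl⟩
  obtain ⟨n, hn⟩ := isCompact_univ.elim_directed_cover U hU hcov hmono.directed_le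
  obtain ⟨c, hc, hcx⟩ := hb.exists_pos_le_colBivector hJ hJt 1
  obtain ⟨g, hg⟩ := hcon (c / ((n : ℝ) ^ 2 + 1)) (by positivity)
  obtain ⟨s, hs, hsg⟩ := hn (Set.mem_univ (QuotientGroup.mk g))
  have hγ : s⁻¹ * g ∈ latticeStab J b := QuotientGroup.eq.1 hsg
  have h1 : (s⁻¹ * g).1.val * x ∈ colLattice b := (hγ x).2 hx.1
  have h2 : (s⁻¹ * g).1.val * x ≠ 0 := by
    intro h0
    refine hx.2.1 ?_
    rw [← Matrix.one_mul x, ← SOQ.inv_mul_val (s⁻¹ * g), Matrix.mul_assoc, h0, Matrix.mul_zero]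
  have h3 := hcx _ h1 h2
  have h4 : (((1 : SOQ J)).1.val : Matrix ι ι ℝ) = 1 := rfl
  rw [h4, Matrix.one_mul, SOQ.mul_val, Matrix.mul_assoc, colBivector_mul] at h3
  rw [Set.mem_ofPred_eq] at hs
  set w := colBivector (g.1.val * x)
  have h5 : entryNorm ((s⁻¹).1.val * w * (s⁻¹).1.valᵀ) ≤
      entryNorm (s⁻¹).1.val ^ 2 * entryNorm w := by
    refine (entryNorm_mul_le _ _).trans ?_
    rw [entryNorm_transpose]
    have := entryNorm_mul_le (s⁻¹).1.val w
    nlinarith [entryNorm_nonneg (s⁻¹).1.val]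
  rw [lt_div_iff₀ (by positivity)] at hg
  have h6 := entryNorm_nonneg w
  have h7 := entryNorm_nonneg (s⁻¹).1.val
  have h8 : entryNorm (s⁻¹).1.val ^ 2 ≤ (n : ℝ) ^ 2 := by
    gcongr
  nlinarith [mul_le_mul_of_nonneg_right h8 h6]

end cusps

/-- Finiteness of the covolume of the stabilizer of a lattice with discrete form and rank one
cusps. -/
theorem isLattice_latticeStab {N : ℕ} {κ : Type*} [Fintype κ] {ε : Fin N → ℝ}
    (hε : ∀ i, ε i = 1 ∨ ε i = -1)
    {p m z j₀ : Fin N} (hpm : p ≠ m) (hpz : p ≠ z) (hmz : m ≠ z) (hj : j₀ ∈ otherIdx p m z)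
    (hp : ε p = 1) (hm : ε m = -1) {b : Module.Basis κ ℝ (Matrix (Fin N) (Fin 2) ℝ)}
    (hb : HasDiscreteForm (diagonal ε) b) (hpar : HasRankOneCusps (diagonal ε) b)
    [MeasurableSpace (SOQ (diagonal ε))] [BorelSpace (SOQ (diagonal ε))]
    (μ : Measure (SOQ (diagonal ε))) [μ.IsHaarMeasure] :
    IsLattice μ (latticeStab (diagonal ε) b) := by
  have hJ : diagonal ε * diagonal ε = 1 := by
    rw [diagonal_mul_diagonal, ← diagonal_one]
    congr 1
    funext i
    rcases hε i with h | h <;> simp [h]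
  have hJt : (diagonal ε)ᵀ = diagonal ε := diagonal_transpose ε
  have := SOQ.locallyCompactSpace hJ
  have := SOQ.secondCountableTopology hJ
  have := SOQ.t2Space hJ
  have := hb.discreteTopology hJ hJt
  obtain ⟨r, h, δ, hr, hδ, hh, hcontr⟩ := exists_contracting_involutions hε hpm hpz hmz hj hp hm
  obtain ⟨B, hB, hav⟩ := avgOp_cuspHeight_le hb hJ hJt hpar hr hh hδ hcontr
  refine isLattice_of_contracted_function μ hr h hh (cuspHeight_ne_top hb hJ hJt hδ) hB hav
    fun R hR => exists_compact_of_cuspHeight_le hb hJ hδ hR fun g x hx => ?_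
  obtain ⟨c, hc, hcx⟩ := hb.exists_pos_le_colBivector hJ hJt g⁻¹
  exact hc.trans_le (hcx x hx.1 hx.2.1)

section quadratic_integers

/-- The real embedding of `ℤ[√2]`. -/
noncomputable def sqrtTwoEmb : Zsqrtd 2 →+* ℝ := Zsqrtd.toReal (by norm_num)

lemma sqrtTwoEmb_apply (x : Zsqrtd 2) : sqrtTwoEmb x = x.re + x.im * √2 := by
  simp [sqrtTwoEmb, Zsqrtd.toReal, Zsqrtd.lift]

lemma sqrtTwoEmb_injective : Function.Injective sqrtTwoEmb :=
  Zsqrtd.toReal_injective _ fun n h => by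
    have h1 : n ≤ 1 := by nlinarith
    have h2 : -1 ≤ n := by nlinarith
    interval_cases n <;> omega

lemma sqrtTwoEmb_eq_zero {x : Zsqrtd 2} : sqrtTwoEmb x = 0 ↔ x = 0 :=
  map_eq_zero_iff _ sqrtTwoEmb_injective

lemma isDomain_zsqrtd_two : IsDomain (Zsqrtd 2) := sqrtTwoEmb_injective.isDomain _

lemma sqrtTwoEmb_star (x : Zsqrtd 2) : sqrtTwoEmb (star x) = x.re - x.im * √2 := by
  rw [sqrtTwoEmb_apply]
  simp [sub_eq_add_neg]

lemma sqrtTwoEmb_mul_star (x : Zsqrtd 2) : sqrtTwoEmb x * sqrtTwoEmb (star x) = (x.norm : ℤ) := by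
  rw [sqrtTwoEmb_apply, sqrtTwoEmb_star, Zsqrtd.norm_def]
  have : √2 * √2 = 2 := Real.mul_self_sqrt (by norm_num)
  push_cast
  linear_combination (-(x.im : ℝ) * x.im) * this

lemma finite_bounded_zsqrtd (R : ℝ) :
    {x : Zsqrtd 2 | |sqrtTwoEmb x| ≤ R ∧ |sqrtTwoEmb (star x)| ≤ R}.Finite := by
  have h1 : (Set.Icc (-⌈R⌉) ⌈R⌉ ×ˢ Set.Icc (-⌈R⌉) ⌈R⌉ : Set (ℤ × ℤ)).Finite :=
    (Set.finite_Icc _ _).prod (Set.finite_Icc _ _)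
  refine (h1.image fun p => (⟨p.1, p.2⟩ : Zsqrtd 2)).subset ?_
  rintro ⟨p, q⟩ ⟨ha, hb⟩
  rw [sqrtTwoEmb_apply] at ha
  rw [sqrtTwoEmb_star] at hb
  simp only at ha hb
  rw [abs_le] at ha hb
  have hs : (1 : ℝ) ≤ √2 := by
    rw [Real.one_le_sqrt]; norm_num
  have hR := Int.le_ceil R
  have hp1 : (p : ℝ) ≤ ⌈R⌉ := by linarith
  have hp2 : -(⌈R⌉ : ℝ) ≤ p := by linarith
  have hq : |(q : ℝ)| ≤ R := by
    have : |(q : ℝ)| * √2 ≤ R := by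
      rw [← abs_of_pos (show (0 : ℝ) < √2 by positivity), ← abs_mul, abs_le]
      constructor <;> linarith
    nlinarith [abs_nonneg (q : ℝ)]
  rw [abs_le] at hq
  have hq1 : (q : ℝ) ≤ ⌈R⌉ := by linarith
  have hq2 : -(⌈R⌉ : ℝ) ≤ q := by linarith
  exact ⟨(p, q), ⟨⟨by exact_mod_cast hp2, by exact_mod_cast hp1⟩,
    by exact_mod_cast hq2, by exact_mod_cast hq1⟩, rfl⟩

lemma eq_zero_of_descent {V : Type*} {P : V → Prop} {f : V → ℤ}
    (h : ∀ v, P v → ∃ v', P v' ∧ f v = 3 * f v') {v : V} (hv : P v) : f v = 0 := by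
  have h1 : ∀ n : ℕ, ∀ v, P v → (3 : ℤ) ^ n ∣ f v := by
    intro n
    induction n with
    | zero => simp
    | succ n ih =>
      intro v hv
      obtain ⟨v', hv', he⟩ := h v hv
      rw [he, pow_succ, mul_comm]
      exact mul_dvd_mul_left _ (ih v' hv')
  refine Int.eq_zero_of_abs_lt_dvd (h1 (f v).natAbs v hv) ?_
  rw [Int.abs_eq_natAbs]
  exact_mod_cast Nat.lt_pow_self (by norm_num)

lemma three_dvd_of_sq_add_sq {p q : ℤ} (h : (3 : ℤ) ∣ p ^ 2 + q ^ 2) : 3 ∣ p ∧ 3 ∣ q := by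
  have key : ∀ p q : ZMod 3, p ^ 2 + q ^ 2 = 0 → p = 0 ∧ q = 0 := by decide
  have h1 := key p q (by exact_mod_cast (ZMod.intCast_zmod_eq_zero_iff_dvd _ 3).2 h)
  exact ⟨(ZMod.intCast_zmod_eq_zero_iff_dvd _ 3).1 h1.1,
    (ZMod.intCast_zmod_eq_zero_iff_dvd _ 3).1 h1.2⟩

lemma eq_zero_of_three_mul_norm {x y : Zsqrtd 2} (h : 3 * x.norm = y.norm) : x = 0 ∧ y = 0 := by
  let P : ℤ × ℤ × ℤ × ℤ → Prop := fun v =>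
    3 * (v.1 ^ 2 - 2 * v.2.1 ^ 2) = v.2.2.1 ^ 2 - 2 * v.2.2.2 ^ 2
  have hd : ∀ v, P v → ∃ v', P v' ∧ v.1 = 3 * v'.1 ∧ v.2.1 = 3 * v'.2.1 ∧
      v.2.2.1 = 3 * v'.2.2.1 ∧ v.2.2.2 = 3 * v'.2.2.2 := by
    rintro ⟨p, q, r, s⟩ hv
    simp only [P] at hv
    obtain ⟨⟨r', rfl⟩, ⟨s', rfl⟩⟩ := three_dvd_of_sq_add_sq (p := r) (q := s)
      ⟨p ^ 2 - 2 * q ^ 2 + s ^ 2, by linarith⟩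
    obtain ⟨⟨p', rfl⟩, ⟨q', rfl⟩⟩ := three_dvd_of_sq_add_sq (p := p) (q := q)
      ⟨r' ^ 2 - 2 * s' ^ 2 + q ^ 2, by linarith⟩
    exact ⟨(p', q', r', s'), by simp only [P]; linarith, rfl, rfl, rfl, rfl⟩
  have h0 : P (x.re, x.im, y.re, y.im) := by
    simp only [P]
    rw [Zsqrtd.norm_def, Zsqrtd.norm_def] at h
    linarith
  constructor
  · refine Zsqrtd.ext ?_ ?_
    · exact eq_zero_of_descent (f := fun v => v.1)
        (fun v hv => (hd v hv).imp fun _ h => ⟨h.1, h.2.1⟩) h0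
    · exact eq_zero_of_descent (f := fun v => v.2.1)
        (fun v hv => (hd v hv).imp fun _ h => ⟨h.1, h.2.2.1⟩) h0
  · refine Zsqrtd.ext ?_ ?_
    · exact eq_zero_of_descent (f := fun v => v.2.2.1)
        (fun v hv => (hd v hv).imp fun _ h => ⟨h.1, h.2.2.2.1⟩) h0
    · exact eq_zero_of_descent (f := fun v => v.2.2.2)
        (fun v hv => (hd v hv).imp fun _ h => ⟨h.1, h.2.2.2.2⟩) h0

lemma three_dvd_of_ternary {p q r s : ℤ}
    (h1 : (3 : ℤ) ∣ p ^ 2 + 2 * q ^ 2 - (2 * r ^ 2 + 4 * s ^ 2 + 4 * r * s))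
    (h2 : (3 : ℤ) ∣ 2 * p * q - (r ^ 2 + 2 * s ^ 2 + 4 * r * s)) :
    3 ∣ p ∧ 3 ∣ q ∧ 3 ∣ r ∧ 3 ∣ s := by
  have key : ∀ p q r s : ZMod 3, p ^ 2 + 2 * q ^ 2 - (2 * r ^ 2 + 4 * s ^ 2 + 4 * r * s) = 0 →
      2 * p * q - (r ^ 2 + 2 * s ^ 2 + 4 * r * s) = 0 → p = 0 ∧ q = 0 ∧ r = 0 ∧ s = 0 := by decide
  have h := key p q r s (by exact_mod_cast (ZMod.intCast_zmod_eq_zero_iff_dvd _ 3).2 h1)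
    (by exact_mod_cast (ZMod.intCast_zmod_eq_zero_iff_dvd _ 3).2 h2)
  simpa only [ZMod.intCast_zmod_eq_zero_iff_dvd _ 3, Nat.cast_ofNat] using h

/-- The sextic pair of forms used below is anisotropic, by descent at the prime `3`. -/
lemma eq_zero_of_descent_three {t : ℤ} {x y : Fin 3 → Zsqrtd 2}
    (h1 : -3 * t * x 0 ^ 2 + 2 * x 0 * y 0 - 9 * t * y 0 ^ 2 + (x 1 ^ 2 + 3 * y 1 ^ 2) -
      (⟨2, 1⟩ * x 2 ^ 2 + 3 * ⟨2, -1⟩ * y 2 ^ 2) = 0)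
    (h2 : (-9 * t * (x 0 * star (y 0)) + x 0 * star (x 0) - 9 * t * (y 0 * star (x 0)) +
      3 * (y 0 * star (y 0)) + 3 * (x 1 * star (y 1) + y 1 * star (x 1)) -
      3 * (⟨2, 1⟩ * (x 2 * star (y 2)) + ⟨2, -1⟩ * (y 2 * star (x 2)))).re = 0) :
    x = 0 ∧ y = 0 := by
  let P : (Fin 3 → Zsqrtd 2) × (Fin 3 → Zsqrtd 2) → Prop := fun v =>
    (-3 * t * v.1 0 ^ 2 + 2 * v.1 0 * v.2 0 - 9 * t * v.2 0 ^ 2 + (v.1 1 ^ 2 + 3 * v.2 1 ^ 2) -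
      (⟨2, 1⟩ * v.1 2 ^ 2 + 3 * ⟨2, -1⟩ * v.2 2 ^ 2)) = 0 ∧
    (-9 * t * (v.1 0 * star (v.2 0)) + v.1 0 * star (v.1 0) - 9 * t * (v.2 0 * star (v.1 0)) +
      3 * (v.2 0 * star (v.2 0)) + 3 * (v.1 1 * star (v.2 1) + v.2 1 * star (v.1 1)) -
      3 * (⟨2, 1⟩ * (v.1 2 * star (v.2 2)) + ⟨2, -1⟩ * (v.2 2 * star (v.1 2)))).re = 0
  have hd : ∀ v, P v → ∃ v', P v' ∧ ∀ i, v.1 i = 3 * v'.1 i ∧ v.2 i = 3 * v'.2 i := by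
    rintro ⟨x, y⟩ ⟨hv1, hv2⟩
    simp only at hv1 hv2
    have hre := congrArg Zsqrtd.re hv1
    have him := congrArg Zsqrtd.im hv1
    obtain ⟨p0, hp0⟩ : ∃ z, z = (x 0).re := ⟨_, rfl⟩
    obtain ⟨q0, hq0⟩ : ∃ z, z = (x 0).im := ⟨_, rfl⟩
    obtain ⟨r0, hr0⟩ : ∃ z, z = (y 0).re := ⟨_, rfl⟩
    obtain ⟨s0, hs0⟩ : ∃ z, z = (y 0).im := ⟨_, rfl⟩
    obtain ⟨p1, hp1⟩ : ∃ z, z = (x 1).re := ⟨_, rfl⟩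
    obtain ⟨q1, hq1⟩ : ∃ z, z = (x 1).im := ⟨_, rfl⟩
    obtain ⟨r1, hr1⟩ : ∃ z, z = (y 1).re := ⟨_, rfl⟩
    obtain ⟨s1, hs1⟩ : ∃ z, z = (y 1).im := ⟨_, rfl⟩
    obtain ⟨p2, hp2⟩ : ∃ z, z = (x 2).re := ⟨_, rfl⟩
    obtain ⟨q2, hq2⟩ : ∃ z, z = (x 2).im := ⟨_, rfl⟩
    obtain ⟨r2, hr2⟩ : ∃ z, z = (y 2).re := ⟨_, rfl⟩
    obtain ⟨s2, hs2⟩ : ∃ z, z = (y 2).im := ⟨_, rfl⟩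
    have hR : -3 * t * (p0 ^ 2 + 2 * q0 ^ 2) + 2 * (p0 * r0 + 2 * q0 * s0) -
        9 * t * (r0 ^ 2 + 2 * s0 ^ 2) + (p1 ^ 2 + 2 * q1 ^ 2) + 3 * (r1 ^ 2 + 2 * s1 ^ 2) -
        (2 * p2 ^ 2 + 4 * q2 ^ 2 + 4 * p2 * q2) -
        3 * (2 * r2 ^ 2 + 4 * s2 ^ 2 - 4 * r2 * s2) = 0 := by
      simp [pow_two, ← hp0, ← hq0, ← hr0, ← hs0, ← hp1, ← hq1, ← hr1, ← hs1, ← hp2, ← hq2, ← hr2,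
        ← hs2] at hre
      linarith
    have hI : -3 * t * (2 * p0 * q0) + 2 * (p0 * s0 + q0 * r0) - 9 * t * (2 * r0 * s0) +
        2 * p1 * q1 + 3 * (2 * r1 * s1) - (p2 ^ 2 + 2 * q2 ^ 2 + 4 * p2 * q2) -
        3 * (4 * r2 * s2 - r2 ^ 2 - 2 * s2 ^ 2) = 0 := by
      simp [pow_two, ← hp0, ← hq0, ← hr0, ← hs0, ← hp1, ← hq1, ← hr1, ← hs1, ← hp2, ← hq2, ← hr2,
        ← hs2] at him
      linarith
    have hS : -18 * t * (p0 * r0 - 2 * q0 * s0) + (p0 ^ 2 - 2 * q0 ^ 2) +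
        3 * (r0 ^ 2 - 2 * s0 ^ 2) + 6 * (p1 * r1 - 2 * q1 * s1) -
        12 * (p2 * r2 - 2 * q2 * s2 + q2 * r2 - p2 * s2) = 0 := by
      simp [pow_two, ← hp0, ← hq0, ← hr0, ← hs0, ← hp1, ← hq1, ← hr1, ← hs1, ← hp2, ← hq2, ← hr2,
        ← hs2] at hv2
      linarith
    obtain ⟨⟨p0', rfl⟩, ⟨q0', rfl⟩⟩ := three_dvd_of_sq_add_sq (p := p0) (q := q0)
      ⟨-(-6 * t * (p0 * r0 - 2 * q0 * s0) - q0 ^ 2 + (r0 ^ 2 - 2 * s0 ^ 2) +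
        2 * (p1 * r1 - 2 * q1 * s1) - 4 * (p2 * r2 - 2 * q2 * s2 + q2 * r2 - p2 * s2)),
        by linarith⟩
    obtain ⟨⟨p1', rfl⟩, ⟨q1', rfl⟩, ⟨p2', rfl⟩, ⟨q2', rfl⟩⟩ := three_dvd_of_ternary
      (p := p1) (q := q1) (r := p2) (s := q2)
      ⟨-(-9 * t * (p0' ^ 2 + 2 * q0' ^ 2) + 2 * (p0' * r0 + 2 * q0' * s0) -
        3 * t * (r0 ^ 2 + 2 * s0 ^ 2) + (r1 ^ 2 + 2 * s1 ^ 2) -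
        (2 * r2 ^ 2 + 4 * s2 ^ 2 - 4 * r2 * s2)), by linarith⟩
      ⟨-(-9 * t * (2 * p0' * q0') + 2 * (p0' * s0 + q0' * r0) - 3 * t * (2 * r0 * s0) +
        (2 * r1 * s1) - (4 * r2 * s2 - r2 ^ 2 - 2 * s2 ^ 2)), by linarith⟩
    obtain ⟨⟨r0', rfl⟩, ⟨s0', rfl⟩⟩ := three_dvd_of_sq_add_sq (p := r0) (q := s0)
      ⟨-(-6 * t * (p0' * r0 - 2 * q0' * s0) + (p0' ^ 2 - 2 * q0' ^ 2) - s0 ^ 2 +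
        2 * (p1' * r1 - 2 * q1' * s1) - 4 * (p2' * r2 - 2 * q2' * s2 + q2' * r2 - p2' * s2)),
        by linarith⟩
    obtain ⟨⟨r1', rfl⟩, hs1d, ⟨r2', rfl⟩, hs2d⟩ := three_dvd_of_ternary
      (p := r1) (q := -s1) (r := r2) (s := -s2)
      ⟨-(-3 * t * (p0' ^ 2 + 2 * q0' ^ 2) + 2 * (p0' * r0' + 2 * q0' * s0') -
        9 * t * (r0' ^ 2 + 2 * s0' ^ 2) + (p1' ^ 2 + 2 * q1' ^ 2) -
        (2 * p2' ^ 2 + 4 * q2' ^ 2 + 4 * p2' * q2')), by linarith⟩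
      ⟨-3 * t * (2 * p0' * q0') + 2 * (p0' * s0' + q0' * r0') - 9 * t * (2 * r0' * s0') +
        2 * p1' * q1' - (p2' ^ 2 + 2 * q2' ^ 2 + 4 * p2' * q2'), by linarith⟩
    obtain ⟨s1', rfl⟩ := (dvd_neg (α := ℤ)).1 hs1d
    obtain ⟨s2', rfl⟩ := (dvd_neg (α := ℤ)).1 hs2d
    have hthree : ∀ (w : Zsqrtd 2) (p q : ℤ), 3 * p = w.re → 3 * q = w.im → w = 3 * ⟨p, q⟩ := by
      intro w p q hp hq
      refine Zsqrtd.ext ?_ ?_ <;> simp [← hp, ← hq]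
    have hx0 := hthree _ _ _ hp0 hq0
    have hx1 := hthree _ _ _ hp1 hq1
    have hx2 := hthree _ _ _ hp2 hq2
    have hy0 := hthree _ _ _ hr0 hs0
    have hy1 := hthree _ _ _ hr1 hs1
    have hy2 := hthree _ _ _ hr2 hs2
    have hst : ∀ w : Zsqrtd 2, star (3 * w) = 3 * star w := fun w => by
      rw [star_mul', star_ofNat]
    refine ⟨(![⟨p0', q0'⟩, ⟨p1', q1'⟩, ⟨p2', q2'⟩], ![⟨r0', s0'⟩, ⟨r1', s1'⟩, ⟨r2', s2'⟩]),
      ⟨?_, ?_⟩, fun i => ?_⟩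
    · have h9 : (9 : Zsqrtd 2) ≠ 0 := by decide
      have := isDomain_zsqrtd_two
      refine (mul_eq_zero.1 (Eq.trans ?_ hv1)).resolve_left h9
      rw [hx0, hx1, hx2, hy0, hy1, hy2]
      simp only [Matrix.cons_val]
      ring
    · have h9 : ∀ w : Zsqrtd 2, (9 * w).re = 0 → w.re = 0 := by
        intro w hw
        simpa using hw
      refine h9 _ (Eq.trans (congrArg Zsqrtd.re ?_) hv2)
      simp only [hx0, hx1, hx2, hy0, hy1, hy2, hst, Matrix.cons_val]
      ring
    · fin_cases i
      · exact ⟨hx0, hy0⟩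
      · exact ⟨hx1, hy1⟩
      · exact ⟨hx2, hy2⟩
  have hP : P (x, y) := ⟨h1, h2⟩
  constructor
  · funext i
    refine Zsqrtd.ext ?_ ?_
    · exact eq_zero_of_descent (f := fun v => (v.1 i).re)
        (fun v hv => (hd v hv).imp fun _ h => ⟨h.1, by simp [(h.2 i).1]⟩) hP
    · exact eq_zero_of_descent (f := fun v => (v.1 i).im)
        (fun v hv => (hd v hv).imp fun _ h => ⟨h.1, by simp [(h.2 i).1]⟩) hP
  · funext i
    refine Zsqrtd.ext ?_ ?_
    · exact eq_zero_of_descent (f := fun v => (v.2 i).re)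
        (fun v hv => (hd v hv).imp fun _ h => ⟨h.1, by simp [(h.2 i).2]⟩) hP
    · exact eq_zero_of_descent (f := fun v => (v.2 i).im)
        (fun v hv => (hd v hv).imp fun _ h => ⟨h.1, by simp [(h.2 i).2]⟩) hP

end quadratic_integers

section block_forms

/-- A binary-block quadratic form over `ℤ[√2]` together with a real diagonalization of each
block. -/
structure BlockForm (β : Type) where
  a : β → Zsqrtd 2
  c : β → ℤ
  T : β → Matrix (Fin 2) (Fin 2) ℝ
  s : β → Fin 2 → ℝ
  form_xx : ∀ b, s b 0 * (T b 0 0 * T b 0 0) + s b 1 * (T b 1 0 * T b 1 0) = sqrtTwoEmb (a b)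
  form_xy : ∀ b, s b 0 * (T b 0 0 * T b 0 1) + s b 1 * (T b 1 0 * T b 1 1) = c b
  form_yy : ∀ b, s b 0 * (T b 0 1 * T b 0 1) + s b 1 * (T b 1 1 * T b 1 1) =
    3 * sqrtTwoEmb (star (a b))
  det_ne : ∀ b, T b 0 0 * T b 1 1 - T b 0 1 * T b 1 0 ≠ 0

variable {β ι : Type} [Fintype β]

/-- The semilinear operator corresponding to right multiplication by the quaternion `j`. -/
def conjVec (v : β → Zsqrtd 2 × Zsqrtd 2) : β → Zsqrtd 2 × Zsqrtd 2 :=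
  fun b => (3 * star (v b).2, star (v b).1)

lemma conjVec_conjVec (v : β → Zsqrtd 2 × Zsqrtd 2) :
    conjVec (conjVec v) = (3 : Zsqrtd 2) • v := by
  funext b
  simp [conjVec, Prod.ext_iff, smul_eq_mul, mul_comm]

lemma conjVec_add (v u : β → Zsqrtd 2 × Zsqrtd 2) : conjVec (v + u) = conjVec v + conjVec u := by
  funext b
  simp [conjVec, Prod.ext_iff, mul_add]

lemma conjVec_smul (r : Zsqrtd 2) (v : β → Zsqrtd 2 × Zsqrtd 2) :
    conjVec (r • v) = star r • conjVec v := by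
  funext b
  simp only [conjVec, Prod.ext_iff, Pi.smul_apply, Prod.smul_fst, Prod.smul_snd, smul_eq_mul,
    star_mul']
  exact ⟨by ring, trivial⟩

namespace BlockForm

/-- The bilinear form over `ℤ[√2]`. -/
def form (F : BlockForm β) (v u : β → Zsqrtd 2 × Zsqrtd 2) : Zsqrtd 2 :=
  ∑ b, (F.a b * ((v b).1 * (u b).1) + F.c b * ((v b).1 * (u b).2 + (v b).2 * (u b).1) +
    3 * star (F.a b) * ((v b).2 * (u b).2))

lemma form_comm (F : BlockForm β) (v u : β → Zsqrtd 2 × Zsqrtd 2) : F.form v u = F.form u v :=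
  Finset.sum_congr rfl fun b _ => by ring

lemma form_add_right (F : BlockForm β) (v u u' : β → Zsqrtd 2 × Zsqrtd 2) :
    F.form v (u + u') = F.form v u + F.form v u' := by
  simp only [form, ← Finset.sum_add_distrib]
  exact Finset.sum_congr rfl fun b _ => by simp only [Pi.add_apply, Prod.fst_add, Prod.snd_add]; ring

lemma form_smul_right (F : BlockForm β) (r : Zsqrtd 2) (v u : β → Zsqrtd 2 × Zsqrtd 2) :
    F.form v (r • u) = r * F.form v u := by
  simp only [form, Finset.mul_sum]
  exact Finset.sum_congr rfl fun b _ => by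
    simp only [Pi.smul_apply, Prod.smul_fst, Prod.smul_snd, smul_eq_mul]; ring

lemma form_add_left (F : BlockForm β) (v v' u : β → Zsqrtd 2 × Zsqrtd 2) :
    F.form (v + v') u = F.form v u + F.form v' u := by
  rw [form_comm, form_add_right, form_comm F u, form_comm F u]

lemma form_smul_left (F : BlockForm β) (r : Zsqrtd 2) (v u : β → Zsqrtd 2 × Zsqrtd 2) :
    F.form (r • v) u = r * F.form v u := by
  rw [form_comm, form_smul_right, form_comm]

lemma form_conjVec_left (F : BlockForm β) (v u : β → Zsqrtd 2 × Zsqrtd 2) :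
    F.form (conjVec v) u = star (F.form v (conjVec u)) := by
  simp only [form, star_sum, conjVec]
  refine Finset.sum_congr rfl fun b _ => ?_
  simp only [star_add, star_mul', star_star, star_intCast, star_ofNat]
  ring

lemma form_conjVec_conjVec (F : BlockForm β) (v u : β → Zsqrtd 2 × Zsqrtd 2) :
    F.form (conjVec v) (conjVec u) = 3 * star (F.form v u) := by
  rw [form_conjVec_left, conjVec_conjVec, form_smul_right, star_mul', star_ofNat]

/-- The real coordinate of a vector with respect to the diagonalizing basis. -/
noncomputable def coord (F : BlockForm β) (p : β × Fin 2) (v : β → Zsqrtd 2 × Zsqrtd 2) : ℝ :=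
  F.T p.1 p.2 0 * sqrtTwoEmb (v p.1).1 + F.T p.1 p.2 1 * sqrtTwoEmb (v p.1).2

lemma sum_coord_mul_coord (F : BlockForm β) (v u : β → Zsqrtd 2 × Zsqrtd 2) :
    ∑ p : β × Fin 2, F.coord p v * F.s p.1 p.2 * F.coord p u = sqrtTwoEmb (F.form v u) := by
  rw [form, map_sum, Fintype.sum_prod_type]
  refine Finset.sum_congr rfl fun b _ => ?_
  simp only [Fin.sum_univ_two, coord, map_add, map_mul, map_intCast, map_ofNat, ← F.form_xx,
    ← F.form_xy, ← F.form_yy]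
  ring

lemma eq_zero_of_coord (F : BlockForm β) {b : β} {v : β → Zsqrtd 2 × Zsqrtd 2}
    (h : ∀ k, F.coord (b, k) v = 0) : v b = 0 := by
  have h0 := h 0
  have h1 := h 1
  simp only [coord] at h0 h1
  have hd := F.det_ne b
  refine Prod.ext ?_ ?_
  · refine sqrtTwoEmb_eq_zero.1 (mul_left_cancel₀ hd ?_)
    linear_combination (F.T b 1 1) * h0 - (F.T b 0 1) * h1
  · refine sqrtTwoEmb_eq_zero.1 (mul_left_cancel₀ hd ?_)
    linear_combination (F.T b 0 0) * h1 - (F.T b 1 0) * h0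

/-- The real two-column matrix attached to a vector over `ℤ[√2]`. -/
noncomputable def realize (F : BlockForm β) (φ : ι ≃ β × Fin 2) (v : β → Zsqrtd 2 × Zsqrtd 2) :
    Matrix ι (Fin 2) ℝ :=
  Matrix.of fun i j => F.coord (φ i) (if j = 0 then v else conjVec v)

/-- The matrix of signs. -/
def signs (F : BlockForm β) (φ : ι ≃ β × Fin 2) : ι → ℝ := fun i => F.s (φ i).1 (φ i).2

lemma realize_form [Fintype ι] [DecidableEq ι] (F : BlockForm β) (φ : ι ≃ β × Fin 2)
    (v u : β → Zsqrtd 2 × Zsqrtd 2) :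
    (F.realize φ v)ᵀ * diagonal (F.signs φ) * F.realize φ u =
      !![sqrtTwoEmb (F.form v u), sqrtTwoEmb (F.form v (conjVec u));
        sqrtTwoEmb (star (F.form v (conjVec u))), 3 * sqrtTwoEmb (star (F.form v u))] := by
  have key : ∀ v u : β → Zsqrtd 2 × Zsqrtd 2,
      ∑ i, F.coord (φ i) v * F.signs φ i * F.coord (φ i) u = sqrtTwoEmb (F.form v u) := by
    intro v u
    rw [← sum_coord_mul_coord]
    exact φ.sum_comp fun p => F.coord p v * F.s p.1 p.2 * F.coord p u
  have h3 : (3 : ℝ) * sqrtTwoEmb (star (F.form v u)) =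
      sqrtTwoEmb (F.form (conjVec v) (conjVec u)) := by
    rw [form_conjVec_conjVec, map_mul, map_ofNat]
  rw [h3, ← form_conjVec_left]
  ext i j
  rw [Matrix.mul_apply]
  simp only [Matrix.mul_diagonal, Matrix.transpose_apply, realize, Matrix.of_apply]
  rw [key]
  fin_cases i <;> fin_cases j <;> simp

lemma realize_add (F : BlockForm β) (φ : ι ≃ β × Fin 2) (v u : β → Zsqrtd 2 × Zsqrtd 2) :
    F.realize φ (v + u) = F.realize φ v + F.realize φ u := by
  ext i j
  simp only [realize, Matrix.of_apply, Matrix.add_apply, coord, conjVec_add]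
  split_ifs <;> simp <;> ring

lemma realize_smul (F : BlockForm β) [Fintype ι] (φ : ι ≃ β × Fin 2) (r t : Zsqrtd 2)
    (v : β → Zsqrtd 2 × Zsqrtd 2) :
    F.realize φ (r • v + t • conjVec v) = F.realize φ v *
      !![sqrtTwoEmb r, 3 * sqrtTwoEmb (star t); sqrtTwoEmb t, sqrtTwoEmb (star r)] := by
  ext i j
  rw [Matrix.mul_apply, Fin.sum_univ_two]
  simp only [realize, Matrix.of_apply, coord, conjVec_add, conjVec_smul, conjVec_conjVec]
  have h3 : sqrtTwoEmb 3 = 3 := map_ofNat _ 3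
  fin_cases j <;> simp [h3] <;> ring

/-- The real linear map extending `realize`. -/
noncomputable def realizeLin (F : BlockForm β) (φ : ι ≃ β × Fin 2) :
    ((β × Fin 2) × Fin 2 → ℝ) →ₗ[ℝ] Matrix ι (Fin 2) ℝ where
  toFun w := Matrix.of fun i j =>
    F.T (φ i).1 (φ i).2 0 * (if j = 0 then w (((φ i).1, 0), 0) + w (((φ i).1, 0), 1) * √2
      else 3 * (w (((φ i).1, 1), 0) - w (((φ i).1, 1), 1) * √2)) +
    F.T (φ i).1 (φ i).2 1 * (if j = 0 then w (((φ i).1, 1), 0) + w (((φ i).1, 1), 1) * √2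
      else w (((φ i).1, 0), 0) - w (((φ i).1, 0), 1) * √2)
  map_add' w w' := by
    ext i j
    simp only [Matrix.of_apply, Matrix.add_apply, Pi.add_apply]
    split_ifs <;> ring
  map_smul' r w := by
    ext i j
    simp only [Matrix.of_apply, Matrix.smul_apply, Pi.smul_apply, smul_eq_mul, RingHom.id_apply]
    split_ifs <;> ring

lemma realizeLin_injective (F : BlockForm β) (φ : ι ≃ β × Fin 2) :
    Function.Injective (F.realizeLin φ) := by
  rw [injective_iff_map_eq_zero]
  intro w hw
  have hz : ∀ b : β, ∀ X Y : ℝ, (∀ k, F.T b k 0 * X + F.T b k 1 * Y = 0) → X = 0 ∧ Y = 0 := by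
    intro b X Y h
    have hd := F.det_ne b
    constructor
    · refine mul_left_cancel₀ hd ?_
      linear_combination (F.T b 1 1) * h 0 - (F.T b 0 1) * h 1
    · refine mul_left_cancel₀ hd ?_
      linear_combination (F.T b 0 0) * h 1 - (F.T b 1 0) * h 0
  have hs : √2 ≠ 0 := by positivity
  have key : ∀ b, w ((b, 0), 0) = 0 ∧ w ((b, 0), 1) = 0 ∧ w ((b, 1), 0) = 0 ∧
      w ((b, 1), 1) = 0 := by
    intro b
    have h0 := hz b (w ((b, 0), 0) + w ((b, 0), 1) * √2) (w ((b, 1), 0) + w ((b, 1), 1) * √2)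
      fun k => by
        have := congrFun (congrFun hw (φ.symm (b, k))) 0
        simpa [realizeLin] using this
    have h1 := hz b (3 * (w ((b, 1), 0) - w ((b, 1), 1) * √2)) (w ((b, 0), 0) - w ((b, 0), 1) * √2)
      fun k => by
        have := congrFun (congrFun hw (φ.symm (b, k))) 1
        simpa [realizeLin] using this
    refine ⟨by linarith [h0.1, h1.2], ?_, by linarith [h0.2, h1.1], ?_⟩
    · exact (mul_eq_zero.1 (by linarith [h0.1, h1.2] : w ((b, 0), 1) * √2 = 0)).resolve_right hs
    · exact (mul_eq_zero.1 (by linarith [h0.2, h1.1] : w ((b, 1), 1) * √2 = 0)).resolve_right hs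
  funext ⟨⟨b, k⟩, l⟩
  obtain ⟨h1, h2, h3, h4⟩ := key b
  fin_cases k <;> fin_cases l <;> assumption

/-- The real basis of two-column matrices whose integral span is the image of `realize`. -/
noncomputable def basis [Fintype ι] (F : BlockForm β) (φ : ι ≃ β × Fin 2) :
    Module.Basis ((β × Fin 2) × Fin 2) ℝ (Matrix ι (Fin 2) ℝ) :=
  Module.Basis.ofEquivFun (LinearMap.linearEquivOfInjective (F.realizeLin φ)
    (F.realizeLin_injective φ) (by
      rw [Module.finrank_fintype_fun_eq_card, Module.finrank_matrix, Module.finrank_self,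
        Fintype.card_prod, Fintype.card_congr φ]
      simp)).symm

lemma mem_colLattice_basis [Fintype ι] (F : BlockForm β) (φ : ι ≃ β × Fin 2)
    {x : Matrix ι (Fin 2) ℝ} : x ∈ colLattice (F.basis φ) ↔ ∃ v, x = F.realize φ v := by
  rw [colLattice, Module.Basis.mem_span_iff_repr_mem]
  set e := LinearMap.linearEquivOfInjective (F.realizeLin φ) (F.realizeLin_injective φ) (by
      rw [Module.finrank_fintype_fun_eq_card, Module.finrank_matrix, Module.finrank_self,
        Fintype.card_prod, Fintype.card_congr φ]
      simp) with he
  have hrepr : ∀ i, (F.basis φ).repr x i = e.symm x i := fun i => rfl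
  have hreal : ∀ v : β → Zsqrtd 2 × Zsqrtd 2, F.realize φ v = e fun p =>
      if p.1.2 = 0 then (if p.2 = 0 then ((v p.1.1).1.re : ℝ) else (v p.1.1).1.im)
      else (if p.2 = 0 then ((v p.1.1).2.re : ℝ) else (v p.1.1).2.im) := by
    intro v
    rw [he, LinearMap.linearEquivOfInjective_apply]
    ext i j
    simp only [realize, coord, realizeLin, LinearMap.coe_mk, AddHom.coe_mk, Matrix.of_apply]
    by_cases hj : j = 0
    · simp [hj, sqrtTwoEmb_apply]
    · have h3 : sqrtTwoEmb 3 = 3 := map_ofNat _ 3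
      simp [hj, conjVec, sqrtTwoEmb_star, h3]
  constructor
  · intro h
    choose z hz using h
    refine ⟨fun b => (⟨z ((b, 0), 0), z ((b, 0), 1)⟩, ⟨z ((b, 1), 0), z ((b, 1), 1)⟩), ?_⟩
    rw [hreal, ← e.symm_apply_eq]
    funext ⟨⟨b, k⟩, l⟩
    rw [← hrepr, ← hz]
    fin_cases k <;> fin_cases l <;> simp
  · rintro ⟨v, rfl⟩ i
    rw [hrepr, hreal, LinearEquiv.symm_apply_apply]
    split_ifs <;> exact ⟨_, rfl⟩

lemma realize_eq_zero (F : BlockForm β) (φ : ι ≃ β × Fin 2) {v : β → Zsqrtd 2 × Zsqrtd 2} :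
    F.realize φ v = 0 ↔ v = 0 := by
  constructor
  · intro h
    funext b
    refine F.eq_zero_of_coord fun k => ?_
    simpa [realize] using congrFun (congrFun h (φ.symm (b, k))) 0
  · rintro rfl
    ext i j
    have : conjVec (0 : β → Zsqrtd 2 × Zsqrtd 2) = 0 := by
      funext b
      simp [conjVec]
    simp [realize, coord, this]

lemma hasDiscreteForm [Fintype ι] [DecidableEq ι] (F : BlockForm β) (φ : ι ≃ β × Fin 2) :
    HasDiscreteForm (diagonal (F.signs φ)) (F.basis φ) := by
  constructor
  · intro R
    have h1 := finite_bounded_zsqrtd R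
    refine ((h1.prod h1).image fun p => (!![sqrtTwoEmb p.1, sqrtTwoEmb p.2;
        sqrtTwoEmb (star p.2), 3 * sqrtTwoEmb (star p.1)] : Matrix (Fin 2) (Fin 2) ℝ)).subset ?_
    rintro _ ⟨⟨x, hx, y, hy, rfl⟩, hR⟩
    obtain ⟨v, rfl⟩ := (F.mem_colLattice_basis φ).1 hx
    obtain ⟨u, rfl⟩ := (F.mem_colLattice_basis φ).1 hy
    rw [Set.mem_ofPred_eq, realize_form] at hR
    rw [realize_form]
    have hb := fun i j => (abs_le_entryNorm _ i j).trans hR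
    have h00 := hb 0 0
    have h01 := hb 0 1
    have h10 := hb 1 0
    have h11 := hb 1 1
    simp at h00 h01 h10 h11
    exact ⟨(F.form v u, F.form v (conjVec u)), ⟨⟨h00, by
      linarith [abs_nonneg (sqrtTwoEmb (star (F.form v u)))]⟩, h01, h10⟩, rfl⟩
  · intro x hx y hy hdet
    obtain ⟨v, rfl⟩ := (F.mem_colLattice_basis φ).1 hx
    obtain ⟨u, rfl⟩ := (F.mem_colLattice_basis φ).1 hy
    rw [realize_form] at hdet ⊢
    rw [Matrix.det_fin_two_of] at hdet
    have h1 : sqrtTwoEmb (F.form v u) * (3 * sqrtTwoEmb (star (F.form v u))) -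
        sqrtTwoEmb (F.form v (conjVec u)) * sqrtTwoEmb (star (F.form v (conjVec u))) =
        ((3 * (F.form v u).norm - (F.form v (conjVec u)).norm : ℤ) : ℝ) := by
      push_cast
      rw [← sqrtTwoEmb_mul_star, ← sqrtTwoEmb_mul_star]
      ring
    rw [h1] at hdet
    have h2 : |3 * (F.form v u).norm - (F.form v (conjVec u)).norm| < 1 := by exact_mod_cast hdet
    have h3 := eq_zero_of_three_mul_norm (x := F.form v u) (y := F.form v (conjVec u))
      (by rw [Int.abs_lt_one_iff] at h2; linarith)
    rw [h3.1, h3.2]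
    ext i j
    fin_cases i <;> fin_cases j <;> simp

end BlockForm

end block_forms

section rank_one_cusps

variable {β ι : Type} [Fintype β]

lemma colBivector_mul_right [Fintype ι] (x : Matrix ι (Fin 2) ℝ) (A : Matrix (Fin 2) (Fin 2) ℝ) :
    colBivector (x * A) = A.det • colBivector x := by
  have h : A * symplMat * Aᵀ = A.det • symplMat := by
    ext i j
    rw [Matrix.det_fin_two]
    fin_cases i <;> fin_cases j <;>
      simp [symplMat, Matrix.mul_apply, Fin.sum_univ_two] <;> ring
  calc colBivector (x * A) = x * (A * symplMat * Aᵀ) * xᵀ := by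
        simp only [colBivector, Matrix.transpose_mul, Matrix.mul_assoc]
    _ = _ := by rw [h, Matrix.mul_smul, Matrix.smul_mul, colBivector]

lemma det_quaternion_ne_zero {r t : Zsqrtd 2} (h : ¬ (r = 0 ∧ t = 0)) :
    (!![sqrtTwoEmb r, 3 * sqrtTwoEmb (star t); sqrtTwoEmb t, sqrtTwoEmb (star r)]).det ≠ 0 := by
  rw [Matrix.det_fin_two_of]
  intro h0
  have h1 : ((r.norm - 3 * t.norm : ℤ) : ℝ) = 0 := by
    push_cast
    rw [← sqrtTwoEmb_mul_star, ← sqrtTwoEmb_mul_star]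
    linarith
  have h2 : r.norm - 3 * t.norm = 0 := by exact_mod_cast h1
  have h3 := eq_zero_of_three_mul_norm (x := t) (y := r) (by linarith)
  exact h ⟨h3.2, h3.1⟩

namespace BlockForm

lemma block_sum_eq (F : BlockForm β) (b : β) (v : β → Zsqrtd 2 × Zsqrtd 2) :
    F.s b 0 * F.coord (b, 0) v ^ 2 + F.s b 1 * F.coord (b, 1) v ^ 2 =
      sqrtTwoEmb (F.a b) * sqrtTwoEmb (v b).1 ^ 2 +
      2 * F.c b * (sqrtTwoEmb (v b).1 * sqrtTwoEmb (v b).2) +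
      3 * sqrtTwoEmb (star (F.a b)) * sqrtTwoEmb (v b).2 ^ 2 := by
  rw [← F.form_xx, ← F.form_xy, ← F.form_yy]
  simp only [coord]
  ring

lemma form_self_eq (F : BlockForm β) (v : β → Zsqrtd 2 × Zsqrtd 2) :
    sqrtTwoEmb (F.form v v) =
      ∑ b, (F.s b 0 * F.coord (b, 0) v ^ 2 + F.s b 1 * F.coord (b, 1) v ^ 2) := by
  rw [← sum_coord_mul_coord, Fintype.sum_prod_type]
  refine Finset.sum_congr rfl fun b _ => ?_
  simp only [Fin.sum_univ_two]
  ring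

lemma eq_zero_of_form_self (F : BlockForm β) {b₀ b₁ : β}
    (hneg : ∀ b, b ≠ b₀ → b ≠ b₁ → ∀ k, F.s b k = -1)
    (h₀ : sqrtTwoEmb (F.a b₀) - 2 * F.c b₀ + 3 * sqrtTwoEmb (star (F.a b₀)) < 0)
    {z : β → Zsqrtd 2 × Zsqrtd 2} (hz₁ : z b₁ = 0) (hz₀ : (z b₀).1 + (z b₀).2 = 0)
    (hz : F.form z z = 0) : z = 0 := by
  have hY : sqrtTwoEmb (z b₀).2 = -sqrtTwoEmb (z b₀).1 := by
    rw [← map_neg]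
    congr 1
    exact (neg_eq_of_add_eq_zero_right hz₀).symm
  have hb₀ : F.s b₀ 0 * F.coord (b₀, 0) z ^ 2 + F.s b₀ 1 * F.coord (b₀, 1) z ^ 2 =
      (sqrtTwoEmb (F.a b₀) - 2 * F.c b₀ + 3 * sqrtTwoEmb (star (F.a b₀))) *
        sqrtTwoEmb (z b₀).1 ^ 2 := by
    rw [block_sum_eq, hY]
    ring
  have hb₁ : F.s b₁ 0 * F.coord (b₁, 0) z ^ 2 + F.s b₁ 1 * F.coord (b₁, 1) z ^ 2 = 0 := by
    rw [block_sum_eq, hz₁]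
    simp
  have hle : ∀ b ∈ Finset.univ,
      F.s b 0 * F.coord (b, 0) z ^ 2 + F.s b 1 * F.coord (b, 1) z ^ 2 ≤ 0 := by
    intro b _
    by_cases h0 : b = b₀
    · rw [h0, hb₀]
      nlinarith [sq_nonneg (sqrtTwoEmb (z b₀).1)]
    by_cases h1 : b = b₁
    · rw [h1, hb₁]
    · rw [hneg b h0 h1, hneg b h0 h1]
      nlinarith [sq_nonneg (F.coord (b, 0) z), sq_nonneg (F.coord (b, 1) z)]
  have hsum := F.form_self_eq z
  rw [hz, map_zero] at hsum
  have hall := (Finset.sum_eq_zero_iff_of_nonpos hle).1 hsum.symm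
  funext b
  have hb := hall b (Finset.mem_univ b)
  by_cases h0 : b = b₀
  · subst h0
    rw [hb₀] at hb
    have h1 : sqrtTwoEmb (z b).1 = 0 :=
      pow_eq_zero_iff (two_ne_zero) |>.1 ((mul_eq_zero.1 hb).resolve_left h₀.ne)
    rw [h1, neg_zero] at hY
    exact Prod.ext (sqrtTwoEmb_eq_zero.1 h1) (sqrtTwoEmb_eq_zero.1 hY)
  by_cases h1 : b = b₁
  · rw [h1, hz₁]; rfl
  · rw [hneg b h0 h1, hneg b h0 h1] at hb
    refine F.eq_zero_of_coord fun k => ?_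
    have hk0 : F.coord (b, 0) z = 0 := by
      refine pow_eq_zero_iff (two_ne_zero) |>.1 ?_
      nlinarith [sq_nonneg (F.coord (b, 0) z), sq_nonneg (F.coord (b, 1) z)]
    have hk1 : F.coord (b, 1) z = 0 := by
      refine pow_eq_zero_iff (two_ne_zero) |>.1 ?_
      nlinarith [sq_nonneg (F.coord (b, 0) z), sq_nonneg (F.coord (b, 1) z)]
    fin_cases k
    · exact hk0
    · exact hk1

lemma form_eq_zero_of_realize [Fintype ι] [DecidableEq ι] (F : BlockForm β) (φ : ι ≃ β × Fin 2)
    {v u : β → Zsqrtd 2 × Zsqrtd 2}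
    (h : (F.realize φ v)ᵀ * diagonal (F.signs φ) * F.realize φ u = 0) :
    F.form v u = 0 ∧ F.form v (conjVec u) = 0 := by
  rw [realize_form] at h
  have h0 := congrFun (congrFun h 0) 0
  have h1 := congrFun (congrFun h 0) 1
  simp at h0 h1
  exact ⟨sqrtTwoEmb_eq_zero.1 h0, sqrtTwoEmb_eq_zero.1 h1⟩

lemma hasRankOneCusps [Fintype ι] [DecidableEq ι] (F : BlockForm β) (φ : ι ≃ β × Fin 2)
    {b₀ b₁ : β} (hneg : ∀ b, b ≠ b₀ → b ≠ b₁ → ∀ k, F.s b k = -1)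
    (h₀ : sqrtTwoEmb (F.a b₀) - 2 * F.c b₀ + 3 * sqrtTwoEmb (star (F.a b₀)) < 0) :
    HasRankOneCusps (diagonal (F.signs φ)) (F.basis φ) := by
  rintro x ⟨hx, hx0, hxx⟩ y ⟨hy, hy0, hyy⟩ hxy
  obtain ⟨v, rfl⟩ := (F.mem_colLattice_basis φ).1 hx
  obtain ⟨u, rfl⟩ := (F.mem_colLattice_basis φ).1 hy
  obtain ⟨h1, h2⟩ := F.form_eq_zero_of_realize φ hxx
  obtain ⟨h3, h4⟩ := F.form_eq_zero_of_realize φ hyy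
  obtain ⟨h5, h6⟩ := F.form_eq_zero_of_realize φ hxy
  have := isDomain_zsqrtd_two
  let w : Fin 4 → β → Zsqrtd 2 × Zsqrtd 2 := ![v, conjVec v, u, conjVec u]
  let M : Matrix (Fin 4) (Fin 4) (Zsqrtd 2) := Matrix.of fun i j =>
    ![(w j b₁).1, (w j b₁).2, (w j b₀).1 + (w j b₀).2, 0] i
  have hM : M.det = 0 := Matrix.det_eq_zero_of_row_eq_zero 3 fun j => rfl
  obtain ⟨r, hr0, hr⟩ := Matrix.exists_mulVec_eq_zero_iff.2 hM
  set z := (r 0 • v + r 1 • conjVec v) + (r 2 • u + r 3 • conjVec u) with hz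
  have hz0 : z = 0 := by
    refine F.eq_zero_of_form_self hneg h₀ (b₁ := b₁) (Prod.ext ?_ ?_) ?_ ?_
    · have := congrFun hr 0
      simp [M, w, Matrix.mulVec, dotProduct, Fin.sum_univ_four] at this
      simp [hz]
      linear_combination this
    · have := congrFun hr 1
      simp [M, w, Matrix.mulVec, dotProduct, Fin.sum_univ_four] at this
      simp [hz]
      linear_combination this
    · have := congrFun hr 2
      simp [M, w, Matrix.mulVec, dotProduct, Fin.sum_univ_four] at this
      simp [hz]
      linear_combination this
    · have h7 : F.form u v = 0 := by rw [form_comm, h5]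
      have h8 : F.form u (conjVec v) = 0 := by rw [form_comm, form_conjVec_left, h6, star_zero]
      simp [hz, form_add_left, form_add_right, form_smul_left, form_smul_right, form_conjVec_left,
        conjVec_conjVec, h1, h2, h3, h4, h5, h6, h7, h8]
  have hreal := (F.realize_eq_zero φ).2 hz0
  rw [hz, realize_add, realize_smul, realize_smul] at hreal
  by_cases h23 : r 2 = 0 ∧ r 3 = 0
  · exfalso
    have h01 : ¬ (r 0 = 0 ∧ r 1 = 0) := by
      rintro ⟨h, h'⟩
      refine hr0 (funext fun i => ?_)
      fin_cases i
      · exact h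
      · exact h'
      · exact h23.1
      · exact h23.2
    have hA := det_quaternion_ne_zero h01
    refine hx0 ?_
    have hB : (!![sqrtTwoEmb (r 2), 3 * sqrtTwoEmb (star (r 3)); sqrtTwoEmb (r 3),
        sqrtTwoEmb (star (r 2))] : Matrix (Fin 2) (Fin 2) ℝ) = 0 := by
      rw [h23.1, h23.2]
      ext i j
      fin_cases i <;> fin_cases j <;> simp
    rw [hB, Matrix.mul_zero, add_zero] at hreal
    rw [← Matrix.mul_one (F.realize φ v), ← Matrix.mul_nonsing_inv _ (IsUnit.mk0 _ hA),
      ← Matrix.mul_assoc, hreal, Matrix.zero_mul]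
  · have hB := det_quaternion_ne_zero h23
    set A : Matrix (Fin 2) (Fin 2) ℝ := !![sqrtTwoEmb (r 0), 3 * sqrtTwoEmb (star (r 1));
      sqrtTwoEmb (r 1), sqrtTwoEmb (star (r 0))]
    set B : Matrix (Fin 2) (Fin 2) ℝ := !![sqrtTwoEmb (r 2), 3 * sqrtTwoEmb (star (r 3));
      sqrtTwoEmb (r 3), sqrtTwoEmb (star (r 2))]
    have hu : F.realize φ u = F.realize φ v * (-(A * B⁻¹)) := by
      have h7 : F.realize φ u * B = F.realize φ v * (-A) := by
        rw [Matrix.mul_neg]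
        exact eq_neg_of_add_eq_zero_right hreal
      calc F.realize φ u = F.realize φ u * B * B⁻¹ := by
            rw [Matrix.mul_assoc, Matrix.mul_nonsing_inv _ (IsUnit.mk0 _ hB), Matrix.mul_one]
        _ = _ := by rw [h7, Matrix.mul_assoc, Matrix.neg_mul]
    exact ⟨_, by rw [hu, colBivector_mul_right]⟩

/-- A form on three blocks with the given first block. -/
noncomputable def ternary (t : ℤ) (T₀ : Matrix (Fin 2) (Fin 2) ℝ) (s₀ : Fin 2 → ℝ)
    (hxx : s₀ 0 * (T₀ 0 0 * T₀ 0 0) + s₀ 1 * (T₀ 1 0 * T₀ 1 0) = -3 * t)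
    (hxy : s₀ 0 * (T₀ 0 0 * T₀ 0 1) + s₀ 1 * (T₀ 1 0 * T₀ 1 1) = 1)
    (hyy : s₀ 0 * (T₀ 0 1 * T₀ 0 1) + s₀ 1 * (T₀ 1 1 * T₀ 1 1) = -9 * t)
    (hdet : T₀ 0 0 * T₀ 1 1 - T₀ 0 1 * T₀ 1 0 ≠ 0) : BlockForm (Fin 3) where
  a := ![-3 * t, 1, -⟨2, 1⟩]
  c := ![1, 0, 0]
  T := ![T₀, !![1, 0; 0, √3], !![√(2 + √2), 0; 0, √(3 * (2 - √2))]]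
  s := ![s₀, 1, -1]
  form_xx := by
    have h3 : sqrtTwoEmb 3 = 3 := map_ofNat _ 3
    intro b
    fin_cases b
    · simpa [h3] using hxx
    · simp
    · have : √(2 + √2) * √(2 + √2) = 2 + √2 := Real.mul_self_sqrt (by positivity)
      simp [sqrtTwoEmb_apply, this]
      ring
  form_xy := by
    intro b
    fin_cases b
    · simpa using hxy
    · simp
    · simp
  form_yy := by
    have h3 : sqrtTwoEmb 3 = 3 := map_ofNat _ 3
    intro b
    fin_cases b
    · simp [h3]
      linarith
    · simp
    · have h2 : √2 ≤ 2 := by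
        rw [Real.sqrt_le_left (by norm_num)]; norm_num
      have h4 : √(3 * (2 - √2)) * √(3 * (2 - √2)) = 3 * (2 - √2) :=
        Real.mul_self_sqrt (by linarith)
      have h5 : sqrtTwoEmb (star (-⟨2, 1⟩ : Zsqrtd 2)) = -(2 - √2) := by
        rw [star_neg, map_neg, sqrtTwoEmb_star]
        norm_num
      show (-1 : ℝ) * (0 * 0) + (-1) * (√(3 * (2 - √2)) * √(3 * (2 - √2))) =
        3 * sqrtTwoEmb (star (-⟨2, 1⟩ : Zsqrtd 2))
      rw [h4, h5]
      ring
  det_ne := by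
    intro b
    fin_cases b
    · simpa using hdet
    · simp
    · have h2 : √2 < 2 := by
        rw [Real.sqrt_lt' (by norm_num)]; norm_num
      have h3 : √(2 + √2) ≠ 0 := by positivity
      have h4 : √(3 * (2 - √2)) ≠ 0 := (Real.sqrt_pos.2 (by linarith)).ne'
      show √(2 + √2) * √(3 * (2 - √2)) - 0 * 0 ≠ 0
      rw [mul_zero, sub_zero]
      exact mul_ne_zero h3 h4

lemma isotropicVectors_eq_empty [Fintype ι] [DecidableEq ι] (F : BlockForm (Fin 3))
    (φ : ι ≃ Fin 3 × Fin 2) {t : ℤ}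
    (ha : F.a = ![-3 * (t : Zsqrtd 2), 1, -⟨2, 1⟩]) (hc : F.c = ![1, 0, 0]) :
    isotropicVectors (diagonal (F.signs φ)) (F.basis φ) = ∅ := by
  rw [Set.eq_empty_iff_forall_notMem]
  rintro x ⟨hx, hx0, hxx⟩
  obtain ⟨v, rfl⟩ := (F.mem_colLattice_basis φ).1 hx
  obtain ⟨h1, h2⟩ := F.form_eq_zero_of_realize φ hxx
  refine hx0 ((F.realize_eq_zero φ).2 ?_)
  have hst : star (-⟨2, 1⟩ : Zsqrtd 2) = -⟨2, -1⟩ := by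
    rw [star_neg]; rfl
  have h3 := eq_zero_of_descent_three (t := t) (x := fun i => (v i).1) (y := fun i => (v i).2)
    (by
      rw [← h1, form, ha, hc, Fin.sum_univ_three]
      simp only [Matrix.cons_val, hst, star_mul', star_neg, star_ofNat, star_intCast, star_one,
        Int.cast_one, Int.cast_zero]
      ring) (by
      rw [← Zsqrtd.re_zero (d := 2), ← h2, form, ha, hc, Fin.sum_univ_three]
      congr 1
      simp only [Matrix.cons_val, hst, star_mul', star_neg, star_ofNat, star_intCast, star_one,
        Int.cast_one, Int.cast_zero, conjVec]
      ring)
  funext b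
  exact Prod.ext (congrFun h3.1 b) (congrFun h3.2 b)

/-- Adding `k` negative definite blocks. -/
noncomputable def extend (F : BlockForm β) (k : ℕ) : BlockForm (β ⊕ Fin k) where
  a := Sum.elim F.a fun _ => -1
  c := Sum.elim F.c fun _ => 0
  T := Sum.elim F.T fun _ => !![1, 0; 0, √3]
  s := Sum.elim F.s fun _ => -1
  form_xx := by
    rintro (b | b)
    · exact F.form_xx b
    · simp
  form_xy := by
    rintro (b | b)
    · exact F.form_xy b
    · simp
  form_yy := by
    rintro (b | b)
    · exact F.form_yy b
    · simp
  det_ne := by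
    rintro (b | b)
    · exact F.det_ne b
    · simp

end BlockForm

end rank_one_cusps

section boosts

variable {ι : Type} [Fintype ι] [DecidableEq ι]

lemma formRefl_mulVec (J : Matrix ι ι ℝ) (s : ℝ) (x v : ι → ℝ) :
    formRefl J s x *ᵥ v = v - (s * (J *ᵥ x ⬝ᵥ v)) • x := by
  rw [formRefl, Matrix.sub_mulVec, Matrix.one_mulVec, Matrix.smul_mulVec, vecMulVec_mulVec]
  ext i
  simp [mul_comm]
  ring

/-- A hyperbolic rotation contracting an isotropic vector. -/
lemma exists_boost {ε : ι → ℝ} {i j : ι} (hi : ε i = 1) (hj : ε j = -1) {r : ℝ} (hr : 0 < r) :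
    ∃ g : SOQ (diagonal ε), ∀ v : ι → ℝ,
      (v i = v j → g.1.val *ᵥ v = v + ((r - 1) * v i) • (Pi.single i 1 + Pi.single j 1)) := by
  have hij : i ≠ j := by
    rintro rfl
    linarith
  obtain ⟨a, c, hac, hacr⟩ : ∃ a c : ℝ, a ^ 2 - c ^ 2 = 1 ∧ (a + c) ^ 2 = r := by
    have hs : √r ≠ 0 := (Real.sqrt_pos.2 hr).ne'
    have hsq : √r ^ 2 = r := Real.sq_sqrt hr.le
    refine ⟨(√r + 1 / √r) / 2, (√r - 1 / √r) / 2, ?_, ?_⟩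
    · field_simp
      ring
    · rw [← hsq]
      simp only [Real.sqrt_sq (Real.sqrt_nonneg r)]
      ring
  have hJt : (diagonal ε)ᵀ = diagonal ε := diagonal_transpose ε
  set u : ι → ℝ := a • Pi.single i 1 + c • Pi.single j 1 with hu
  have hJi : diagonal ε *ᵥ (Pi.single i 1 : ι → ℝ) = Pi.single i 1 := by
    ext l
    by_cases h : l = i
    · subst h; simp [mulVec_diagonal, hi]
    · simp [mulVec_diagonal, h]
  have hJj : diagonal ε *ᵥ (Pi.single j 1 : ι → ℝ) = -Pi.single j 1 := by
    ext l
    by_cases h : l = j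
    · subst h; simp [mulVec_diagonal, hj]
    · simp [mulVec_diagonal, h]
  have hJu : diagonal ε *ᵥ u = a • Pi.single i 1 - c • Pi.single j 1 := by
    rw [hu, Matrix.mulVec_add, Matrix.mulVec_smul, Matrix.mulVec_smul, hJi, hJj, smul_neg,
      sub_eq_add_neg]
  have hq₁ : (2 : ℝ) * ((Pi.single i 1 : ι → ℝ) ⬝ᵥ diagonal ε *ᵥ (Pi.single i 1 : ι → ℝ)) = 2 := by
    rw [hJi]
    simp
  have hq₂ : (2 : ℝ) * (u ⬝ᵥ diagonal ε *ᵥ u) = 2 := by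
    rw [hJu, hu]
    simp [hij, hij.symm]
    linarith
  refine ⟨SOQ.mk (formRefl (diagonal ε) 2 u * formRefl (diagonal ε) 2 (Pi.single i 1)) ?_ ?_, ?_⟩
  · rw [Matrix.det_mul, det_formRefl, det_formRefl, hq₁, hq₂]
    norm_num
  · have h1 := formRefl_form hJt hq₁
    have h2 := formRefl_form hJt hq₂
    rw [Matrix.transpose_mul]
    calc _ = (formRefl (diagonal ε) 2 (Pi.single i 1))ᵀ * ((formRefl (diagonal ε) 2 u)ᵀ *
          diagonal ε * formRefl (diagonal ε) 2 u) * formRefl (diagonal ε) 2 (Pi.single i 1) := by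
          simp only [Matrix.mul_assoc]
      _ = _ := by rw [h2, h1]
  · intro v hv
    rw [SOQ.mk_val, ← Matrix.mulVec_mulVec, formRefl_mulVec, formRefl_mulVec, hJi, hJu, hu]
    ext l
    simp [hij, hij.symm, sub_dotProduct, hv]
    generalize v j = y
    rw [← hacr]
    have ha : a ^ 2 = 1 + c ^ 2 := by linarith
    by_cases hl : l = i
    · subst hl
      simp [hij]
      ring_nf
      simp only [ha]
      ring
    · by_cases hl' : l = j
      · subst hl'
        simp [hl]
        ring_nf
        simp only [ha]
        ring
      · simp [hl, hl']

lemma not_compactSpace_of_hyperbolic {β : Type} [Fintype β] [DecidableEq β] (F : BlockForm β)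
    (φ : ι ≃ β × Fin 2) {b₁ b₂ : β}
    (ha₁ : F.a b₁ = 1) (ha₂ : F.a b₂ = -1) (hc₁ : F.c b₁ = 0) (hc₂ : F.c b₂ = 0)
    (hT₁ : F.T b₁ = !![1, 0; 0, √3]) (hT₂ : F.T b₂ = !![1, 0; 0, √3])
    (hs₁ : F.s b₁ 0 = 1) (hs₂ : F.s b₂ 0 = -1) (hs : ∀ b k, F.s b k * F.s b k = 1) :
    ¬ CompactSpace (SOQ (diagonal (F.signs φ)) ⧸ latticeStab (diagonal (F.signs φ)) (F.basis φ)) := by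
  have h12 : b₁ ≠ b₂ := by
    rintro rfl
    linarith
  have hJ : diagonal (F.signs φ) * diagonal (F.signs φ) = 1 := by
    rw [diagonal_mul_diagonal, ← diagonal_one]
    congr 1
    funext i
    exact hs _ _
  let v : β → Zsqrtd 2 × Zsqrtd 2 := fun b => if b = b₁ ∨ b = b₂ then (1, 0) else 0
  have hv : ∀ b, b ≠ b₁ → b ≠ b₂ → v b = 0 := fun b h1 h2 => if_neg (by tauto)
  have hv₁ : v b₁ = (1, 0) := if_pos (Or.inl rfl)
  have hv₂ : v b₂ = (1, 0) := if_pos (Or.inr rfl)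
  have hsum : ∀ f : β → Zsqrtd 2, (∀ b, b ≠ b₁ → b ≠ b₂ → f b = 0) → ∑ b, f b = f b₁ + f b₂ := by
    intro f hf
    rw [← Finset.sum_pair h12]
    refine (Finset.sum_subset (Finset.subset_univ _) fun b _ hb => ?_).symm
    simp only [Finset.mem_insert, Finset.mem_singleton, not_or] at hb
    exact hf b hb.1 hb.2
  have hvv : F.form v v = 0 := by
    rw [BlockForm.form, hsum _ fun b h1 h2 => by simp [hv b h1 h2]]
    simp [hv₁, hv₂, ha₁, ha₂]
  have hvc : F.form v (conjVec v) = 0 := by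
    rw [BlockForm.form, hsum _ fun b h1 h2 => by simp [hv b h1 h2]]
    simp [hv₁, hv₂, hc₁, hc₂, conjVec]
  have hx : F.realize φ v ∈ isotropicVectors (diagonal (F.signs φ)) (F.basis φ) := by
    refine ⟨(F.mem_colLattice_basis φ).2 ⟨v, rfl⟩, ?_, ?_⟩
    · rw [Ne, F.realize_eq_zero]
      intro h
      have := congrFun h b₁
      rw [hv₁] at this
      simp at this
    · rw [F.realize_form, hvv, hvc]
      ext i j
      fin_cases i <;> fin_cases j <;> simp
  refine not_compactSpace_of_contracted (F.hasDiscreteForm φ) hJ (diagonal_transpose _) hx ?_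
  intro c hc
  set M := entryNorm (colBivector (F.realize φ v)) with hM
  have hM0 : 0 ≤ M := entryNorm_nonneg _
  have hr : 0 < c / (M + 1) := by positivity
  have hi : F.signs φ (φ.symm (b₁, 0)) = 1 := by simp [BlockForm.signs, hs₁]
  have hj : F.signs φ (φ.symm (b₂, 0)) = -1 := by simp [BlockForm.signs, hs₂]
  obtain ⟨g, hg⟩ := exists_boost hi hj hr
  have hgx : g.1.val * F.realize φ v = F.realize φ v * !![c / (M + 1), 0; 0, 1] := by
    have hcol : ∀ k : Fin 2, F.realize φ v (φ.symm (b₁, 0)) k = (if k = 0 then 1 else 0) ∧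
        F.realize φ v (φ.symm (b₂, 0)) k = (if k = 0 then 1 else 0) := by
      intro k
      fin_cases k <;> simp [BlockForm.realize, BlockForm.coord, conjVec, hv₁, hv₂, hT₁, hT₂]
    ext l k
    have h1 := congrFun (hg (fun i => F.realize φ v i k) (by rw [(hcol k).1, (hcol k).2])) l
    rw [Matrix.mul_apply]
    have h2 : (∑ j, g.1.val l j * F.realize φ v j k) =
      (g.1.val *ᵥ fun i => F.realize φ v i k) l := rfl
    rw [h2, h1, (hcol k).1, Matrix.mul_apply, Fin.sum_univ_two]
    fin_cases k
    · have h0 : F.realize φ v l 0 =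
          (Pi.single (φ.symm (b₁, 0)) 1 + Pi.single (φ.symm (b₂, 0)) 1 : ι → ℝ) l := by
        obtain ⟨⟨b, k⟩, rfl⟩ := φ.symm.surjective l
        rw [Pi.add_apply, Pi.single_apply, Pi.single_apply]
        simp only [EmbeddingLike.apply_eq_iff_eq, Prod.mk.injEq]
        by_cases hb₁ : b = b₁
        · subst hb₁
          fin_cases k <;> simp [BlockForm.realize, BlockForm.coord, hv₁, hT₁, h12]
        by_cases hb₂ : b = b₂
        · subst hb₂
          fin_cases k <;> simp [BlockForm.realize, BlockForm.coord, hv₂, hT₂, h12.symm]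
        simp [BlockForm.realize, BlockForm.coord, hv b hb₁ hb₂, hb₁, hb₂]
      simp [h0]
      ring
    · simp
  refine ⟨g, ?_⟩
  rw [hgx, colBivector_mul_right, entryNorm_smul, ← hM, Matrix.det_fin_two_of, mul_one, mul_zero,
    sub_zero, abs_of_pos hr, div_mul_eq_mul_div, div_lt_iff₀ (by positivity)]
  nlinarith

end boosts

section block_embedding

variable {ι ι₃ ι' : Type} [Fintype ι] [DecidableEq ι] [Fintype ι₃] [DecidableEq ι₃]
  [Fintype ι'] [DecidableEq ι']

/-- The embedding of square matrices as the upper left block. -/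
def blockEmb (θ : ι ≃ ι₃ ⊕ ι') (A : Matrix ι₃ ι₃ ℝ) : Matrix ι ι ℝ :=
  (fromBlocks A 0 0 (1 : Matrix ι' ι' ℝ)).submatrix θ θ

lemma blockEmb_mul (θ : ι ≃ ι₃ ⊕ ι') (A B : Matrix ι₃ ι₃ ℝ) :
    blockEmb θ (A * B) = blockEmb θ A * blockEmb θ B := by
  rw [blockEmb, blockEmb, blockEmb, Matrix.submatrix_mul_equiv, fromBlocks_multiply]
  simp

lemma det_blockEmb (θ : ι ≃ ι₃ ⊕ ι') (A : Matrix ι₃ ι₃ ℝ) : (blockEmb θ A).det = A.det := by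
  rw [blockEmb, Matrix.det_submatrix_equiv_self, det_fromBlocks_zero₂₁, det_one, mul_one]

lemma blockEmb_form (θ : ι ≃ ι₃ ⊕ ι') {ε : ι → ℝ} {ε₃ : ι₃ → ℝ}
    (hε : ∀ i, ε (θ.symm (Sum.inl i)) = ε₃ i) {A : Matrix ι₃ ι₃ ℝ}
    (hA : Aᵀ * diagonal ε₃ * A = diagonal ε₃) :
    (blockEmb θ A)ᵀ * diagonal ε * blockEmb θ A = diagonal ε := by
  have h : diagonal ε = (fromBlocks (diagonal ε₃) 0 0
      (diagonal fun i => ε (θ.symm (Sum.inr i)))).submatrix θ θ := by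
    rw [fromBlocks_diagonal, submatrix_diagonal_equiv]
    congr 1
    funext i
    obtain ⟨i | i, rfl⟩ := θ.symm.surjective i
    · simp [hε]
    · simp
  rw [h, blockEmb, transpose_submatrix, Matrix.submatrix_mul_equiv, Matrix.submatrix_mul_equiv,
    fromBlocks_transpose, fromBlocks_multiply, fromBlocks_multiply]
  simp [hA]

/-- The embedding of orthogonal groups given by an orthogonal decomposition. -/
noncomputable def SOQ.blockHom (θ : ι ≃ ι₃ ⊕ ι') {ε : ι → ℝ} {ε₃ : ι₃ → ℝ}
    (hε : ∀ i, ε (θ.symm (Sum.inl i)) = ε₃ i) : SOQ (diagonal ε₃) →* SOQ (diagonal ε) :=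
  MonoidHom.mk' (fun g => SOQ.mk (blockEmb θ g.1.val)
    (by rw [det_blockEmb, SOQ.det_val]) (blockEmb_form θ hε (SOQ.form_val g))) fun g h =>
      SOQ.ext_val (blockEmb_mul θ g.1.val h.1.val)

lemma SOQ.blockHom_val (θ : ι ≃ ι₃ ⊕ ι') {ε : ι → ℝ} {ε₃ : ι₃ → ℝ}
    (hε : ∀ i, ε (θ.symm (Sum.inl i)) = ε₃ i) (g : SOQ (diagonal ε₃)) :
    (SOQ.blockHom θ hε g).1.val = blockEmb θ g.1.val := rfl

lemma isClosedEmbedding_blockEmb (θ : ι ≃ ι₃ ⊕ ι') :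
    Topology.IsClosedEmbedding (blockEmb θ) := by
  refine Function.LeftInverse.isClosedEmbedding
    (f := fun B : Matrix ι ι ℝ => B.submatrix (θ.symm ∘ Sum.inl) (θ.symm ∘ Sum.inl)) ?_ ?_ ?_
  · intro A
    ext i j
    simp [blockEmb]
  · fun_prop
  · unfold blockEmb
    fun_prop

lemma SOQ.isClosedEmbedding_blockHom (θ : ι ≃ ι₃ ⊕ ι') {ε : ι → ℝ} {ε₃ : ι₃ → ℝ}
    (hε : ∀ i, ε (θ.symm (Sum.inl i)) = ε₃ i) (hJ : diagonal ε * diagonal ε = 1)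
    (hJ₃ : diagonal ε₃ * diagonal ε₃ = 1) :
    Topology.IsClosedEmbedding (SOQ.blockHom θ hε) := by
  rw [← (SOQ.isClosedEmbedding_val hJ).of_comp_iff]
  exact (isClosedEmbedding_blockEmb θ).comp (SOQ.isClosedEmbedding_val hJ₃)

end block_embedding

section abstract_groups

lemma Isogenous.range {H G : Type} [Group H] [TopologicalSpace H] [Group G] [TopologicalSpace G]
    {ψ : H →* G} (hψ : Topology.IsClosedEmbedding ψ) : Isogenous ψ.range H := by
  refine ⟨H, inferInstance, inferInstance, ψ.rangeRestrict, MonoidHom.id H, ?_, ?_,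
    ψ.rangeRestrict_surjective, ?_, continuous_id, IsOpenMap.id, fun x => ⟨x, rfl⟩, ?_⟩
  · exact hψ.continuous.subtype_mk _
  · refine Topology.IsInducing.isOpenMap ?_ ?_
    · exact Topology.IsInducing.of_comp (hψ.continuous.subtype_mk _) continuous_subtype_val
        hψ.isInducing
    · rw [Set.range_eq_univ.2 ψ.rangeRestrict_surjective]
      exact isOpen_univ
  · rw [MonoidHom.ker_rangeRestrict, (MonoidHom.ker_eq_bot_iff ψ).2 hψ.injective]
    exact Set.finite_singleton 1
  · exact (Set.finite_singleton (1 : H)).subset fun x hx => hx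

lemma discreteTopology_subgroupOf {G : Type} [Group G] [TopologicalSpace G] (Λ K : Subgroup G)
    [DiscreteTopology Λ] : DiscreteTopology (Λ.subgroupOf K) := by
  refine DiscreteTopology.of_continuous_injective
    (f := fun x : Λ.subgroupOf K => (⟨x.1.1, x.2⟩ : Λ)) ?_ ?_
  · fun_prop
  · intro x y h
    exact Subtype.ext (Subtype.ext (congrArg (fun z : Λ => z.1) h))

lemma compactSpace_range_quotient {H G : Type} [Group H] [TopologicalSpace H]
    [IsTopologicalGroup H] [Group G] [TopologicalSpace G] [IsTopologicalGroup G] {ψ : H →* G}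
    (hψ : Continuous ψ) {Λ : Subgroup G} {Γ : Subgroup H} (hΓ : ∀ γ ∈ Γ, ψ γ ∈ Λ) {C : Set H}
    (hC : IsCompact C) (hCg : ∀ g, ∃ γ ∈ Γ, ∃ c ∈ C, g = γ * c) :
    CompactSpace (ψ.range ⧸ Λ.subgroupOf ψ.range) := by
  have hc : Continuous fun c : H =>
      (QuotientGroup.mk (ψ.rangeRestrict c⁻¹) : ψ.range ⧸ Λ.subgroupOf ψ.range) :=
    QuotientGroup.continuous_mk.comp ((hψ.comp continuous_inv).subtype_mk _)
  refine ⟨?_⟩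
  convert hC.image hc
  refine (Set.eq_univ_iff_forall.2 fun q => ?_).symm
  obtain ⟨g, rfl⟩ := QuotientGroup.mk_surjective q
  obtain ⟨h, rfl⟩ := ψ.rangeRestrict_surjective g
  obtain ⟨γ, hγ, c, hcC, hgc⟩ := hCg h⁻¹
  refine ⟨c, hcC, ?_⟩
  rw [QuotientGroup.eq, Subgroup.mem_subgroupOf]
  have : (ψ.rangeRestrict c⁻¹)⁻¹ * ψ.rangeRestrict h = ψ.rangeRestrict γ⁻¹ := by
    rw [← map_inv, ← map_mul]
    congr 1
    rw [inv_inv, ← inv_inv h, hgc]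
    group
  rw [this]
  exact hΓ _ (Γ.inv_mem hγ)

end abstract_groups

section block_lattices

variable {ι ι₃ : Type} [Fintype ι] [DecidableEq ι] [Fintype ι₃] [DecidableEq ι₃] {k : ℕ}

/-- The indexing of coordinates after adding `k` blocks. -/
def extendIndex (φ₃ : ι₃ ≃ Fin 3 × Fin 2) (θ : ι ≃ ι₃ ⊕ Fin k × Fin 2) :
    ι ≃ (Fin 3 ⊕ Fin k) × Fin 2 :=
  θ.trans ((Equiv.sumCongr φ₃ (Equiv.refl _)).trans (Equiv.sumProdDistrib _ _ _).symm)

lemma extendIndex_inl (φ₃ : ι₃ ≃ Fin 3 × Fin 2) (θ : ι ≃ ι₃ ⊕ Fin k × Fin 2) (i : ι₃) :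
    extendIndex φ₃ θ (θ.symm (Sum.inl i)) = (Sum.inl (φ₃ i).1, (φ₃ i).2) := by
  simp [extendIndex]

lemma extendIndex_inr (φ₃ : ι₃ ≃ Fin 3 × Fin 2) (θ : ι ≃ ι₃ ⊕ Fin k × Fin 2) (p : Fin k × Fin 2) :
    extendIndex φ₃ θ (θ.symm (Sum.inr p)) = (Sum.inr p.1, p.2) := by
  simp [extendIndex]

lemma realize_extend_inl (F : BlockForm (Fin 3)) (φ₃ : ι₃ ≃ Fin 3 × Fin 2)
    (θ : ι ≃ ι₃ ⊕ Fin k × Fin 2) (v : Fin 3 ⊕ Fin k → Zsqrtd 2 × Zsqrtd 2) (i : ι₃) (j : Fin 2) :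
    (F.extend k).realize (extendIndex φ₃ θ) v (θ.symm (Sum.inl i)) j =
      F.realize φ₃ (v ∘ Sum.inl) i j := by
  simp only [BlockForm.realize, Matrix.of_apply, extendIndex_inl, BlockForm.coord]
  split_ifs <;> rfl

lemma realize_extend_inr (F : BlockForm (Fin 3)) (φ₃ : ι₃ ≃ Fin 3 × Fin 2)
    (θ : ι ≃ ι₃ ⊕ Fin k × Fin 2) {v v' : Fin 3 ⊕ Fin k → Zsqrtd 2 × Zsqrtd 2}
    (h : ∀ b, v (Sum.inr b) = v' (Sum.inr b)) (p : Fin k × Fin 2) (j : Fin 2) :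
    (F.extend k).realize (extendIndex φ₃ θ) v (θ.symm (Sum.inr p)) j =
      (F.extend k).realize (extendIndex φ₃ θ) v' (θ.symm (Sum.inr p)) j := by
  have h' : conjVec v (Sum.inr p.1) = conjVec v' (Sum.inr p.1) := by
    rw [conjVec, conjVec, h]
  by_cases hj : j = 0
  · simp only [BlockForm.realize, Matrix.of_apply, extendIndex_inr, BlockForm.coord, if_pos hj]
    rw [h]
  · simp only [BlockForm.realize, Matrix.of_apply, extendIndex_inr, BlockForm.coord, if_neg hj]
    rw [h']

lemma blockEmb_mul_inl {ι' : Type} [Fintype ι'] [DecidableEq ι'] (θ : ι ≃ ι₃ ⊕ ι')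
    (A : Matrix ι₃ ι₃ ℝ) (x : Matrix ι (Fin 2) ℝ) (i : ι₃) (j : Fin 2) :
    (blockEmb θ A * x) (θ.symm (Sum.inl i)) j =
      (A * Matrix.of fun l j => x (θ.symm (Sum.inl l)) j : Matrix ι₃ (Fin 2) ℝ) i j := by
  rw [Matrix.mul_apply, ← θ.symm.sum_comp, Fintype.sum_sum_type, Matrix.mul_apply]
  simp [blockEmb]

lemma blockEmb_mul_inr {ι' : Type} [Fintype ι'] [DecidableEq ι'] (θ : ι ≃ ι₃ ⊕ ι')
    (A : Matrix ι₃ ι₃ ℝ) (x : Matrix ι (Fin 2) ℝ) (i : ι') (j : Fin 2) :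
    (blockEmb θ A * x) (θ.symm (Sum.inr i)) j = x (θ.symm (Sum.inr i)) j := by
  rw [Matrix.mul_apply, ← θ.symm.sum_comp, Fintype.sum_sum_type]
  simp [blockEmb, Matrix.one_apply]

lemma blockHom_mem_latticeStab (F : BlockForm (Fin 3)) (φ₃ : ι₃ ≃ Fin 3 × Fin 2)
    (θ : ι ≃ ι₃ ⊕ Fin k × Fin 2)
    (hε : ∀ i, (F.extend k).signs (extendIndex φ₃ θ) (θ.symm (Sum.inl i)) = F.signs φ₃ i)
    {g : SOQ (diagonal (F.signs φ₃))} (hg : g ∈ latticeStab (diagonal (F.signs φ₃)) (F.basis φ₃)) :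
    SOQ.blockHom θ hε g ∈ latticeStab (diagonal ((F.extend k).signs (extendIndex φ₃ θ)))
      ((F.extend k).basis (extendIndex φ₃ θ)) := by
  have key : ∀ g ∈ latticeStab (diagonal (F.signs φ₃)) (F.basis φ₃),
      ∀ x ∈ colLattice ((F.extend k).basis (extendIndex φ₃ θ)),
        (SOQ.blockHom θ hε g).1.val * x ∈ colLattice ((F.extend k).basis (extendIndex φ₃ θ)) := by
    intro g hg x hx
    obtain ⟨v, rfl⟩ := (BlockForm.mem_colLattice_basis _ _).1 hx
    obtain ⟨v', hv'⟩ := (F.mem_colLattice_basis φ₃).1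
      ((mem_latticeStab.1 hg _).2 ((F.mem_colLattice_basis φ₃).2 ⟨v ∘ Sum.inl, rfl⟩))
    refine (BlockForm.mem_colLattice_basis _ _).2 ⟨Sum.elim v' (v ∘ Sum.inr), ?_⟩
    rw [SOQ.blockHom_val]
    ext i j
    obtain ⟨i | i, rfl⟩ := θ.symm.surjective i
    · have hvl : (Matrix.of fun l j => (F.extend k).realize (extendIndex φ₃ θ) v
          (θ.symm (Sum.inl l)) j : Matrix ι₃ (Fin 2) ℝ) = F.realize φ₃ (v ∘ Sum.inl) := by
        ext l j
        exact realize_extend_inl F φ₃ θ v l j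
      rw [blockEmb_mul_inl, realize_extend_inl, Sum.elim_comp_inl, ← hv', hvl]
    · rw [blockEmb_mul_inr]
      exact realize_extend_inr F φ₃ θ (v := v) (v' := Sum.elim v' (v ∘ Sum.inr)) (fun b => rfl) i j
  refine mem_latticeStab.2 fun x => ⟨fun h => ?_, key g hg x⟩
  have h1 := key g⁻¹ (inv_mem hg) _ h
  rwa [← Matrix.mul_assoc, map_inv, SOQ.inv_mul_val, Matrix.one_mul] at h1

theorem exists_lattice_of_blockForm {N k : ℕ} (hk : 1 ≤ k) (F : BlockForm (Fin 3))
    (φ₃ : ι₃ ≃ Fin 3 × Fin 2) (θ : Fin N ≃ ι₃ ⊕ Fin k × Fin 2) {ε : Fin N → ℝ} {ε₃ : ι₃ → ℝ}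
    (hε : ∀ i, ε i = 1 ∨ ε i = -1) (hinl : ∀ i, ε (θ.symm (Sum.inl i)) = ε₃ i)
    (hinr : ∀ p, ε (θ.symm (Sum.inr p)) = -1) (h₃ : ∀ i, F.signs φ₃ i = ε₃ i) {t : ℤ}
    (ha : F.a = ![-3 * (t : Zsqrtd 2), 1, -⟨2, 1⟩]) (hc : F.c = ![1, 0, 0])
    (hT : F.T 1 = !![1, 0; 0, √3]) (hs₁ : F.s 1 = 1) (hs₂ : F.s 2 = -1) (ht : 0 ≤ t)
    {p m z j₀ : Fin N} (hpm : p ≠ m) (hpz : p ≠ z) (hmz : m ≠ z) (hj : j₀ ∈ otherIdx p m z)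
    (hp : ε p = 1) (hm : ε m = -1)
    [MeasurableSpace (SOQ (diagonal ε))] [BorelSpace (SOQ (diagonal ε))]
    (μ : Measure (SOQ (diagonal ε))) [μ.IsHaarMeasure] :
    ∃ G Λ : Subgroup (SOQ (diagonal ε)), IsClosed (G : Set (SOQ (diagonal ε))) ∧
      Isogenous G (SOQ (diagonal ε₃)) ∧ IsLattice μ Λ ∧ ¬ CompactSpace (SOQ (diagonal ε) ⧸ Λ) ∧
      DiscreteTopology (Λ.subgroupOf G) ∧ CompactSpace (G ⧸ Λ.subgroupOf G) := by
  obtain rfl : F.signs φ₃ = ε₃ := funext h₃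
  obtain rfl : (F.extend k).signs (extendIndex φ₃ θ) = ε := by
    funext i
    obtain ⟨i | i, rfl⟩ := θ.symm.surjective i
    · rw [hinl, BlockForm.signs, extendIndex_inl]
      rfl
    · rw [hinr, BlockForm.signs, extendIndex_inr]
      rfl
  have hsq : ∀ i, (F.extend k).signs (extendIndex φ₃ θ) i *
      (F.extend k).signs (extendIndex φ₃ θ) i = 1 := fun i => by
    rcases hε i with h | h <;> rw [h] <;> norm_num
  have hJ : diagonal ((F.extend k).signs (extendIndex φ₃ θ)) *
      diagonal ((F.extend k).signs (extendIndex φ₃ θ)) = 1 := by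
    rw [diagonal_mul_diagonal, ← diagonal_one]
    congr 1
    exact funext hsq
  have hJ₃ : diagonal (F.signs φ₃) * diagonal (F.signs φ₃) = 1 := by
    rw [diagonal_mul_diagonal, ← diagonal_one]
    congr 1
    funext i
    rw [← hinl]
    exact hsq _
  have hdisc := (F.extend k).hasDiscreteForm (extendIndex φ₃ θ)
  have hcusp : HasRankOneCusps (diagonal ((F.extend k).signs (extendIndex φ₃ θ)))
      ((F.extend k).basis (extendIndex φ₃ θ)) := by
    refine (F.extend k).hasRankOneCusps (extendIndex φ₃ θ) (b₀ := Sum.inl 0) (b₁ := Sum.inl 1) ?_ ?_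
    · rintro (b | b) h0 h1 j
      · show F.s b j = -1
        fin_cases b
        · exact absurd rfl h0
        · exact absurd rfl h1
        · exact congrFun hs₂ j
      · rfl
    · show sqrtTwoEmb (F.a 0) - 2 * (F.c 0 : ℝ) + 3 * sqrtTwoEmb (star (F.a 0)) < 0
      have h0 : F.a 0 = ((-3 * t : ℤ) : Zsqrtd 2) := by
        rw [ha]
        simp
      have h1 : F.c 0 = 1 := by
        rw [hc]
        rfl
      have ht' : (0 : ℝ) ≤ t := by exact_mod_cast ht
      rw [h0, h1, star_intCast, map_intCast]
      push_cast
      linarith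
  have hψ := SOQ.isClosedEmbedding_blockHom θ hinl hJ hJ₃
  have hΛ := HasDiscreteForm.discreteTopology hdisc hJ (diagonal_transpose _)
  obtain ⟨C, hC, hCg⟩ := exists_compact_of_anisotropic (F.hasDiscreteForm φ₃) hJ₃
    (F.isotropicVectors_eq_empty φ₃ ha hc)
  refine ⟨(SOQ.blockHom θ hinl).range, latticeStab _ ((F.extend k).basis (extendIndex φ₃ θ)),
    ?_, Isogenous.range hψ,
    isLattice_latticeStab hε hpm hpz hmz hj hp hm hdisc hcusp μ, ?_,
    discreteTopology_subgroupOf _ _,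
    compactSpace_range_quotient hψ.continuous
      (fun γ hγ => blockHom_mem_latticeStab F φ₃ θ hinl hγ) hC hCg⟩
  · rw [MonoidHom.coe_range]
    exact hψ.isClosed_range
  · refine not_compactSpace_of_hyperbolic (F.extend k) (extendIndex φ₃ θ)
      (b₁ := Sum.inl 1) (b₂ := Sum.inr ⟨0, hk⟩) ?_ rfl ?_ rfl hT rfl ?_ rfl ?_
    · show F.a 1 = 1
      rw [ha]
      rfl
    · show F.c 1 = 0
      rw [hc]
      rfl
    · show F.s 1 0 = 1
      rw [hs₁]
      rfl
    · intro b j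
      obtain ⟨i, hi⟩ := (extendIndex φ₃ θ).surjective (b, j)
      have := hsq i
      rwa [BlockForm.signs, hi] at this

end block_lattices

section indexing

/-- The splitting of the coordinates into the first `n + m` and the last `2k` ones. -/
def splitIndex (n m k : ℕ) : Fin (n + (2 * k + m)) ≃ Fin (n + m) ⊕ Fin k × Fin 2 :=
  (finCongr (by ring)).trans (finSumFinEquiv.symm.trans
    (Equiv.sumCongr (Equiv.refl (Fin (n + m))) finProdFinEquiv.symm))

lemma splitIndex_symm_inl (n m k : ℕ) (i : Fin (n + m)) :
    (((splitIndex n m k).symm (Sum.inl i) : Fin _) : ℕ) = i := by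
  simp [splitIndex]

lemma le_splitIndex_symm_inr (n m k : ℕ) (p : Fin k × Fin 2) :
    n + m ≤ (((splitIndex n m k).symm (Sum.inr p) : Fin _) : ℕ) := by
  simp [splitIndex]

theorem exists_lattice_SOnm {n m k : ℕ} (hn : 2 ≤ n) (hm : 2 ≤ m) (hk : 1 ≤ k)
    (F : BlockForm (Fin 3)) (φ₃ : Fin (n + m) ≃ Fin 3 × Fin 2)
    (h₃ : ∀ i, F.signs φ₃ i = if (i : ℕ) < n then 1 else -1) {t : ℤ}
    (ha : F.a = ![-3 * (t : Zsqrtd 2), 1, -⟨2, 1⟩]) (hc : F.c = ![1, 0, 0])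
    (hT : F.T 1 = !![1, 0; 0, √3]) (hs₁ : F.s 1 = 1) (hs₂ : F.s 2 = -1) (ht : 0 ≤ t)
    [MeasurableSpace ↥(SOnm n (2 * k + m))] [BorelSpace ↥(SOnm n (2 * k + m))]
    (μ : Measure ↥(SOnm n (2 * k + m))) [μ.IsHaarMeasure] :
    ∃ G Λ : Subgroup ↥(SOnm n (2 * k + m)), IsClosed (G : Set ↥(SOnm n (2 * k + m))) ∧
      Isogenous ↥G ↥(SOnm n m) ∧ IsLattice μ Λ ∧
      ¬ CompactSpace (↥(SOnm n (2 * k + m)) ⧸ Λ) ∧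
      DiscreteTopology ↥(Λ.subgroupOf G) ∧ CompactSpace (↥G ⧸ Λ.subgroupOf G) := by
  let J : Matrix (Fin (n + (2 * k + m))) (Fin (n + (2 * k + m))) ℝ :=
    diagonal fun i => if (i : ℕ) < n then (1 : ℝ) else -1
  let i₁ : MeasurableSpace (SOQ J) := ‹MeasurableSpace ↥(SOnm n (2 * k + m))›
  have i₂ : BorelSpace (SOQ J) := ‹BorelSpace ↥(SOnm n (2 * k + m))›
  have i₃ : (show Measure (SOQ J) from μ).IsHaarMeasure := ‹μ.IsHaarMeasure›
  refine exists_lattice_of_blockForm (N := n + (2 * k + m)) hk F φ₃ (splitIndex n m k)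
    (ε := fun i => if (i : ℕ) < n then 1 else -1) (ε₃ := fun i => if (i : ℕ) < n then 1 else -1)
    ?_ ?_ ?_ h₃ ha hc hT hs₁ hs₂ ht (p := ⟨0, by omega⟩) (m := ⟨n, by omega⟩)
    (z := ⟨1, by omega⟩) (j₀ := ⟨n + 1, by omega⟩) ?_ ?_ ?_ ?_ ?_ ?_ μ
  · intro i
    by_cases h : (i : ℕ) < n
    · exact Or.inl (if_pos h)
    · exact Or.inr (if_neg h)
  · intro i
    simp only [splitIndex_symm_inl]
  · intro p
    have := le_splitIndex_symm_inr n m k p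
    exact if_neg (by omega)
  · simp [Fin.ext_iff]
    omega
  · simp [Fin.ext_iff]
  · simp [Fin.ext_iff]
    omega
  · simp [mem_otherIdx, Fin.ext_iff]
    omega
  · exact if_pos (show 0 < n by omega)
  · exact if_neg (lt_irrefl n)

/-- The order of coordinates in signature `(3, 3)`. -/
noncomputable def indexThreeThree : Fin (3 + 3) ≃ Fin 3 × Fin 2 :=
  Equiv.ofBijective ![(0, 0), (1, 0), (1, 1), (0, 1), (2, 0), (2, 1)] (by decide)

/-- The order of coordinates in signature `(2, 4)`. -/
noncomputable def indexTwoFour : Fin (2 + 4) ≃ Fin 3 × Fin 2 :=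
  Equiv.ofBijective ![(1, 0), (1, 1), (0, 0), (0, 1), (2, 0), (2, 1)] (by decide)

/-- The form of signature `(3, 3)`. -/
noncomputable def formThreeThree : BlockForm (Fin 3) :=
  have h : √2 * √2 = 2 := Real.mul_self_sqrt (by norm_num)
  have h0 : √2 ≠ 0 := by positivity
  BlockForm.ternary 0 !![1 / √2, 1 / √2; 1 / √2, -(1 / √2)] ![1, -1]
    (by simp) (by
      simp
      field_simp
      linarith) (by simp) (by
      simp
      field_simp
      intro h1
      linarith)

/-- The form of signature `(2, 4)`. -/
noncomputable def formTwoFour : BlockForm (Fin 3) :=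
  have h : √3 * √3 = 3 := Real.mul_self_sqrt (by norm_num)
  have h' : √(26 / 3) * √(26 / 3) = 26 / 3 := Real.mul_self_sqrt (by norm_num)
  have h0 : √3 ≠ 0 := by positivity
  have h0' : √(26 / 3) ≠ 0 := by positivity
  BlockForm.ternary 1 !![√3, -(1 / √3); 0, √(26 / 3)] ![-1, -1]
    (by
      show (-1 : ℝ) * (√3 * √3) + -1 * (0 * 0) = -3 * ((1 : ℤ) : ℝ)
      rw [h]
      norm_num)
    (by
      show (-1 : ℝ) * (√3 * -(1 / √3)) + -1 * (0 * √(26 / 3)) = 1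
      field_simp
      norm_num)
    (by
      show (-1 : ℝ) * (-(1 / √3) * -(1 / √3)) + -1 * (√(26 / 3) * √(26 / 3)) = -9 * ((1 : ℤ) : ℝ)
      have h1 : -(1 / √3) * -(1 / √3) = 1 / (√3 * √3) := by
        field_simp
      rw [h', h1, h]
      norm_num)
    (by
      show √3 * √(26 / 3) - -(1 / √3) * 0 ≠ 0
      rw [mul_zero, sub_zero]
      exact mul_ne_zero h0 h0')

end indexing

/-- For `(n,m) ∈ {(2,4),(3,3)}` and `q = 2k + m` with `k ≥ 1`, there are a closed subgroup
`G` of `SO(n,q)` isogenous to `SO(n,m)` and a non-cocompact lattice `Λ` in `SO(n,q)` such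
that `Λ ∩ G` is a cocompact lattice in `G`. -/
theorem exists_noncocompact_lattice_with_cocompact_intersection
    (n m k : ℕ) (hnm : (n, m) = (2, 4) ∨ (n, m) = (3, 3)) (hk : 1 ≤ k)
    [MeasurableSpace ↥(SOnm n (2 * k + m))] [BorelSpace ↥(SOnm n (2 * k + m))]
    (μ : Measure ↥(SOnm n (2 * k + m))) [μ.IsHaarMeasure] :
    ∃ G Λ : Subgroup ↥(SOnm n (2 * k + m)),
      IsClosed (G : Set ↥(SOnm n (2 * k + m))) ∧
      Isogenous ↥G ↥(SOnm n m) ∧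
      IsLattice μ Λ ∧
      ¬ CompactSpace (↥(SOnm n (2 * k + m)) ⧸ Λ) ∧
      DiscreteTopology ↥(Λ.subgroupOf G) ∧
      CompactSpace (↥G ⧸ Λ.subgroupOf G) := by
  rcases hnm with h | h
  · obtain ⟨rfl, rfl⟩ := Prod.mk.inj h
    refine exists_lattice_SOnm (by norm_num) (by norm_num) hk formTwoFour indexTwoFour ?_ (t := 1)
      rfl rfl rfl rfl rfl (by norm_num) μ
    intro i
    fin_cases i <;> simp [BlockForm.signs, indexTwoFour, formTwoFour, BlockForm.ternary]
  · obtain ⟨rfl, rfl⟩ := Prod.mk.inj h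
    refine exists_lattice_SOnm (by norm_num) (by norm_num) hk formThreeThree indexThreeThree ?_
      (t := 0) rfl rfl rfl rfl rfl le_rfl μ
    intro i
    fin_cases i <;> simp [BlockForm.signs, indexThreeThree, formThreeThree, BlockForm.ternary]
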